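/- arXiv:math/0612178 — 3 statements merged into one kernel-verified Lean document; each statement's English description precedes it below -/
import Mathlib

section
/- There are no infinite torsion groups among the groups generated by invertible automata with 3 states over a 2-letter alphabet: every such automaton group is either finite or contains an element of infinite order. -/
/-- An invertible automaton over the two-letter alphabet `Bool`:
a set of states `Q`, a transition map and an output map such that each state
acts on the alphabet by a permutation. -/
structure BinAutomaton (Q : Type*) where
  trans : Q → Bool → Q
  out : Q → Bool → Bool
  out_bij : ∀ q, Function.Bijective (out q)

namespace BinAutomaton

variable {Q : Type*} (A : BinAutomaton Q)

/-- The action of a state on finite binary words: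
`q(xw) = ρ(q,x) · (τ(q,x))(w)`. -/
def act : Q → List Bool → List Bool
  | _, [] => []
  | q, x :: w => A.out q x :: act (A.trans q x) w

theorem act_injective (q : Q) : Function.Injective (A.act q) := by
  intro u
  induction u generalizing q with
  | nil =>
    intro v h
    cases v with
    | nil => rfl
    | cons y v => simp [act] at h
  | cons x u ih =>
    intro v h
    cases v with
    | nil => simp [act] at h
    | cons y v =>
      simp only [act, List.cons.injEq] at h
      obtain ⟨h1, h2⟩ := h
      obtain rfl : x = y := (A.out_bij q).1 h1
      rw [ih _ h2]

theorem act_surjective (q : Q) : Function.Surjective (A.act q) := by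
  intro v
  induction v generalizing q with
  | nil => exact ⟨[], rfl⟩
  | cons y v ih =>
    obtain ⟨x, hx⟩ := (A.out_bij q).2 y
    obtain ⟨w, hw⟩ := ih (A.trans q x)
    exact ⟨x :: w, by simp [act, hx, hw]⟩

/-- The tree automorphism defined by the state `q`. -/
noncomputable def perm (q : Q) : Equiv.Perm (List Bool) :=
  Equiv.ofBijective (A.act q) ⟨A.act_injective q, A.act_surjective q⟩

/-- The group generated by the automaton: the subgroup of the group of
bijections of the binary tree generated by the states. -/
noncomputable def autGroup : Subgroup (Equiv.Perm (List Bool)) :=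
  Subgroup.closure (Set.range A.perm)

end BinAutomaton

/-- Helper constructing a 3-state automaton from the sections at `0`, the
sections at `1`, and the activity of each state. -/
def mkAut3 (t0 t1 : Fin 3 → Fin 3) (actv : Fin 3 → Bool) : BinAutomaton (Fin 3) where
  trans q x := cond x (t1 q) (t0 q)
  out q x := xor (actv q) x
  out_bij q := by
    have h : ∀ b : Bool, Function.Bijective fun x => xor b x := by decide
    exact h (actv q)


/-! ## Words of states and their sections -/

namespace BinAutomaton

section Words

variable {E : Type} (M : BinAutomaton E)

/-- section of a word of states (applied left to right) at a letter -/
def wsec : List E → Bool → List E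
  | [], _ => []
  | q :: w, x => M.trans q x :: wsec w (M.out q x)

/-- action of a word of states on a letter -/
def wout : List E → Bool → Bool
  | [], x => x
  | q :: w, x => wout w (M.out q x)

/-- the automorphism induced by a word -/
noncomputable def wperm : List E → Equiv.Perm (List Bool)
  | [] => 1
  | q :: w => wperm w * M.perm q

theorem perm_apply (q : E) (v : List Bool) : M.perm q v = M.act q v := rfl

theorem wperm_nil_apply (w : List E) : M.wperm w [] = [] := by
  induction w with
  | nil => rfl
  | cons q w ih => simp [wperm, perm_apply, act, ih]

theorem wperm_cons_apply (w : List E) (x : Bool) (v : List Bool) :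
    M.wperm w (x :: v) = M.wout w x :: M.wperm (M.wsec w x) v := by
  induction w generalizing x v with
  | nil => rfl
  | cons q w ih => simp [wperm, perm_apply, act, ih, wout, wsec]

theorem wperm_append (u v : List E) : M.wperm (u ++ v) = M.wperm v * M.wperm u := by
  induction u with
  | nil => simp [wperm]
  | cons q u ih => simp [wperm, ih, mul_assoc]

theorem wout_append (u v : List E) (x : Bool) :
    M.wout (u ++ v) x = M.wout v (M.wout u x) := by
  induction u generalizing x with
  | nil => rfl
  | cons q u ih => simp [wout, ih]

theorem wsec_append (u v : List E) (x : Bool) :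
    M.wsec (u ++ v) x = M.wsec u x ++ M.wsec v (M.wout u x) := by
  induction u generalizing x with
  | nil => rfl
  | cons q u ih => simp [wout, wsec, ih]

theorem out_not (q : E) (x : Bool) : M.out q (!x) = !(M.out q x) := by
  have h := (M.out_bij q).1
  have h1 : M.out q (!x) ≠ M.out q x := fun e => by
    have := h e
    cases x <;> simp at this
  cases h2 : M.out q (!x) <;> cases h3 : M.out q x <;> simp_all

theorem wout_not (w : List E) (x : Bool) : M.wout w (!x) = !(M.wout w x) := by
  induction w generalizing x with
  | nil => rfl
  | cons q w ih => simp [wout, out_not, ih]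

/-- activity of a word -/
def wact (w : List E) : Bool := M.wout w false

theorem wout_eq (w : List E) (x : Bool) : M.wout w x = xor (M.wact w) x := by
  cases x
  · simp [wact]
  · have := M.wout_not w false
    simp at this
    simp [wact, this]

theorem wact_append (u v : List E) : M.wact (u ++ v) = xor (M.wact u) (M.wact v) := by
  unfold wact
  rw [wout_append, wout_eq, wact, Bool.xor_comm]

/-! ## Orders -/

theorem pow_inactive {w : List E} (h : M.wact w = false) (n : ℕ) (x : Bool) (v : List Bool) :
    ((M.wperm w) ^ n) (x :: v) = x :: ((M.wperm (M.wsec w x)) ^ n) v := by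
  induction n generalizing v with
  | zero => rfl
  | succ n ih =>
    rw [pow_succ, pow_succ, Equiv.Perm.mul_apply, wperm_cons_apply, wout_eq, h]
    simp only [Bool.false_xor, Equiv.Perm.mul_apply]
    exact ih _

theorem sec_of_inactive {w : List E} (h : M.wact w = false) {n : ℕ}
    (hn : (M.wperm w) ^ n = 1) (x : Bool) : (M.wperm (M.wsec w x)) ^ n = 1 := by
  ext1 v
  have := M.pow_inactive h n x v
  rw [hn] at this
  simp at this
  simpa using this.symm

theorem sec_of_active {w : List E} (h : M.wact w = true) {n : ℕ}
    (hn : (M.wperm w) ^ n = 1) (x : Bool) :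
    ∃ m, n = 2 * m ∧ (M.wperm (M.wsec (w ++ w) x)) ^ m = 1 := by
  have h2 : M.wact (w ++ w) = false := by simp [wact_append]
  have hp : M.wperm (w ++ w) = M.wperm w ^ 2 := by rw [wperm_append, sq]
  rcases Nat.even_or_odd' n with ⟨m, rfl | rfl⟩
  · refine ⟨m, rfl, ?_⟩
    apply M.sec_of_inactive h2
    rw [hp, ← pow_mul, hn]
  · exfalso
    have h3 := M.pow_inactive h2 m false []
    rw [hp, ← pow_mul] at h3
    rw [pow_succ'] at hn
    have h4 : M.wperm w ((M.wperm w ^ (2 * m)) [false]) = [false] := by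
      rw [← Equiv.Perm.mul_apply, hn]; rfl
    rw [h3, wperm_cons_apply, wout_eq, h] at h4
    simp at h4

theorem trivial_of_odd (v : List Bool) : ∀ (w : List E) (m : ℕ),
    (M.wperm w) ^ (2 * m + 1) = 1 → M.wperm w v = v := by
  induction v with
  | nil => intro w m _; exact M.wperm_nil_apply w
  | cons x v ih =>
    intro w m h
    cases ha : M.wact w
    · rw [wperm_cons_apply, wout_eq, ha, ih _ m (M.sec_of_inactive ha h x)]
      simp
    · obtain ⟨k, hk, _⟩ := M.sec_of_active ha h false
      omega

/-- power of a word -/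
theorem exists_word_pow (w : List E) (n : ℕ) : ∃ u, M.wperm u = M.wperm w ^ n := by
  induction n with
  | zero => exact ⟨[], rfl⟩
  | succ n ih =>
    obtain ⟨u, hu⟩ := ih
    exact ⟨u ++ w, by rw [wperm_append, hu, pow_succ']⟩

theorem two_pow_of_finite {w : List E} {n : ℕ} (hn : 0 < n) (h : M.wperm w ^ n = 1) :
    ∃ k, M.wperm w ^ (2 ^ k) = 1 := by
  obtain ⟨k, m, hm, rfl⟩ := Nat.exists_eq_two_pow_mul_odd (n := n) (by omega)
  obtain ⟨r, rfl⟩ := hm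
  obtain ⟨u, hu⟩ := M.exists_word_pow w (2 ^ k)
  refine ⟨k, ?_⟩
  rw [← hu]
  ext1 v
  exact M.trivial_of_odd v u r (by rw [hu, ← pow_mul, h])

/-! ## Parity criterion -/

/-- parity of the number of active vertices of the `n`-th level -/
def par : ℕ → List E → Bool
  | 0, w => M.wact w
  | n + 1, w => xor (par n (M.wsec w false)) (par n (M.wsec w true))

theorem par_append (n : ℕ) (u v : List E) :
    M.par n (u ++ v) = xor (M.par n u) (M.par n v) := by
  induction n generalizing u v with
  | zero => exact M.wact_append u v
  | succ n ih =>
    simp only [par, wsec_append, ih, wout_eq]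
    cases M.wact u <;> simp <;> 
    cases M.par n (M.wsec u false) <;> cases M.par n (M.wsec u true) <;>
    cases M.par n (M.wsec v false) <;> cases M.par n (M.wsec v true) <;> rfl

theorem par_infinite (n : ℕ) : 0 < n → ∀ w, (∀ k, M.par k w = true) → M.wperm w ^ n ≠ 1 := by
  induction n using Nat.strong_induction_on with
  | _ n ih =>
    intro hn w hw h
    have ha : M.wact w = true := hw 0
    obtain ⟨m, rfl, hm⟩ := M.sec_of_active ha h false
    refine ih m (by omega) (by omega) _ ?_ hm
    intro k
    have := hw (k + 1)
    rw [wsec_append, par_append, wout_eq, ha]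
    simpa [par] using this

/-! ## Triviality check -/

set_option linter.unusedSectionVars false

/-- letters which can be compared and normalised quickly -/
class Forc (E : Type) where
  eqb : E → E → Bool
  eqb_iff : ∀ x y, eqb x y = true ↔ x = y
  force : E → (E → Bool) → Bool
  force_eq : ∀ x k, force x k = k x

variable [Forc E]

/-- comparison of words -/
def eqW : List E → List E → Bool
  | [], [] => true
  | [], _ :: _ => false
  | _ :: _, [] => false
  | x :: u, y :: v => match Forc.eqb x y with
    | true => eqW u v
    | false => false

theorem eqW_iff (u v : List E) : eqW u v = true ↔ u = v := by
  induction u generalizing v with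
  | nil => cases v <;> simp [eqW]
  | cons x u ih =>
    cases v with
    | nil => simp [eqW]
    | cons y v =>
      rw [eqW, List.cons.injEq, ← Forc.eqb_iff x y, ← ih]
      cases Forc.eqb x y <;> simp

/-- normalisation of a word before it is used -/
def forceW : List E → (List E → Bool) → Bool
  | [], k => k []
  | x :: u, k => Forc.force x fun y => forceW u fun v => k (y :: v)

theorem forceW_eq (u : List E) (k : List E → Bool) : forceW u k = k u := by
  induction u generalizing k with
  | nil => rfl
  | cons x u ih => rw [forceW, Forc.force_eq, ih]

/-- membership in a list of words -/
def memW (u : List E) : List (List E) → Bool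
  | [] => false
  | v :: l => match eqW u v with
    | true => true
    | false => memW u l

theorem memW_iff (u : List E) (l : List (List E)) : memW u l = true ↔ u ∈ l := by
  induction l with
  | nil => simp [memW]
  | cons v l ih =>
    rw [memW, List.mem_cons, ← ih, ← eqW_iff u v]
    cases eqW u v <;> simp

/-- free reduction of a word -/
def redW (inv : E → E) : List E → (List E → Bool) → Bool
  | [], k => k []
  | x :: u, k => Forc.force x fun y => redW inv u fun v =>
    match v with
    | [] => k [y]
    | z :: v => match Forc.eqb (inv y) z with
      | true => k v
      | false => k (y :: z :: v)

theorem redW_spec {inv : E → E} (hinv : ∀ e, M.perm (inv e) = (M.perm e)⁻¹) (u : List E) :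
    ∀ k, redW inv u k = true → ∃ v, M.wperm v = M.wperm u ∧ k v = true := by
  induction u with
  | nil => intro k h; exact ⟨[], rfl, h⟩
  | cons x u ih =>
    intro k h
    rw [redW, Forc.force_eq] at h
    obtain ⟨v, hv, hk⟩ := ih _ h
    split at hk
    · exact ⟨_, by simp only [wperm] at hv ⊢; rw [hv], hk⟩
    · rename_i z v
      split at hk
      · rename_i e
        rw [Forc.eqb_iff] at e
        refine ⟨_, ?_, hk⟩
        rw [wperm, ← hv, wperm, ← e, hinv, inv_mul_cancel_right]
      · exact ⟨_, by rw [wperm, hv, wperm], hk⟩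

/-- search through all sections for an active one -/
def bfs (inv : E → E) : ℕ → List (List E) → List (List E) → Bool
  | 0, _, _ => false
  | _ + 1, [], _ => true
  | n + 1, u :: todo, seen =>
    match M.wact u with
    | true => false
    | false =>
      redW inv (M.wsec u false) fun u0 => redW inv (M.wsec u true) fun u1 =>
      match memW u0 seen, memW u1 (u0 :: seen) with
      | true, true => bfs inv n todo seen
      | true, false => bfs inv n (u1 :: todo) (u1 :: seen)
      | false, true => bfs inv n (u0 :: todo) (u0 :: seen)
      | false, false => bfs inv n (u1 :: u0 :: todo) (u1 :: u0 :: seen)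

theorem bfs_sound {inv : E → E} (hinv : ∀ e, M.perm (inv e) = (M.perm e)⁻¹) (n : ℕ) :
    ∀ todo seen, M.bfs inv n todo seen = true →
    (∀ u ∈ seen, u ∈ todo ∨
      (M.wact u = false ∧ ∀ x, ∃ v ∈ seen, M.wperm v = M.wperm (M.wsec u x))) →
    ∃ S : List (List E), (∀ u ∈ seen, u ∈ S) ∧
      ∀ u ∈ S, M.wact u = false ∧ ∀ x, ∃ v ∈ S, M.wperm v = M.wperm (M.wsec u x) := by
  induction n with
  | zero => intro _ _ h; simp [bfs] at h
  | succ n ih =>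
    intro todo seen h hsn
    cases todo with
    | nil => exact ⟨seen, fun u hu => hu, fun u hu => by simpa using hsn u hu⟩
    | cons u todo =>
      have key : ∀ todo' seen', M.bfs inv n todo' seen' = true → M.wact u = false →
          (∀ v ∈ seen, v ∈ seen') → (∀ v ∈ todo, v ∈ todo') →
          (∀ v ∈ seen', v ∈ seen ∨ v ∈ todo') →
          (∀ x, ∃ v ∈ seen', M.wperm v = M.wperm (M.wsec u x)) →
          ∃ S : List (List E), (∀ u ∈ seen, u ∈ S) ∧
            ∀ u ∈ S, M.wact u = false ∧ ∀ x, ∃ v ∈ S, M.wperm v = M.wperm (M.wsec u x) := by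
        intro todo' seen' hb ha h1 h2 h3 h4
        obtain ⟨S, hS1, hS2⟩ := ih todo' seen' hb (by
          intro v hv
          rcases h3 v hv with hv | hv
          · rcases hsn v hv with hv' | ⟨hv1, hv2⟩
            · rcases List.mem_cons.1 hv' with rfl | hv'
              · exact Or.inr ⟨ha, h4⟩
              · exact Or.inl (h2 v hv')
            · refine Or.inr ⟨hv1, fun x => ?_⟩
              obtain ⟨v', hv', e⟩ := hv2 x
              exact ⟨v', h1 _ hv', e⟩
          · exact Or.inl hv)
        exact ⟨S, fun v hv => hS1 v (h1 v hv), hS2⟩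
      rw [bfs] at h
      split at h
      · simp at h
      · rename_i ha
        obtain ⟨u0, hu0, h⟩ := M.redW_spec hinv _ _ h
        obtain ⟨u1, hu1, h⟩ := M.redW_spec hinv _ _ h
        split at h
        all_goals
          rename_i e0 e1
          first
            | rw [memW_iff] at e0
            | rw [← Bool.not_eq_true, memW_iff] at e0
          first
            | rw [memW_iff] at e1
            | rw [← Bool.not_eq_true, memW_iff] at e1
          refine key _ _ h ha ?_ ?_ ?_ ?_
          · intro v hv; simp [hv]
          · intro v hv; simp [hv]
          · intro v hv; try simp only [List.mem_cons] at hv ⊢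
            tauto
          · intro x
            cases x
            · refine ⟨u0, ?_, hu0⟩
              first | exact e0 | simp [e0]
            · refine ⟨u1, ?_, hu1⟩
              first | (simp; done) | (rcases List.mem_cons.1 e1 with e1 | e1 <;> simp_all)

/-- checks that the word is trivial in the group -/
def isTriv (inv : E → E) (w : List E) : Bool :=
  redW inv w fun w => M.bfs inv 400 [w] [w]

theorem isTriv_sound {inv : E → E} (hinv : ∀ e, M.perm (inv e) = (M.perm e)⁻¹)
    {w : List E} (h : M.isTriv inv w = true) : M.wperm w = 1 := by
  obtain ⟨w', hw, h⟩ := M.redW_spec hinv _ _ h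
  rw [← hw]
  obtain ⟨S, h1, h2⟩ := M.bfs_sound hinv _ _ _ h (by simp)
  have : ∀ v : List Bool, ∀ u ∈ S, M.wperm u v = v := by
    intro v
    induction v with
    | nil => intro u _; exact M.wperm_nil_apply u
    | cons x v ih =>
      intro u hu
      obtain ⟨u', hu', e⟩ := (h2 u hu).2 x
      rw [wperm_cons_apply, wout_eq, (h2 u hu).1, ← e, ih _ hu']
      simp
  ext1 v
  exact this v w' (h1 w' (by simp))

/-! ## Inverse letters and the cycle criterion -/

/-- inverse of a word -/
def invW (inv : E → E) (w : List E) : List E := (w.map inv).reverse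

theorem wperm_invW {inv : E → E} (hinv : ∀ e, M.perm (inv e) = (M.perm e)⁻¹) (w : List E) :
    M.wperm (invW inv w) = (M.wperm w)⁻¹ := by
  induction w with
  | nil => simp [invW, wperm]
  | cons q w ih =>
    have : invW inv (q :: w) = invW inv w ++ [inv q] := by simp [invW]
    rw [this, wperm_append, ih]
    simp [wperm, hinv]

/-- one step: the first return section -/
def step (w : List E) (x : Bool) : List E :=
  match M.wact w with
  | true => M.wsec (w ++ w) x
  | false => M.wsec w x

/-- iterated steps -/
def run : List E → List Bool → List E
  | w, [] => w
  | w, x :: xs => run (M.step w x) xs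

/-- whether one of the steps was active -/
def dbl : List E → List Bool → Bool
  | _, [] => false
  | w, x :: xs => M.wact w || dbl (M.step w x) xs

theorem run_spec (xs : List Bool) : ∀ (w : List E) (n : ℕ), 0 < n → M.wperm w ^ n = 1 →
    ∃ m, 0 < m ∧ m ≤ n ∧ (M.dbl w xs = true → m < n) ∧ M.wperm (M.run w xs) ^ m = 1 := by
  induction xs with
  | nil => intro w n hn h; exact ⟨n, hn, le_rfl, by simp [dbl], h⟩
  | cons x xs ih =>
    intro w n hn h
    cases ha : M.wact w
    · have hs : M.step w x = M.wsec w x := by simp [step, ha]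
      obtain ⟨m, h1, h2, h3, h4⟩ := ih (M.step w x) n hn (by
        rw [hs]; exact M.sec_of_inactive ha h x)
      exact ⟨m, h1, h2, by simpa [dbl, ha] using h3, h4⟩
    · have hs : M.step w x = M.wsec (w ++ w) x := by simp [step, ha]
      obtain ⟨k, rfl, hk⟩ := M.sec_of_active ha h x
      obtain ⟨m, h1, h2, h3, h4⟩ := ih (M.step w x) k (by omega) (by rw [hs]; exact hk)
      exact ⟨m, h1, by omega, fun _ => by omega, h4⟩

/-- the cycle check -/
def cycChk (inv : E → E) (w : List E) (xs : List Bool) (t : List E) (sg : Bool) : Bool :=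
  M.dbl w xs && M.isTriv inv (M.run w xs ++ (invW inv t ++ ((match sg with
    | true => w
    | false => invW inv w) ++ t)))

theorem cyc_sound {inv : E → E} (hinv : ∀ e, M.perm (inv e) = (M.perm e)⁻¹)
    {w : List E} {xs : List Bool} {t : List E} {sg : Bool}
    (h : M.cycChk inv w xs t sg = true) (n : ℕ) : 0 < n → M.wperm w ^ n ≠ 1 := by
  unfold cycChk at h
  rw [Bool.and_eq_true] at h
  obtain ⟨hd, ht⟩ := h
  have ht := M.isTriv_sound hinv ht
  induction n using Nat.strong_induction_on with
  | _ n ih =>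
    intro hn hw
    obtain ⟨m, h1, h2, h3, h4⟩ := M.run_spec xs w n hn hw
    refine ih m (h3 hd) h1 ?_
    simp only [wperm_append, M.wperm_invW hinv] at ht
    set T := M.wperm t
    set R := M.wperm (M.run w xs)
    cases sg
    · simp only [M.wperm_invW hinv] at ht
      have hR : R = T * M.wperm w * T⁻¹ := by
        rw [mul_assoc, mul_assoc] at ht
        rw [← mul_assoc, ← mul_assoc] at ht
        have := eq_inv_of_mul_eq_one_right ht
        rw [this]; group
      rw [hR, conj_pow] at h4
      exact conj_eq_one_iff.1 h4
    · have hR : R = T * (M.wperm w)⁻¹ * T⁻¹ := by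
        rw [mul_assoc, mul_assoc] at ht
        rw [← mul_assoc, ← mul_assoc] at ht
        have := eq_inv_of_mul_eq_one_right ht
        rw [this]; group
      rw [hR, conj_pow] at h4
      have := conj_eq_one_iff.1 h4
      simpa using this

/-! ## Finiteness -/

/-- every product `u q` is in the list, up to equality in the group -/
def finChk (inv : E → E) (gens : List E) (els : List (List E)) : Bool :=
  memW [] els && els.all fun u => gens.all fun q =>
    els.any fun v => M.isTriv inv (u ++ (q :: invW inv v))

theorem fin_sound {inv : E → E} (hinv : ∀ e, M.perm (inv e) = (M.perm e)⁻¹)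
    {gens : List E} {els : List (List E)} (h : M.finChk inv gens els = true) :
    Finite (Subgroup.closure {g | ∃ q ∈ gens, g = M.perm q}) := by
  rw [finChk, Bool.and_eq_true, memW_iff] at h
  obtain ⟨h1, h2⟩ := h
  have h2 : ∀ u ∈ els, ∀ q ∈ gens, ∃ v ∈ els, M.isTriv inv (u ++ (q :: invW inv v)) = true := by
    simpa [List.all_eq_true, List.any_eq_true] using h2
  let S : Set (Equiv.Perm (List Bool)) := {g | ∃ u ∈ els, g = M.wperm u}
  have hS : S.Finite := by
    have : S = M.wperm '' {u | u ∈ els} := by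
      ext g; simp [S, eq_comm]
    rw [this]
    exact (List.finite_toSet els).image _
  have hmul : ∀ q ∈ gens, ∀ g ∈ S, M.perm q * g ∈ S := by
    rintro q hq g ⟨u, hu, rfl⟩
    obtain ⟨v, hv, hvt⟩ := h2 u hu q hq
    refine ⟨v, hv, ?_⟩
    have := M.isTriv_sound hinv hvt
    rw [wperm_append, wperm, M.wperm_invW hinv, mul_assoc] at this
    exact (inv_mul_eq_one.1 this).symm
  have hinvm : ∀ q ∈ gens, ∀ g ∈ S, (M.perm q)⁻¹ * g ∈ S := by
    intro q hq g hg
    have hmaps : Set.MapsTo (fun g => M.perm q * g) S S := fun g hg => hmul q hq g hg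
    have hsurj : Set.SurjOn (fun g => M.perm q * g) S S :=
      ((hS.injOn_iff_bijOn_of_mapsTo hmaps).1 (fun a _ b _ hab => mul_left_cancel hab)).surjOn
    obtain ⟨g', hg', rfl⟩ := hsurj hg
    simpa using hg'
  have hsub : ((Subgroup.closure {g | ∃ q ∈ gens, g = M.perm q} : Subgroup _) :
      Set (Equiv.Perm (List Bool))) ⊆ S := by
    intro g hg
    induction hg using Subgroup.closure_induction_left with
    | one => exact ⟨[], h1, rfl⟩
    | mul_left x hx y _ hy =>
      obtain ⟨q, hq, rfl⟩ := hx
      exact hmul q hq y hy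
    | inv_mul_cancel x hx y _ hy =>
      obtain ⟨q, hq, rfl⟩ := hx
      exact hinvm q hq y hy
  exact (hS.subset hsub).to_subtype

end Words

end BinAutomaton

/-! ## Degree criterion -/

/-- difference operator on binary sequences -/
def bdiff (f : ℕ → Bool) : ℕ → Bool := fun j => xor (f (j + 1)) (f j)

/-- iterated difference operator -/
def bdiffs : ℕ → (ℕ → Bool) → ℕ → Bool
  | 0, f => f
  | d + 1, f => bdiffs d (bdiff f)

theorem bdiffs_add (d e : ℕ) (f : ℕ → Bool) : bdiffs (d + e) f = bdiffs d (bdiffs e f) := by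
  induction e generalizing f with
  | zero => rfl
  | succ e ih => rw [← add_assoc, bdiffs, ih, bdiffs]

theorem bdiff_xor (f g : ℕ → Bool) :
    bdiff (fun j => xor (f j) (g j)) = fun j => xor (bdiff f j) (bdiff g j) := by
  funext j
  simp only [bdiff]
  cases f j <;> cases f (j + 1) <;> cases g j <;> cases g (j + 1) <;> rfl

theorem bdiffs_xor (d : ℕ) (f g : ℕ → Bool) :
    bdiffs d (fun j => xor (f j) (g j)) = fun j => xor (bdiffs d f j) (bdiffs d g j) := by
  induction d generalizing f g with
  | zero => rfl
  | succ d ih => simp only [bdiffs, bdiff_xor, ih]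

theorem bdiffs_shift (d n : ℕ) (f : ℕ → Bool) (h : ∀ j, f (j + n) = f j) (j : ℕ) :
    bdiffs d f (j + n) = bdiffs d f j := by
  induction d generalizing f with
  | zero => exact h j
  | succ d ih =>
    refine ih _ (fun i => ?_)
    simp only [bdiff]
    rw [h, show i + n + 1 = (i + 1) + n by ring, h]

theorem bdiffs_two_pow (k : ℕ) (f : ℕ → Bool) :
    bdiffs (2 ^ k) f = fun j => xor (f (j + 2 ^ k)) (f j) := by
  induction k generalizing f with
  | zero => rfl
  | succ k ih =>
    rw [pow_succ, mul_two, bdiffs_add, ih, ih]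
    funext j
    dsimp only
    rw [add_assoc]
    cases f j <;> cases f (j + 2 ^ k) <;> cases f (j + (2 ^ k + 2 ^ k)) <;> rfl

namespace BinAutomaton

section Degree

variable {E : Type} (M : BinAutomaton E)

/-- section of a word at a vertex -/
def vsec (w : List E) (v : List Bool) : List E := v.foldl M.wsec w

theorem vsec_concat (w : List E) (v : List Bool) (x : Bool) :
    M.vsec w (v ++ [x]) = M.wsec (M.vsec w v) x := by
  simp [vsec]

theorem wperm_concat (w : List E) (v : List Bool) (x : Bool) :
    M.wperm w (v ++ [x]) = M.wperm w v ++ [xor (M.wact (M.vsec w v)) x] := by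
  induction v generalizing w with
  | nil => simp [wperm_cons_apply, wperm_nil_apply, vsec, wout_eq]
  | cons y v ih =>
    rw [List.cons_append, wperm_cons_apply, ih, wperm_cons_apply]
    rfl

theorem length_wperm (w : List E) (v : List Bool) : (M.wperm w v).length = v.length := by
  induction v generalizing w with
  | nil => rw [wperm_nil_apply]
  | cons x v ih => rw [wperm_cons_apply]; simp [ih]

theorem length_wperm_pow (w : List E) (v : List Bool) (j : ℕ) :
    ((M.wperm w ^ j) v).length = v.length := by
  induction j with
  | zero => rfl
  | succ j ih => rw [pow_succ', Equiv.Perm.mul_apply, length_wperm, ih]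

/-- values of a function of the section along the orbit of a vertex -/
noncomputable def pat (w : List E) (f : List E → Bool) (v : List Bool) (j : ℕ) : Bool :=
  f (M.vsec w ((M.wperm w ^ j) v))

/-- the letters appended along the orbit -/
noncomputable def lett (w : List E) (v : List Bool) (x : Bool) : ℕ → Bool
  | 0 => x
  | j + 1 => xor (M.pat w M.wact v j) (lett w v x j)

theorem pow_concat (w : List E) (v : List Bool) (x : Bool) (j : ℕ) :
    (M.wperm w ^ j) (v ++ [x]) = (M.wperm w ^ j) v ++ [M.lett w v x j] := by
  induction j with
  | zero => rfl
  | succ j ih =>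
    rw [pow_succ', Equiv.Perm.mul_apply, Equiv.Perm.mul_apply, ih, wperm_concat]
    rfl

theorem bdiff_lett (w : List E) (v : List Bool) (x : Bool) :
    bdiff (M.lett w v x) = M.pat w M.wact v := by
  funext j
  simp only [bdiff, lett]
  cases M.pat w M.wact v j <;> cases M.lett w v x j <;> rfl

theorem lett_not (w : List E) (v : List Bool) (j : ℕ) :
    M.lett w v true j = !(M.lett w v false j) := by
  induction j with
  | zero => rfl
  | succ j ih => simp only [lett, ih, Bool.xor_not]

theorem pat_concat (w : List E) (f : List E → Bool) (v : List Bool) (x : Bool) (j : ℕ) :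
    M.pat w f (v ++ [x]) j =
      f (M.wsec (M.vsec w ((M.wperm w ^ j) v)) (M.lett w v x j)) := by
  rw [pat, pow_concat, vsec_concat]

/-- derivative of a function of words -/
def dfun : ℕ → List E → Bool
  | 0, s => M.wact s
  | k + 1, s => xor (dfun k (M.wsec s false)) (dfun k (M.wsec s true))

theorem pat_toggle (w : List E) (k : ℕ) (v : List Bool) (j : ℕ) :
    M.pat w (M.dfun (k + 1)) v j =
      xor (M.pat w (M.dfun k) (v ++ [false]) j) (M.pat w (M.dfun k) (v ++ [true]) j) := by
  rw [pat_concat, pat_concat, lett_not, pat, dfun]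
  cases M.lett w v false j
  · rfl
  · rw [Bool.xor_comm]; rfl

theorem exists_of_toggle (w : List E) (k d : ℕ) (v : List Bool)
    (h : bdiffs d (M.pat w (M.dfun (k + 1)) v) ≠ fun _ => false) :
    ∃ v', bdiffs d (M.pat w (M.dfun k) v') ≠ fun _ => false := by
  by_contra hc
  push Not at hc
  apply h
  have : M.pat w (M.dfun (k + 1)) v = fun j =>
      xor (M.pat w (M.dfun k) (v ++ [false]) j) (M.pat w (M.dfun k) (v ++ [true]) j) :=
    funext fun j => M.pat_toggle w k v j
  rw [this, bdiffs_xor, hc, hc]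
  rfl

theorem exists_of_toggles (w : List E) (k d : ℕ) : ∀ (v : List Bool)
    (_ : bdiffs d (M.pat w (M.dfun k) v) ≠ fun _ => false),
    ∃ v', bdiffs d (M.pat w M.wact v') ≠ fun _ => false := by
  induction k with
  | zero => intro v h; exact ⟨v, h⟩
  | succ k ih =>
    intro v h
    obtain ⟨v', hv'⟩ := M.exists_of_toggle w k d v h
    exact ih v' hv'

/-- the condition on the set of sections at a level -/
def DegCond (k : ℕ) (L : List (List E)) : Prop :=
  (∀ s ∈ L, M.dfun (k + 1) s = true) ∧
    ∃ c e : Bool, ∀ s ∈ L, M.dfun k (M.wsec s false) = xor c (e && M.wact s)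

theorem deg_infinite (w : List E) (k : ℕ)
    (hL : ∀ m, ∃ L, M.DegCond k L ∧ ∀ v : List Bool, v.length = m → M.vsec w v ∈ L)
    (n : ℕ) (hn : 0 < n) : M.wperm w ^ n ≠ 1 := by
  intro hw
  have hper : ∀ f v j, M.pat w f v (j + n) = M.pat w f v j := by
    intro f v j
    rw [pat, pow_add, hw, mul_one, pat]
  have main : ∀ d, ∃ v, bdiffs d (M.pat w M.wact v) ≠ fun _ => false := by
    intro d
    induction d with
    | zero =>
      obtain ⟨L, hL1, hL2⟩ := hL 0
      apply M.exists_of_toggles w (k + 1) 0 []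
      intro h
      have h1 := congrFun h 0
      have h2 := hL1.1 _ (hL2 [] rfl)
      simp only [bdiffs, pat, pow_zero, Equiv.Perm.one_apply] at h1
      rw [h2] at h1
      exact absurd h1 (by simp)
    | succ d ih =>
      obtain ⟨v, hv⟩ := ih
      obtain ⟨L, ⟨hL1, c, e, hL2⟩, hL3⟩ := hL v.length
      apply M.exists_of_toggles w k (d + 1) (v ++ [false])
      have hp : M.pat w (M.dfun k) (v ++ [false]) = fun j => xor (xor c (e && M.pat w M.wact v j))
          (M.lett w v false j) := by
        funext j
        have hmem := hL3 ((M.wperm w ^ j) v) (M.length_wperm_pow w v j)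
        have h1 := hL1 _ hmem
        have h2 := hL2 _ hmem
        rw [pat_concat]
        rw [dfun] at h1
        simp only [pat]
        rw [← h2]
        cases M.lett w v false j
        · simp
        · revert h1
          cases M.dfun k (M.wsec (M.vsec w ((M.wperm w ^ j) v)) false) <;> simp
      have hb : bdiff (M.pat w (M.dfun k) (v ++ [false])) = fun j =>
          xor (e && bdiff (M.pat w M.wact v) j) (M.pat w M.wact v j) := by
        rw [hp, bdiff_xor, bdiff_lett]
        funext j
        simp only [bdiff]
        cases c <;> cases e <;> simp
      intro h
      rw [bdiffs, hb] at h
      apply hv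
      cases e
      · simpa using h
      · simp only [Bool.true_and] at h
        rw [bdiffs_xor] at h
        have hcomm : bdiffs d (bdiff (M.pat w M.wact v)) = bdiff (bdiffs d (M.pat w M.wact v)) := by
          have := bdiffs_add 1 d (M.pat w M.wact v)
          rw [add_comm] at this
          exact this
        rw [hcomm] at h
        have h0 : ∀ j, bdiffs d (M.pat w M.wact v) (j + 1) = false := by
          intro j
          have := congrFun h j
          simp only [bdiff] at this
          simpa using this
        funext j
        rw [← bdiffs_shift d n _ (hper _ v) j]
        obtain ⟨m, rfl⟩ : ∃ m, n = m + 1 := ⟨n - 1, by omega⟩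
        exact h0 (j + m)
  obtain ⟨r, hr⟩ := M.two_pow_of_finite hn hw
  obtain ⟨v, hv⟩ := main (2 ^ r)
  apply hv
  rw [bdiffs_two_pow]
  funext j
  rw [pat, pow_add, hr, mul_one]
  simp [pat]

set_option linter.unusedSectionVars false

variable [Forc E]

/-- Boolean version of `DegCond` -/
def degCond (k : ℕ) (L : List (List E)) : Bool :=
  (L.all fun s => M.dfun (k + 1) s) &&
    [(false, false), (false, true), (true, false), (true, true)].any fun p =>
      L.all fun s => M.dfun k (M.wsec s false) == xor p.1 (p.2 && M.wact s)

theorem degCond_sound {k : ℕ} {L : List (List E)} (h : M.degCond k L = true) :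
    M.DegCond k L := by
  rw [degCond, Bool.and_eq_true, List.any_eq_true] at h
  obtain ⟨h1, ⟨c, e⟩, _, h2⟩ := h
  exact ⟨by simpa using h1, c, e, by simpa using h2⟩

/-- insert in a list of words -/
def insW (u : List E) (l : List (List E)) : List (List E) :=
  match memW u l with
  | true => l
  | false => u :: l

/-- all sections of words in the list -/
def nextL : List (List E) → List (List E)
  | [] => []
  | u :: l => insW (M.wsec u false) (insW (M.wsec u true) (nextL l))

/-- the first few level sets -/
def levels : ℕ → List (List E) → List (List (List E))
  | 0, _ => []
  | n + 1, L => L :: levels n (M.nextL L)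

/-- check of the degree criterion -/
def degChk (w : List E) (k : ℕ) : Bool :=
  let Ls := M.levels 6 [w]
  Ls.all fun L => M.degCond k L && Ls.any fun L' => L.all fun s =>
    memW (M.wsec s false) L' && memW (M.wsec s true) L'

theorem deg_sound {w : List E} {k : ℕ} (h : M.degChk w k = true) (n : ℕ) (hn : 0 < n) :
    M.wperm w ^ n ≠ 1 := by
  simp only [degChk, List.all_eq_true, Bool.and_eq_true, List.any_eq_true, memW_iff] at h
  refine M.deg_infinite w k ?_ n hn
  have : ∀ m, ∃ L ∈ M.levels 6 [w], ∀ v : List Bool, v.length = m →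
      M.vsec w v ∈ L := by
    intro m
    induction m with
    | zero =>
      refine ⟨[w], by simp [levels], ?_⟩
      intro v hv
      rw [List.length_eq_zero_iff.1 hv]
      simp [vsec]
    | succ m ih =>
      obtain ⟨L, hL, hv⟩ := ih
      obtain ⟨_, L', hL', h'⟩ := h L hL
      refine ⟨L', hL', fun v hlen => ?_⟩
      obtain ⟨u, x, rfl⟩ : ∃ u x, v = u ++ [x] := by
        rcases List.eq_nil_or_concat v with rfl | ⟨u, x, rfl⟩
        · simp at hlen
        · exact ⟨u, x, by simp⟩
      rw [vsec_concat]
      have := h' _ (hv u (by simpa using hlen))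
      cases x
      · exact this.1
      · exact this.2
  intro m
  obtain ⟨L, hL, hv⟩ := this m
  exact ⟨L, M.degCond_sound (h L hL).1, hv⟩

end Degree

end BinAutomaton

/-! ## Concrete three-state automata -/

/-- the three states -/
inductive S3
  | a | b | c
  deriving DecidableEq

/-- the three states and their inverses -/
inductive L6
  | a | b | c | A | B | C

namespace L6

/-- formal inverse -/
def inv : L6 → L6
  | a => A | b => B | c => C | A => a | B => b | C => c

/-- the letter of a state -/
def pos : S3 → L6
  | .a => a | .b => b | .c => c

/-- the inverse letter of a state -/
def neg : S3 → L6
  | .a => A | .b => B | .c => C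

theorem inv_pos (s : S3) : inv (pos s) = neg s := by cases s <;> rfl

theorem inv_neg (s : S3) : inv (neg s) = pos s := by cases s <;> rfl

/-- comparison -/
def eqb : L6 → L6 → Bool
  | a, a => true | b, b => true | c, c => true
  | A, A => true | B, B => true | C, C => true
  | _, _ => false

/-- normalisation -/
def force : L6 → (L6 → Bool) → Bool
  | a, k => k a | b, k => k b | c, k => k c
  | A, k => k A | B, k => k B | C, k => k C

instance : BinAutomaton.Forc L6 where
  eqb := eqb
  eqb_iff x y := by cases x <;> cases y <;> simp [eqb]
  force := force
  force_eq x k := by cases x <;> rfl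

end L6

/-- a table describing a three-state automaton -/
structure Tab where
  a0 : S3
  a1 : S3
  b0 : S3
  b1 : S3
  c0 : S3
  c1 : S3
  xa : Bool
  xb : Bool
  xc : Bool

namespace Tab

/-- transitions -/
def tr (T : Tab) : S3 → Bool → S3
  | .a, false => T.a0
  | .a, true => T.a1
  | .b, false => T.b0
  | .b, true => T.b1
  | .c, false => T.c0
  | .c, true => T.c1

/-- activities -/
def ac (T : Tab) : S3 → Bool
  | .a => T.xa
  | .b => T.xb
  | .c => T.xc

/-- transitions of the automaton extended by inverses -/
def etr (T : Tab) : L6 → Bool → L6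
  | .a, x => L6.pos (T.tr .a x)
  | .b, x => L6.pos (T.tr .b x)
  | .c, x => L6.pos (T.tr .c x)
  | .A, x => L6.neg (T.tr .a (xor T.xa x))
  | .B, x => L6.neg (T.tr .b (xor T.xb x))
  | .C, x => L6.neg (T.tr .c (xor T.xc x))

/-- activities of the automaton extended by inverses -/
def eac (T : Tab) : L6 → Bool
  | .a => T.xa
  | .b => T.xb
  | .c => T.xc
  | .A => T.xa
  | .B => T.xb
  | .C => T.xc

/-- the automaton extended by inverses -/
def ext (T : Tab) : BinAutomaton L6 where
  trans := T.etr
  out e x := xor (T.eac e) x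
  out_bij e := by
    have h : ∀ b : Bool, Function.Bijective fun x => xor b x := by decide
    exact h (T.eac e)

theorem act_inv (T : Tab) (v : List Bool) :
    ∀ e, T.ext.act (L6.inv e) (T.ext.act e v) = v := by
  induction v with
  | nil => intro e; rfl
  | cons x v ih =>
    intro e
    have h1 : T.ext.trans (L6.inv e) (T.ext.out e x) = L6.inv (T.ext.trans e x) := by
      have hp : ∀ s (x y z : Bool), xor x (xor y z) = z → 
          L6.neg (T.tr s (xor x (xor y z))) = L6.inv (L6.pos (T.tr s z)) := by
        intro s x y z h; rw [h, L6.inv_pos]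
      have hn : ∀ s x, L6.pos (T.tr s x) = L6.inv (L6.neg (T.tr s x)) := by
        intro s x; rw [L6.inv_neg]
      cases e
      · exact hp .a T.xa T.xa x (by simp)
      · exact hp .b T.xb T.xb x (by simp)
      · exact hp .c T.xc T.xc x (by simp)
      · exact hn .a _
      · exact hn .b _
      · exact hn .c _
    have h2 : T.ext.out (L6.inv e) (T.ext.out e x) = x := by
      cases e <;> simp [ext, eac, L6.inv]
    rw [BinAutomaton.act, BinAutomaton.act, h1, h2, ih]

theorem perm_inv (T : Tab) (e : L6) : T.ext.perm (L6.inv e) = (T.ext.perm e)⁻¹ := by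
  rw [eq_inv_iff_mul_eq_one]
  ext1 v
  exact T.act_inv v e

/-- one step of the parity recursion -/
def pnext (T : Tab) (f : Bool × Bool × Bool) : Bool × Bool × Bool :=
  let g : S3 → Bool := fun s => match s with
    | .a => f.1
    | .b => f.2.1
    | .c => f.2.2
  (xor (g T.a0) (g T.a1), xor (g T.b0) (g T.b1), xor (g T.c0) (g T.c1))

/-- parity of a product -/
def psum (f : Bool × Bool × Bool) : List S3 → Bool
  | [] => false
  | .a :: w => xor f.1 (psum f w)
  | .b :: w => xor f.2.1 (psum f w)
  | .c :: w => xor f.2.2 (psum f w)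

/-- iterates of the parity recursion -/
def piter (T : Tab) : ℕ → Bool × Bool × Bool
  | 0 => (T.xa, T.xb, T.xc)
  | n + 1 => T.pnext (piter T n)

theorem par_letter (T : Tab) (n : ℕ) :
    T.piter n = (T.ext.par n [.a], T.ext.par n [.b], T.ext.par n [.c]) := by
  induction n with
  | zero =>
    simp [piter, BinAutomaton.par, BinAutomaton.wact, BinAutomaton.wout, ext, eac]
  | succ n ih =>
    have key : ∀ s : S3, (match s with
        | .a => T.ext.par n [.a]
        | .b => T.ext.par n [.b]
        | .c => T.ext.par n [.c]) = T.ext.par n [L6.pos s] := by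
      intro s; cases s <;> rfl
    simp only [piter, ih, pnext, key]
    rfl

theorem par_word (T : Tab) (n : ℕ) (w : List S3) :
    T.ext.par n (w.map L6.pos) = psum (T.piter n) w := by
  induction w with
  | nil =>
    rw [psum]
    induction n with
    | zero => rfl
    | succ n ih => simp only [List.map_nil] at ih; simp [BinAutomaton.par, BinAutomaton.wsec, ih]
  | cons s w ih =>
    have h : (s :: w).map L6.pos = [L6.pos s] ++ w.map L6.pos := rfl
    rw [h, BinAutomaton.par_append, ih, par_letter]
    cases s <;> rfl

/-- the parity check -/
def stChk (T : Tab) (w : List S3) : Bool :=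
  (List.range 8).all (fun i => psum (T.piter i) w) &&
    (List.range 8).any (fun i => T.piter i == T.piter 8)

theorem st_sound {T : Tab} {w : List S3} (h : T.stChk w = true) (n : ℕ) (hn : 0 < n) :
    T.ext.wperm (w.map L6.pos) ^ n ≠ 1 := by
  simp only [stChk, Bool.and_eq_true, List.all_eq_true, List.any_eq_true, List.mem_range,
    beq_iff_eq] at h
  obtain ⟨h1, i, hi, h2⟩ := h
  have hk : ∀ k, ∃ j < 8, T.piter k = T.piter j := by
    intro k
    induction k with
    | zero => exact ⟨0, by omega, rfl⟩
    | succ k ih =>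
      obtain ⟨j, hj, he⟩ := ih
      have he' : T.piter (k + 1) = T.piter (j + 1) := by rw [piter, piter, he]
      rcases Nat.lt_or_ge (j + 1) 8 with h8 | h8
      · exact ⟨j + 1, h8, he'⟩
      · have : j + 1 = 8 := by omega
        exact ⟨i, hi, by rw [he', this, h2]⟩
  refine T.ext.par_infinite n hn _ fun k => ?_
  obtain ⟨j, hj, he⟩ := hk k
  rw [par_word, he]
  exact h1 j hj

end Tab

/-- Certificates. -/
inductive Cert
  | st (w : List S3)
  | fin (els : List (List L6))
  | deg (w : List L6) (k : ℕ)
  | cyc (w : List L6) (xs : List Bool) (t : List L6) (sg : Bool)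

/-- Certificate checker. -/
def Tab.chk (T : Tab) : Cert → Bool
  | .st w => T.stChk w
  | .fin els => T.ext.finChk L6.inv [.a, .b, .c] els
  | .deg w k => T.ext.degChk w k
  | .cyc w xs t sg => T.ext.cycChk L6.inv w xs t sg

theorem Tab.chk_sound {T : Tab} {c : Cert} (h : T.chk c = true) :
    Finite (Subgroup.closure {g | ∃ q ∈ [L6.a, .b, .c], g = T.ext.perm q}) ∨
      ∃ w, ∀ n, 0 < n → T.ext.wperm w ^ n ≠ 1 := by
  cases c with
  | st w => exact Or.inr ⟨_, Tab.st_sound h⟩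
  | fin els => exact Or.inl (T.ext.fin_sound T.perm_inv h)
  | deg w k => exact Or.inr ⟨w, T.ext.deg_sound h⟩
  | cyc w xs t sg => exact Or.inr ⟨w, T.ext.cyc_sound T.perm_inv h⟩

/-- check a list of tables against a list of certificates -/
def goChk : List Tab → List Cert → Bool
  | [], _ => true
  | _ :: _, [] => false
  | t :: ts, c :: cs => t.chk c && goChk ts cs

theorem goChk_sound {ts : List Tab} {cs : List Cert} (h : goChk ts cs = true) :
    ∀ t ∈ ts, ∃ c, t.chk c = true := by
  induction ts generalizing cs with
  | nil => simp
  | cons t ts ih =>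
    cases cs with
    | nil => simp [goChk] at h
    | cons c cs =>
      rw [goChk, Bool.and_eq_true] at h
      intro t' ht'
      rcases List.mem_cons.1 ht' with rfl | ht'
      · exact ⟨c, h.1⟩
      · exact ih h.2 t' ht'

/-- all pairs of states -/
def pairs : List (S3 × S3) :=
  [(.a, .a), (.a, .b), (.a, .c), (.b, .a), (.b, .b), (.b, .c), (.c, .a), (.c, .b), (.c, .c)]

theorem mem_pairs (p : S3 × S3) : p ∈ pairs := by
  obtain ⟨x, y⟩ := p
  cases x <;> cases y <;> simp [pairs]

/-- the tables with given activities and given transitions of the first state -/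
def tabs (x y z : Bool) (s t : S3) : List Tab :=
  pairs.flatMap fun q => pairs.map fun r => ⟨s, t, q.1, q.2, r.1, r.2, x, y, z⟩

theorem mem_tabs (T : Tab) : T ∈ tabs T.xa T.xb T.xc T.a0 T.a1 := by
  simp only [tabs, List.mem_flatMap, List.mem_map]
  exact ⟨(T.b0, T.b1), mem_pairs _, (T.c0, T.c1), mem_pairs _, rfl⟩

/-! ## The certificates -/

/-- certificate -/
def k0 : Cert := .st [.a]

/-- certificate -/
def k1 : Cert := .st [.a, .c]

/-- certificate -/
def k2 : Cert := .st [.a, .b]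

/-- certificate -/
def k3 : Cert := .deg [.a] 0

/-- certificate -/
def k4 : Cert := .fin [[], [.a]]

/-- certificate -/
def k5 : Cert := .fin [[], [.a], [.c], [.a, .c]]

/-- certificate -/
def k6 : Cert := .st [.b]

/-- certificate -/
def k7 : Cert := .st [.b, .c]

/-- certificate -/
def k8 : Cert := .deg [.a] 1

/-- certificate -/
def k9 : Cert := .cyc [.a, .B] [false, false] [] false

/-- certificate -/
def k10 : Cert := .cyc [.a, .B] [false, false, false] [] false

/-- certificate -/
def k11 : Cert := .cyc [.a, .C] [false, true] [] false

/-- certificate -/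
def k12 : Cert := .deg [.b] 0

/-- certificate -/
def k13 : Cert := .cyc [.a, .C] [false, false] [] false

/-- certificate -/
def k14 : Cert := .fin [[], [.a], [.b], [.a, .b]]

/-- certificate -/
def k15 : Cert := .cyc [.a, .B] [false, true] [] false

/-- certificate -/
def k16 : Cert := .cyc [.a, .B] [true, false] [] false

/-- certificate -/
def k17 : Cert := .fin [[], [.a], [.b], [.c], [.a, .b], [.a, .c], [.b, .c], [.a, .b, .c]]

/-- certificate -/
def k18 : Cert := .cyc [.a, .B] [false, false] [] true

/-- certificate -/
def k19 : Cert := .cyc [.a, .B] [false, false, true] [] false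

/-- certificate -/
def k20 : Cert := .cyc [.a, .B] [true, false, false] [] false

/-- certificate -/
def k21 : Cert := .cyc [.a, .B] [true, false] [] true

/-- certificate -/
def k22 : Cert := .cyc [.a, .b] [false, false] [] false

/-- certificate -/
def k23 : Cert := .cyc [.a, .B] [false, true, false] [] false

/-- certificate -/
def k24 : Cert := .cyc [.a, .B, .c, .B] [false, false] [] false

/-- certificate -/
def k25 : Cert := .cyc [.a] [false, false] [] false

/-- certificate -/
def k26 : Cert := .fin [[], [.a], [.b], [.a, .b], [.b, .a], [.a, .b, .a], [.b, .a, .b], [.a, .b, .a, .b]]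

/-- certificate -/
def k27 : Cert := .fin [[], [.a], [.c], [.a, .c], [.c, .a], [.a, .c, .a], [.c, .a, .c], [.a, .c, .a, .c]]

/-- certificate -/
def k28 : Cert := .deg [.a, .b] 0

/-- certificate -/
def k29 : Cert := .cyc [.A] [false, false] [] false

/-- certificate -/
def k30 : Cert := .cyc [.b, .C] [false, true] [] false

/-- certificate -/
def k31 : Cert := .cyc [.a, .C] [false, false, false] [] false

/-- certificate -/
def k32 : Cert := .cyc [.a, .B] [false, false, false, false] [.a] false

/-- certificate -/
def k33 : Cert := .fin [[], [.a], [.b], [.c], [.a, .b], [.a, .c], [.b, .c], [.c, .a], [.a, .b, .c], [.a, .c, .a], [.b, .c, .a], [.c, .a, .c], [.a, .b, .c, .a], [.a, .c, .a, .c], [.b, .c, .a, .c], [.a, .b, .c, .a, .c]]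

/-- certificate -/
def k34 : Cert := .fin [[], [.a], [.b], [.c], [.a, .b], [.a, .c], [.b, .a], [.b, .c], [.a, .b, .a], [.a, .b, .c], [.b, .a, .b], [.b, .a, .c], [.a, .b, .a, .b], [.a, .b, .a, .c], [.b, .a, .b, .c], [.a, .b, .a, .b, .c]]

/-- certificate -/
def k35 : Cert := .cyc [.a] [false, false, false, false] [] true

/-- certificate -/
def k36 : Cert := .cyc [.A, .c] [false, true] [] false

/-- certificate -/
def k37 : Cert := .fin [[], [.a], [.b], [.c], [.a, .b], [.a, .c], [.b, .a], [.b, .b], [.b, .c], [.a, .b, .a], [.a, .b, .b], [.a, .b, .c], [.b, .a, .c], [.b, .b, .c], [.a, .b, .a, .c], [.a, .b, .b, .c]]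

/-- certificate -/
def k38 : Cert := .fin [[], [.a], [.b], [.a, .b], [.b, .a], [.b, .b], [.a, .b, .a], [.a, .b, .b]]

/-- certificate -/
def k39 : Cert := .fin [[], [.a], [.b], [.c]]

/-- certificate -/
def k40 : Cert := .fin [[], [.a], [.b], [.c], [.a, .a], [.a, .b], [.a, .c], [.b, .a], [.b, .c], [.a, .a, .a], [.a, .a, .b], [.a, .a, .c], [.a, .b, .c], [.b, .a, .c], [.a, .a, .a, .c], [.a, .a, .b, .c]]

/-- certificate -/
def k41 : Cert := .fin [[], [.a], [.b], [.a, .a], [.a, .b], [.b, .a], [.a, .a, .a], [.a, .a, .b]]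

/-- certificate -/
def k42 : Cert := .cyc [.a, .c] [false, false] [] false

/-- certificate -/
def k43 : Cert := .cyc [.a, .c] [false, true] [] false

/-- certificate -/
def k44 : Cert := .cyc [.a, .B] [false, false, true] [] true

/-- certificate -/
def k45 : Cert := .cyc [.a, .B] [false, true, false] [] true

/-- certificate -/
def k46 : Cert := .cyc [.a, .C, .b, .C] [false, false] [] false

/-- certificate -/
def k47 : Cert := .cyc [.b, .A, .b, .C] [false, false] [] false

/-- certificate -/
def k48 : Cert := .cyc [.a, .C] [false, false, true] [] false

/-- certificate -/
def k49 : Cert := .cyc [.A, .b, .C, .b] [false, true] [] true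

/-- certificate -/
def k50 : Cert := .cyc [.a] [false, true] [] false

/-- certificate -/
def k51 : Cert := .cyc [.a, .B, .c, .B] [false, true] [] true

/-- certificate -/
def k52 : Cert := .cyc [.a, .C] [false, true, false] [] false

/-- certificate -/
def k53 : Cert := .cyc [.a, .B, .a, .C] [false, false] [] false

/-- certificate -/
def k54 : Cert := .cyc [.b, .C] [false, false] [] false

/-- certificate -/
def k55 : Cert := .cyc [.b] [false, false] [] false

/-- certificate -/
def k56 : Cert := .cyc [.a, .b] [false, true] [] false

/-- certificate -/
def k57 : Cert := .cyc [.a, .C] [false, true] [] true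

/-- certificate -/
def k58 : Cert := .cyc [.a, .B] [false, true] [] true

/-- certificate -/
def k59 : Cert := .cyc [.a, .C] [false, false] [] true

/-- certificate -/
def k60 : Cert := .cyc [.A] [false, true] [] false

/-- certificate -/
def k61 : Cert := .cyc [.b, .C, .a, .C] [false, false] [] false

/-- certificate -/
def k62 : Cert := .cyc [.A, .b] [false, true] [] false

/-- certificate -/
def k63 : Cert := .deg [.a, .c] 0

/-- certificate -/
def k64 : Cert := .cyc [.a, .C, .a, .B] [false, false] [] false

/-- certificate -/
def k65 : Cert := .cyc [.a, .b] [true, false] [] false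

/-- certificate -/
def k66 : Cert := .cyc [.b] [false, false, true] [] true

/-- certificate -/
def k67 : Cert := .cyc [.a] [false, true, false] [] false

/-- certificate -/
def k68 : Cert := .cyc [.a] [false, true] [] true

/-- certificate -/
def k69 : Cert := .cyc [.B, .c] [false, true] [] false

/-- certificate -/
def k70 : Cert := .cyc [.b] [false, true] [] true

/-- certificate -/
def k71 : Cert := .cyc [.A, .b] [true, false] [] true

/-- certificate -/
def k72 : Cert := .cyc [.a] [false, false, true] [] false

/-- certificate -/
def k73 : Cert := .cyc [.a] [false, false, true] [] true

/-- certificate -/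
def k74 : Cert := .cyc [.B] [false, false] [] false

/-- certificate -/
def k75 : Cert := .cyc [.A, .B] [false, true] [] false

/-- certificate -/
def k76 : Cert := .cyc [.B, .A] [false, false] [] false

/-- certificate -/
def k77 : Cert := .cyc [.A, .c] [false, false] [] true

/-- certificate -/
def k78 : Cert := .cyc [.A, .b] [false, false] [] true

/-- certificate -/
def k79 : Cert := .cyc [.A, .C] [false, true] [] false

/-- certificate -/
def k80 : Cert := .cyc [.C, .A] [false, false] [] false

/-- certificate -/
def k81 : Cert := .cyc [.A, .b] [false, false, true] [] true

/-- certificate -/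
def k82 : Cert := .cyc [.b, .a] [false, false] [] false

/-- certificate -/
def k83 : Cert := .cyc [.a, .C] [false, false, false, true] [.a] false

/-- certificate -/
def k84 : Cert := .cyc [.a, .b, .C, .B] [false, true, false, false] [] false

/-- certificate -/
def k85 : Cert := .cyc [.a, .C] [false, false, false, false] [.a] false

/-- certificate -/
def k86 : Cert := .cyc [.b, .A, .b, .C] [false, true] [] true

/-- certificate -/
def k87 : Cert := .cyc [.a, .C, .b, .C] [false, true] [] true

/-- certificate -/
def k88 : Cert := .cyc [.B, .c, .A, .c] [false, true] [] true

/-- certificate -/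
def k89 : Cert := .cyc [.A, .b] [false, true, false] [] true

/-- certificate -/
def k90 : Cert := .cyc [.c, .a] [false, false] [] false

/-- certificate -/
def k91 : Cert := .cyc [.B, .a, .B, .c] [false, true] [] true

/-- certificate -/
def k92 : Cert := .cyc [.A, .c, .B, .c] [false, true] [] true

/-- certificate -/
def k93 : Cert := .cyc [.b, .C, .a, .C] [false, true] [] true

/-- certificate -/
def k94 : Cert := .cyc [.a, .B] [false, false, false, true] [.a] false

/-- certificate -/
def k95 : Cert := .cyc [.a, .c, .B, .C] [false, true, false, false] [] false

/-- certificate -/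
def k96 : Cert := .cyc [.a, .b, .C, .B] [false, true] [] false

/-- certificate -/
def k97 : Cert := .cyc [.a, .c, .a, .b] [false, true] [] false

/-- certificate -/
def k98 : Cert := .cyc [.a, .b, .c, .B] [false, true] [] false

/-- certificate -/
def k99 : Cert := .cyc [.a, .B, .a, .C] [false, true] [] false

/-- certificate -/
def k100 : Cert := .cyc [.a, .b, .a, .c] [false, false] [] false

/-- certificate -/
def k101 : Cert := .cyc [.a] [false, true, false] [.b] true

/-- certificate -/
def k102 : Cert := .cyc [.a] [false, true] [.c] true

/-- certificate -/
def k103 : Cert := .cyc [.b] [false, true] [.a] true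

/-- certificate -/
def k104 : Cert := .cyc [.A, .c, .A, .b] [false, true] [] true

/-- certificate -/
def k105 : Cert := .cyc [.a, .B, .a, .C] [false, true] [] true

/-- certificate -/
def k106 : Cert := .cyc [.A] [false, true, false] [.B] true

/-- certificate -/
def k107 : Cert := .cyc [.a] [false, true] [.b] true

/-- certificate -/
def k108 : Cert := .cyc [.b, .C] [false, true, false] [] false

/-- certificate -/
def k109 : Cert := .cyc [.b] [false, true] [] false

/-- certificate -/
def k110 : Cert := .cyc [.B] [false, true, false] [.A] true

/-- certificate -/
def k111 : Cert := .cyc [.a, .b, .c, .a] [false, false] [] false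

/-- certificate -/
def k112 : Cert := .cyc [.a, .b, .c, .b] [false, false] [] false

/-- certificate -/
def k113 : Cert := .cyc [.b, .c, .b, .a] [false, true] [] false

/-- certificate -/
def k114 : Cert := .cyc [.b, .C] [false, false, false, false] [] true

/-- certificate -/
def k115 : Cert := .cyc [.a, .C, .a, .B] [false, true] [] true

/-- certificate -/
def k116 : Cert := .cyc [.A, .b, .A, .c] [false, true] [] true

/-- certificate -/
def k117 : Cert := .cyc [.b] [false, true] [.c] true

/-- certificate -/
def k118 : Cert := .cyc [.b, .C] [false, false, false] [] false

/-- certificate -/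
def k119 : Cert := .cyc [.b] [false, true, false] [.a] true

/-- certificate -/
def k120 : Cert := .cyc [.a, .a, .B, .C] [false, false] [] false

/-- certificate -/
def k121 : Cert := .cyc [.a, .B, .c, .B] [false, true] [] false

/-- certificate -/
def k122 : Cert := .cyc [.b, .C] [false, false, false, true] [] true

/-- certificate -/
def k123 : Cert := .cyc [.a, .C] [false, false, false, false] [] true

/-- certificate -/
def k124 : Cert := .cyc [.a, .C] [false, false, false, true] [] true

/-- certificates -/
def crt_one_aa : List Cert :=
  [k14, k33, k1, k33, k17, k13, k1, k42, k14, k2, k2, k2, k2, k2, k2, k2, k2, k2, k34, k2, k2,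
    k2, k43, k13, k2, k19, k26, k2, k2, k2, k2, k2, k2, k2, k2, k2, k5, k27, k1, k27, k4, k4,
    k1, k4, k4, k22, k23, k1, k22, k4, k4, k1, k4, k4, k34, k2, k2, k2, k42, k19, k2, k42, k26,
    k9, k9, k1, k23, k4, k4, k1, k4, k4, k17, k56, k1, k22, k4, k4, k1, k4, k4]

theorem crt_one_aa_ok :
    goChk (tabs true false false .a .a) crt_one_aa = true := by
  decide +kernel

/-- certificates -/
def crt_one_ab : List Cert :=
  [k0, k0, k0, k0, k0, k0, k0, k0, k0, k3, k3, k3, k3, k3, k1, k3, k1, k3, k10, k3, k3, k15,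
    k15, k1, k13, k1, k75, k3, k3, k3, k3, k3, k1, k3, k1, k3, k0, k0, k0, k0, k0, k0, k0, k0,
    k0, k0, k24, k44, k8, k0, k0, k57, k0, k0, k10, k15, k13, k3, k15, k1, k3, k1, k76, k0, k8,
    k77, k24, k0, k0, k44, k0, k0, k0, k0, k0, k0, k0, k0, k0, k0, k0]

theorem crt_one_ab_ok :
    goChk (tabs true false false .a .b) crt_one_ab = true := by
  decide +kernel

/-- certificates -/
def crt_one_ac : List Cert :=
  [k0, k10, k3, k10, k0, k0, k3, k0, k0, k0, k3, k3, k9, k0, k78, k3, k45, k0, k0, k3, k3, k11,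
    k0, k8, k3, k46, k0, k0, k9, k3, k3, k0, k45, k3, k58, k0, k0, k79, k3, k80, k0, k0, k3, k0,
    k0, k0, k2, k2, k2, k0, k0, k2, k0, k0, k0, k11, k3, k3, k0, k46, k3, k8, k0, k0, k2, k2,
    k2, k0, k0, k2, k0, k0, k0, k11, k3, k11, k0, k0, k3, k0, k0]

theorem crt_one_ac_ok :
    goChk (tabs true false false .a .c) crt_one_ac = true := by
  decide +kernel

/-- certificates -/
def crt_one_ba : List Cert :=
  [k0, k0, k0, k0, k0, k0, k0, k0, k0, k3, k3, k3, k3, k3, k1, k3, k1, k3, k23, k3, k3, k9, k9,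
    k1, k13, k1, k56, k3, k3, k3, k3, k3, k1, k3, k1, k3, k0, k0, k0, k0, k0, k0, k0, k0, k0,
    k0, k47, k81, k8, k0, k0, k57, k0, k0, k10, k15, k59, k3, k15, k1, k3, k1, k82, k0, k8, k59,
    k24, k0, k0, k44, k0, k0, k0, k0, k0, k0, k0, k0, k0, k0, k0]

theorem crt_one_ba_ok :
    goChk (tabs true false false .b .a) crt_one_ba = true := by
  decide +kernel

/-- certificates -/
def crt_one_bb : List Cert :=
  [k14, k33, k1, k33, k17, k11, k1, k13, k14, k2, k2, k2, k2, k2, k2, k2, k2, k2, k83, k2, k2,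
    k2, k28, k84, k2, k13, k26, k2, k2, k2, k2, k2, k2, k2, k2, k2, k5, k27, k1, k27, k4, k4,
    k1, k4, k4, k48, k23, k1, k23, k4, k4, k1, k4, k4, k85, k2, k2, k2, k28, k11, k2, k47, k26,
    k31, k10, k1, k19, k4, k4, k1, k4, k4, k17, k10, k1, k23, k4, k4, k1, k4, k4]

theorem crt_one_bb_ok :
    goChk (tabs true false false .b .b) crt_one_bb = true := by
  decide +kernel

/-- certificates -/
def crt_one_bc : List Cert :=
  [k14, k1, k9, k1, k35, k9, k15, k15, k29, k11, k2, k2, k2, k10, k86, k2, k8, k29, k2, k2, k2,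
    k2, k2, k2, k2, k2, k2, k36, k2, k2, k2, k19, k8, k2, k49, k60, k25, k1, k25, k1, k4, k4,
    k50, k4, k4, k36, k1, k8, k1, k4, k4, k87, k4, k4, k2, k2, k2, k2, k2, k2, k2, k2, k2, k11,
    k1, k88, k1, k4, k4, k8, k4, k4, k35, k1, k10, k1, k4, k4, k23, k4, k4]

theorem crt_one_bc_ok :
    goChk (tabs true false false .b .c) crt_one_bc = true := by
  decide +kernel

/-- certificates -/
def crt_one_ca : List Cert :=
  [k0, k19, k3, k10, k0, k0, k3, k0, k0, k0, k3, k3, k18, k0, k18, k3, k89, k0, k0, k3, k3, k11,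
    k0, k8, k3, k61, k0, k0, k9, k3, k3, k0, k45, k3, k58, k0, k0, k43, k3, k90, k0, k0, k3, k0,
    k0, k0, k2, k2, k2, k0, k0, k2, k0, k0, k0, k13, k3, k3, k0, k46, k3, k8, k0, k0, k2, k2,
    k2, k0, k0, k2, k0, k0, k0, k13, k3, k11, k0, k0, k3, k0, k0]

theorem crt_one_ca_ok :
    goChk (tabs true false false .c .a) crt_one_ca = true := by
  decide +kernel

/-- certificates -/
def crt_one_cb : List Cert :=
  [k14, k1, k15, k1, k35, k15, k62, k62, k25, k13, k2, k2, k2, k10, k91, k2, k8, k25, k2, k2,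
    k2, k2, k2, k2, k2, k2, k2, k11, k2, k2, k2, k19, k8, k2, k51, k50, k29, k1, k29, k1, k4,
    k4, k60, k4, k4, k11, k1, k8, k1, k4, k4, k92, k4, k4, k2, k2, k2, k2, k2, k2, k2, k2, k2,
    k13, k1, k93, k1, k4, k4, k8, k4, k4, k35, k1, k10, k1, k4, k4, k48, k4, k4]

theorem crt_one_cb_ok :
    goChk (tabs true false false .c .b) crt_one_cb = true := by
  decide +kernel

/-- certificates -/
def crt_one_cc : List Cert :=
  [k14, k94, k1, k32, k17, k10, k1, k19, k14, k2, k2, k2, k2, k2, k2, k2, k2, k2, k34, k2, k2,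
    k2, k31, k10, k2, k52, k26, k2, k2, k2, k2, k2, k2, k2, k2, k2, k5, k27, k1, k27, k4, k4,
    k1, k4, k4, k9, k9, k1, k61, k4, k4, k1, k4, k4, k34, k2, k2, k2, k52, k48, k2, k19, k26,
    k15, k95, k1, k15, k4, k4, k1, k4, k4, k17, k63, k1, k63, k4, k4, k1, k4, k4]

theorem crt_one_cc_ok :
    goChk (tabs true false false .c .c) crt_one_cc = true := by
  decide +kernel

/-- certificates -/
def crt_one : S3 → S3 → List Cert
  | .a, .a => crt_one_aa
  | .a, .b => crt_one_ab
  | .a, .c => crt_one_ac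
  | .b, .a => crt_one_ba
  | .b, .b => crt_one_bb
  | .b, .c => crt_one_bc
  | .c, .a => crt_one_ca
  | .c, .b => crt_one_cb
  | .c, .c => crt_one_cc

theorem chunk_one (s t : S3) : goChk (tabs true false false s t) (crt_one s t) = true := by
  cases s <;> cases t
  · exact crt_one_aa_ok
  · exact crt_one_ab_ok
  · exact crt_one_ac_ok
  · exact crt_one_ba_ok
  · exact crt_one_bb_ok
  · exact crt_one_bc_ok
  · exact crt_one_ca_ok
  · exact crt_one_cb_ok
  · exact crt_one_cc_ok

/-- certificates -/
def crt_two_aa : List Cert :=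
  [k5, k5, k1, k5, k5, k1, k1, k1, k4, k5, k5, k1, k5, k5, k1, k1, k1, k4, k37, k7, k6, k7, k96,
    k64, k6, k97, k38, k5, k5, k1, k5, k5, k1, k1, k1, k4, k5, k5, k1, k5, k5, k1, k1, k1, k4,
    k6, k16, k1, k22, k6, k12, k1, k12, k6, k37, k7, k6, k7, k98, k99, k6, k100, k38, k6, k9,
    k1, k65, k6, k12, k1, k12, k6, k17, k9, k1, k22, k39, k1, k1, k1, k14]

theorem crt_two_aa_ok :
    goChk (tabs true true false .a .a) crt_two_aa = true := by
  decide +kernel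

/-- certificates -/
def crt_two_ab : List Cert :=
  [k5, k5, k1, k5, k5, k1, k1, k1, k4, k5, k5, k1, k5, k5, k1, k1, k1, k4, k20, k7, k8, k7, k66,
    k6, k8, k6, k29, k5, k5, k1, k5, k5, k1, k1, k1, k4, k5, k5, k1, k5, k5, k1, k1, k1, k4, k6,
    k51, k21, k49, k6, k1, k21, k1, k6, k18, k7, k64, k7, k101, k6, k53, k6, k67, k6, k8, k102,
    k8, k6, k1, k68, k1, k6, k18, k69, k1, k30, k9, k1, k1, k1, k29]

theorem crt_two_ab_ok :
    goChk (tabs true true false .a .b) crt_two_ab = true := by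
  decide +kernel

/-- certificates -/
def crt_two_ac : List Cert :=
  [k0, k20, k3, k20, k0, k7, k3, k7, k0, k0, k8, k7, k8, k0, k103, k7, k70, k0, k0, k0, k3, k0,
    k0, k3, k3, k3, k0, k0, k104, k7, k105, k0, k21, k7, k21, k0, k0, k16, k3, k65, k0, k7, k3,
    k7, k0, k0, k0, k3, k0, k0, k3, k3, k3, k0, k0, k0, k3, k0, k0, k9, k3, k9, k0, k0, k0, k3,
    k0, k0, k12, k3, k12, k0, k0, k69, k3, k30, k0, k7, k3, k7, k0]

theorem crt_two_ac_ok :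
    goChk (tabs true true false .a .c) crt_two_ac = true := by
  decide +kernel

/-- certificates -/
def crt_two_ba : List Cert :=
  [k5, k5, k1, k5, k5, k1, k1, k1, k4, k5, k5, k1, k5, k5, k1, k1, k1, k4, k21, k7, k53, k7,
    k106, k6, k53, k6, k67, k5, k5, k1, k5, k5, k1, k1, k1, k4, k5, k5, k1, k5, k5, k1, k1, k1,
    k4, k6, k8, k107, k8, k6, k1, k68, k1, k6, k10, k7, k8, k7, k66, k6, k8, k6, k25, k6, k49,
    k18, k51, k6, k1, k71, k1, k6, k21, k30, k1, k54, k16, k1, k1, k1, k25]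

theorem crt_two_ba_ok :
    goChk (tabs true true false .b .a) crt_two_ba = true := by
  decide +kernel

/-- certificates -/
def crt_two_bb : List Cert :=
  [k5, k5, k1, k5, k5, k1, k1, k1, k4, k5, k5, k1, k5, k5, k1, k1, k1, k4, k52, k7, k6, k7, k28,
    k16, k6, k16, k50, k5, k5, k1, k5, k5, k1, k1, k1, k4, k5, k5, k1, k5, k5, k1, k1, k1, k4,
    k6, k20, k1, k20, k6, k12, k1, k12, k6, k31, k7, k6, k7, k28, k9, k6, k30, k25, k6, k10, k1,
    k10, k6, k12, k1, k12, k6, k39, k32, k1, k32, k17, k1, k1, k1, k14]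

theorem crt_two_bb_ok :
    goChk (tabs true true false .b .b) crt_two_bb = true := by
  decide +kernel

/-- certificates -/
def crt_two_bc : List Cert :=
  [k28, k1, k16, k1, k108, k0, k16, k0, k109, k110, k1, k0, k1, k21, k24, k0, k24, k72, k0, k0,
    k3, k0, k0, k3, k3, k3, k0, k73, k1, k0, k1, k20, k8, k0, k8, k74, k111, k1, k112, k1, k40,
    k0, k113, k0, k41, k0, k0, k3, k0, k0, k3, k3, k3, k0, k0, k0, k16, k0, k0, k9, k16, k30,
    k0, k0, k0, k18, k0, k0, k3, k54, k3, k0, k114, k1, k10, k1, k40, k0, k10, k0, k41]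

theorem crt_two_bc_ok :
    goChk (tabs true true false .b .c) crt_two_bc = true := by
  decide +kernel

/-- certificates -/
def crt_two_ca : List Cert :=
  [k0, k10, k3, k10, k0, k7, k3, k7, k0, k0, k115, k7, k116, k0, k18, k7, k71, k0, k0, k0, k3,
    k0, k0, k18, k3, k13, k0, k0, k8, k7, k8, k0, k117, k7, k70, k0, k0, k9, k3, k22, k0, k7,
    k3, k7, k0, k0, k0, k3, k0, k0, k12, k3, k12, k0, k0, k0, k3, k0, k0, k3, k3, k3, k0, k0,
    k0, k3, k0, k0, k3, k3, k3, k0, k0, k30, k3, k54, k0, k7, k3, k7, k0]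

theorem crt_two_ca_ok :
    goChk (tabs true true false .c .a) crt_two_ca = true := by
  decide +kernel

/-- certificates -/
def crt_two_cb : List Cert :=
  [k28, k1, k9, k1, k118, k0, k11, k0, k55, k73, k1, k0, k1, k10, k8, k0, k8, k55, k0, k0, k9,
    k0, k0, k16, k11, k16, k0, k119, k1, k0, k1, k18, k24, k0, k47, k72, k120, k1, k24, k1, k40,
    k0, k121, k0, k41, k0, k0, k9, k0, k0, k3, k9, k3, k0, k0, k0, k3, k0, k0, k3, k3, k3, k0,
    k0, k0, k3, k0, k0, k3, k3, k3, k0, k122, k1, k20, k1, k40, k0, k31, k0, k41]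

theorem crt_two_cb_ok :
    goChk (tabs true true false .c .b) crt_two_cb = true := by
  decide +kernel

/-- certificates -/
def crt_two_cc : List Cert :=
  [k17, k32, k1, k32, k39, k1, k1, k1, k14, k16, k13, k1, k11, k21, k1, k1, k1, k55, k37, k7,
    k6, k7, k123, k10, k6, k10, k38, k9, k11, k1, k36, k18, k1, k1, k1, k74, k39, k43, k1, k22,
    k17, k1, k1, k1, k14, k6, k11, k1, k36, k6, k12, k1, k12, k6, k37, k7, k6, k7, k124, k20,
    k6, k31, k38, k6, k13, k1, k11, k6, k12, k1, k12, k6, k5, k5, k1, k5, k5, k1, k1, k1, k4]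

theorem crt_two_cc_ok :
    goChk (tabs true true false .c .c) crt_two_cc = true := by
  decide +kernel

/-- certificates -/
def crt_two : S3 → S3 → List Cert
  | .a, .a => crt_two_aa
  | .a, .b => crt_two_ab
  | .a, .c => crt_two_ac
  | .b, .a => crt_two_ba
  | .b, .b => crt_two_bb
  | .b, .c => crt_two_bc
  | .c, .a => crt_two_ca
  | .c, .b => crt_two_cb
  | .c, .c => crt_two_cc

theorem chunk_two (s t : S3) : goChk (tabs true true false s t) (crt_two s t) = true := by
  cases s <;> cases t
  · exact crt_two_aa_ok
  · exact crt_two_ab_ok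
  · exact crt_two_ac_ok
  · exact crt_two_ba_ok
  · exact crt_two_bb_ok
  · exact crt_two_bc_ok
  · exact crt_two_ca_ok
  · exact crt_two_cb_ok
  · exact crt_two_cc_ok

theorem chunk_none (s t : S3) :
    goChk (tabs false false false s t) (List.replicate 81 (.fin [[]])) = true := by
  cases s <;> cases t <;> decide +kernel

theorem chunk_three (s t : S3) :
    goChk (tabs true true true s t) (List.replicate 81 (.fin [[], [.a]])) = true := by
  cases s <;> cases t <;> decide +kernel

theorem exists_cert (T : Tab)
    (hT : (T.xa, T.xb, T.xc) ∈ [(false, false, false), (true, false, false),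
      (true, true, false), (true, true, true)]) : ∃ c, T.chk c = true := by
  have hm := mem_tabs T
  simp only [List.mem_cons, Prod.mk.injEq, List.not_mem_nil, or_false] at hT
  rcases hT with ⟨h1, h2, h3⟩ | ⟨h1, h2, h3⟩ | ⟨h1, h2, h3⟩ | ⟨h1, h2, h3⟩ <;>
    rw [h1, h2, h3] at hm
  · exact goChk_sound (chunk_none _ _) T hm
  · exact goChk_sound (chunk_one _ _) T hm
  · exact goChk_sound (chunk_two _ _) T hm
  · exact goChk_sound (chunk_three _ _) T hm

instance : Fintype S3 := ⟨{.a, .b, .c}, fun x => by cases x <;> simp⟩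

theorem exists_sorted (α : S3 → Bool) : ∃ π : Equiv.Perm S3,
    (α (π .a), α (π .b), α (π .c)) ∈ [(false, false, false), (true, false, false),
      (true, true, false), (true, true, true)] := by
  cases ha : α .a <;> cases hb : α .b <;> cases hc : α .c
  · exact ⟨1, by simp [ha, hb, hc]⟩
  · exact ⟨Equiv.swap .a .c, by
      rw [Equiv.swap_apply_left, Equiv.swap_apply_right,
        Equiv.swap_apply_of_ne_of_ne (by decide) (by decide)]; simp [ha, hb, hc]⟩
  · exact ⟨Equiv.swap .a .b, by
      rw [Equiv.swap_apply_left, Equiv.swap_apply_right,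
        Equiv.swap_apply_of_ne_of_ne (by decide) (by decide)]; simp [ha, hb, hc]⟩
  · exact ⟨Equiv.swap .a .c, by
      rw [Equiv.swap_apply_left, Equiv.swap_apply_right,
        Equiv.swap_apply_of_ne_of_ne (by decide) (by decide)]; simp [ha, hb, hc]⟩
  · exact ⟨1, by simp [ha, hb, hc]⟩
  · exact ⟨Equiv.swap .b .c, by
      rw [Equiv.swap_apply_left, Equiv.swap_apply_right,
        Equiv.swap_apply_of_ne_of_ne (by decide) (by decide)]; simp [ha, hb, hc]⟩
  · exact ⟨1, by simp [ha, hb, hc]⟩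
  · exact ⟨1, by simp [ha, hb, hc]⟩

theorem exists_tab (Q : Type) [Fintype Q] (hQ : Fintype.card Q = 3) (A : BinAutomaton Q) :
    ∃ (e : S3 ≃ Q) (T : Tab), (∀ s x, A.trans (e s) x = e (T.tr s x)) ∧
      (∀ s x, A.out (e s) x = xor (T.ac s) x) ∧
      (T.xa, T.xb, T.xc) ∈ [(false, false, false), (true, false, false),
        (true, true, false), (true, true, true)] := by
  have hc : Fintype.card S3 = Fintype.card Q := by rw [hQ]; rfl
  obtain ⟨e₀⟩ := Fintype.card_eq.1 hc
  obtain ⟨π, hπ⟩ := exists_sorted fun s => A.out (e₀ s) false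
  let e : S3 ≃ Q := π.trans e₀
  refine ⟨e, ⟨e.symm (A.trans (e .a) false), e.symm (A.trans (e .a) true),
    e.symm (A.trans (e .b) false), e.symm (A.trans (e .b) true),
    e.symm (A.trans (e .c) false), e.symm (A.trans (e .c) true),
    A.out (e .a) false, A.out (e .b) false, A.out (e .c) false⟩, ?_, ?_, hπ⟩
  · intro s x
    cases s <;> cases x <;> simp [Tab.tr]
  · intro s x
    have h := A.out_not (e s) false
    simp only [Bool.not_false] at h
    cases x
    · cases s <;> simp [Tab.ac]
    · cases s <;> simp [Tab.ac, h]

/-- There are no infinite torsion groups among groups generated by invertible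
automata with 3 states over a 2-letter alphabet: every such group is either
finite or contains an element of infinite order. -/
theorem three_state_automaton_group_not_infinite_torsion
    (Q : Type) [Fintype Q] (hQ : Fintype.card Q = 3) (A : BinAutomaton Q) :
    Finite ↥A.autGroup ∨ ∃ g ∈ A.autGroup, ¬ IsOfFinOrder g := by
  classical
  obtain ⟨e, T, htr, hout, hx⟩ := exists_tab Q hQ A
  obtain ⟨c, hc⟩ := exists_cert T hx
  have hact : ∀ v s, A.act (e s) v = T.ext.act (L6.pos s) v := by
    intro v
    induction v with
    | nil => intro s; rfl
    | cons x v ih =>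
      intro s
      have h1 : T.ext.out (L6.pos s) x = xor (T.ac s) x := by cases s <;> rfl
      have h2 : T.ext.trans (L6.pos s) x = L6.pos (T.tr s x) := by cases s <;> rfl
      rw [BinAutomaton.act, BinAutomaton.act, htr, hout, h1, h2, ih]
  have hperm : ∀ s, A.perm (e s) = T.ext.perm (L6.pos s) := by
    intro s
    ext1 v
    exact hact v s
  have hgrp : A.autGroup = Subgroup.closure {g | ∃ q ∈ [L6.a, .b, .c], g = T.ext.perm q} := by
    rw [BinAutomaton.autGroup]
    congr 1
    ext g
    constructor
    · rintro ⟨q, rfl⟩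
      obtain ⟨s, rfl⟩ := e.surjective q
      exact ⟨L6.pos s, by cases s <;> simp [L6.pos], hperm s⟩
    · rintro ⟨q, hq, rfl⟩
      simp only [List.mem_cons, List.not_mem_nil, or_false] at hq
      rcases hq with rfl | rfl | rfl
      · exact ⟨e .a, hperm .a⟩
      · exact ⟨e .b, hperm .b⟩
      · exact ⟨e .c, hperm .c⟩
  rcases Tab.chk_sound hc with h | ⟨w, hw⟩
  · left
    rw [hgrp]
    exact h
  · right
    refine ⟨T.ext.wperm w, ?_, ?_⟩
    · have hpos : ∀ s, T.ext.perm (L6.pos s) ∈ A.autGroup := fun s => by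
        rw [← hperm]
        exact Subgroup.subset_closure ⟨_, rfl⟩
      have hlet : ∀ q, T.ext.perm q ∈ A.autGroup := by
        intro q
        cases q
        · exact hpos .a
        · exact hpos .b
        · exact hpos .c
        · have := T.perm_inv .a
          exact this ▸ inv_mem (hpos .a)
        · have := T.perm_inv .b
          exact this ▸ inv_mem (hpos .b)
        · have := T.perm_inv .c
          exact this ▸ inv_mem (hpos .c)
      have hw' : ∀ u : List L6, T.ext.wperm u ∈ A.autGroup := by
        intro u
        induction u with
        | nil => exact one_mem _
        | cons q u ih => exact mul_mem ih (hlet q)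
      exact hw' w
    · rw [isOfFinOrder_iff_pow_eq_one]
      rintro ⟨n, hn, h⟩
      exact hw n hn h
end

section
/- The finite groups generated by invertible automata with 3 states over a 2-letter alphabet are, up to isomorphism, exactly the following 6 groups: the trivial group, C₂, C₂ × C₂, the dihedral group D₄ of order 8, C₂ × C₂ × C₂, and D₄ × C₂. -/
/-! ### Sections of tree automorphisms -/

/-- `g` maps `x w` to `y h(w)`. -/
def TSec (g : Equiv.Perm (List Bool)) (x y : Bool) (h : Equiv.Perm (List Bool)) : Prop :=
  ∀ w, g (x :: w) = y :: h w

namespace TSec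

theorem one (x : Bool) : TSec 1 x x 1 := fun _ => rfl

theorem mul {g g' h h' : Equiv.Perm (List Bool)} {x y z : Bool}
    (H' : TSec g' y z h') (H : TSec g x y h) : TSec (g' * g) x z (h' * h) := by
  intro w
  simp only [Equiv.Perm.mul_apply]
  rw [H w, H' (h w)]

theorem inv {g h : Equiv.Perm (List Bool)} {x y : Bool}
    (H : TSec g x y h) : TSec g⁻¹ y x h⁻¹ := by
  intro w
  rw [Equiv.Perm.inv_eq_iff_eq, H]
  simp

theorem unique {g h h' : Equiv.Perm (List Bool)} {x y y' : Bool}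
    (H : TSec g x y h) (H' : TSec g x y' h') : h = h' := by
  ext1 w
  have := (H w).symm.trans (H' w)
  simp only [List.cons.injEq] at this
  exact this.2

theorem out_unique {g h h' : Equiv.Perm (List Bool)} {x y y' : Bool}
    (H : TSec g x y h) (H' : TSec g x y' h') : y = y' := by
  have := (H []).symm.trans (H' [])
  simp only [List.cons.injEq] at this
  exact this.1

theorem pow {g h : Equiv.Perm (List Bool)} {x : Bool}
    (H : TSec g x x h) (n : ℕ) : TSec (g ^ n) x x (h ^ n) := by
  induction n with
  | zero => exact TSec.one x
  | succ n ih => rw [pow_succ, pow_succ]; exact ih.mul H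

end TSec

theorem perm_tsec {Q : Type*} (A : BinAutomaton Q) (q : Q) (x : Bool) :
    TSec (A.perm q) x (A.out q x) (A.perm (A.trans q x)) := fun _ => rfl

/-- The group of sections at `x` of the elements of `K` fixing `x`. -/
def secGroup (K : Subgroup (Equiv.Perm (List Bool))) (x : Bool) :
    Subgroup (Equiv.Perm (List Bool)) where
  carrier := {h | ∃ g ∈ K, TSec g x x h}
  mul_mem' := by
    rintro a b ⟨g, hg, H⟩ ⟨g', hg', H'⟩
    exact ⟨g * g', K.mul_mem hg hg', H.mul H'⟩
  one_mem' := ⟨1, K.one_mem, TSec.one x⟩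
  inv_mem' := by
    rintro a ⟨g, hg, H⟩
    exact ⟨g⁻¹, K.inv_mem hg, H.inv⟩

theorem mem_secGroup {K : Subgroup (Equiv.Perm (List Bool))} {x : Bool}
    {g h : Equiv.Perm (List Bool)} (hg : g ∈ K) (H : TSec g x x h) : h ∈ secGroup K x :=
  ⟨g, hg, H⟩

/-- A self-replicating group moving a letter is infinite. -/
theorem not_finite_of_le_secGroup {K : Subgroup (Equiv.Perm (List Bool))} {x : Bool}
    (hK : K ≤ secGroup K x) {g h : Equiv.Perm (List Bool)} (hg : g ∈ K) (H : TSec g x (!x) h) :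
    ¬ Finite K := by
  intro hfin
  have key : ∀ k : K, ∃ l : K, TSec l.1 x x k.1 := by
    rintro ⟨k, hk⟩
    obtain ⟨l, hl, hs⟩ := hK hk
    exact ⟨⟨l, hl⟩, hs⟩
  choose F hF using key
  have hinj : Function.Injective F := by
    intro k k' hkk
    have h1 := hF k
    rw [hkk] at h1
    exact Subtype.ext (h1.unique (hF k'))
  obtain ⟨k, hk⟩ := Finite.surjective_of_injective hinj ⟨g, hg⟩
  have h1 := hF k
  rw [hk] at h1
  have := H.out_unique h1
  cases x <;> simp at this

theorem not_finite_autGroup {Q : Type*} (A : BinAutomaton Q)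
    {K : Subgroup (Equiv.Perm (List Bool))} (hle : K ≤ A.autGroup) (hK : ¬ Finite K) :
    ¬ Finite A.autGroup := by
  intro h
  exact hK (Finite.of_injective _ (Subgroup.inclusion_injective hle))

theorem perm_mem {Q : Type*} (A : BinAutomaton Q) (q : Q) : A.perm q ∈ A.autGroup :=
  Subgroup.subset_closure ⟨q, rfl⟩

/-! ### Three exceptional families -/

/-- `a = (a,a)σ`, `b = (a,c)σ`, `c = (b,b)`. -/
theorem exceptional_one {Q : Type*} (A : BinAutomaton Q) (a b c : Q) (x : Bool)
    (oa : A.out a x = !x) (oa' : A.out a (!x) = x)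
    (ob : A.out b x = !x) (ob' : A.out b (!x) = x)
    (oc : A.out c x = x) (oc' : A.out c (!x) = !x)
    (ta : A.trans a x = a) (ta' : A.trans a (!x) = a)
    (tb : A.trans b x = a) (tb' : A.trans b (!x) = c)
    (tc : A.trans c x = b) (tc' : A.trans c (!x) = b) : ¬ Finite A.autGroup := by
  have sa : TSec (A.perm a) x (!x) (A.perm a) := by simpa [oa, ta] using perm_tsec A a x
  have sa' : TSec (A.perm a) (!x) x (A.perm a) := by simpa [oa', ta'] using perm_tsec A a (!x)
  have sb : TSec (A.perm b) x (!x) (A.perm a) := by simpa [ob, tb] using perm_tsec A b x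
  have sb' : TSec (A.perm b) (!x) x (A.perm c) := by simpa [ob', tb'] using perm_tsec A b (!x)
  have sc : TSec (A.perm c) x x (A.perm b) := by simpa [oc, tc] using perm_tsec A c x
  have sc' : TSec (A.perm c) (!x) (!x) (A.perm b) := by
    simpa [oc', tc'] using perm_tsec A c (!x)
  have ma := perm_mem A a
  have mb := perm_mem A b
  have mc := perm_mem A c
  generalize A.perm a = a at *
  generalize A.perm b = b at *
  generalize A.perm c = c at *
  let K := Subgroup.closure ({c * a, b, a * a} : Set (Equiv.Perm (List Bool)))
  have k1 : c * a ∈ K := Subgroup.subset_closure (by simp)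
  have k2 : b ∈ K := Subgroup.subset_closure (by simp)
  have k3 : a * a ∈ K := Subgroup.subset_closure (by simp)
  have hle : K ≤ A.autGroup := by
    rw [Subgroup.closure_le]
    rintro g (rfl | rfl | rfl)
    · exact mul_mem mc ma
    · exact mb
    · exact mul_mem ma ma
  refine not_finite_autGroup A hle (not_finite_of_le_secGroup (x := x) ?_ k2 sb)
  have m1 : c * a ∈ secGroup K x := mem_secGroup (mul_mem k2 k2) (sb'.mul sb)
  have m3 : a * a ∈ secGroup K x := mem_secGroup k3 (sa'.mul sa)
  have m2 : b * a * a ∈ secGroup K x := mem_secGroup (mul_mem k1 k2) ((sc.mul sa').mul sb)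
  rw [Subgroup.closure_le]
  rintro g (rfl | rfl | rfl)
  · exact m1
  · have := mul_mem m2 (inv_mem m3)
    rwa [mul_assoc, mul_assoc, ← mul_assoc a a, mul_inv_cancel, mul_one] at this
  · exact m3

/-- `a = (b,b)`, `b = (a,c)σ`, `c = (a,a)σ`. -/
theorem exceptional_two {Q : Type*} (A : BinAutomaton Q) (a b c : Q) (x : Bool)
    (oa : A.out a x = x)
    (ob : A.out b x = !x) (ob' : A.out b (!x) = x)
    (oc : A.out c x = !x)
    (ta : A.trans a x = b)
    (tb : A.trans b x = a) (tb' : A.trans b (!x) = c)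
    (tc : A.trans c x = a) : ¬ Finite A.autGroup := by
  have sa : TSec (A.perm a) x x (A.perm b) := by simpa [oa, ta] using perm_tsec A a x
  have sb : TSec (A.perm b) x (!x) (A.perm a) := by simpa [ob, tb] using perm_tsec A b x
  have sb' : TSec (A.perm b) (!x) x (A.perm c) := by simpa [ob', tb'] using perm_tsec A b (!x)
  have sc : TSec (A.perm c) x (!x) (A.perm a) := by simpa [oc, tc] using perm_tsec A c x
  have ma := perm_mem A a
  have mb := perm_mem A b
  have mc := perm_mem A c
  generalize A.perm a = a at *
  generalize A.perm b = b at *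
  generalize A.perm c = c at *
  let K := Subgroup.closure ({c * a, b} : Set (Equiv.Perm (List Bool)))
  have k1 : c * a ∈ K := Subgroup.subset_closure (by simp)
  have k2 : b ∈ K := Subgroup.subset_closure (by simp)
  have hle : K ≤ A.autGroup := by
    rw [Subgroup.closure_le]
    rintro g (rfl | rfl)
    · exact mul_mem mc ma
    · exact mb
  refine not_finite_autGroup A hle (not_finite_of_le_secGroup (x := x) ?_ k2 sb)
  have m1 : c * a ∈ secGroup K x := mem_secGroup (mul_mem k2 k2) (sb'.mul sb)
  have m2 : a⁻¹ * (a * b) ∈ secGroup K x :=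
    mem_secGroup (mul_mem (inv_mem k2) k1) (sb.inv.mul (sc.mul sa))
  rw [Subgroup.closure_le]
  rintro g (rfl | rfl)
  · exact m1
  · simpa using m2

/-- `a = (b,b)σ`, `b = (a,c)`, `c = (a,a)`. -/
theorem exceptional_three {Q : Type*} (A : BinAutomaton Q) (a b c : Q) (x : Bool)
    (oa : A.out a x = !x) (oa' : A.out a (!x) = x)
    (ob : A.out b x = x) (ob' : A.out b (!x) = !x)
    (oc : A.out c x = x) (oc' : A.out c (!x) = !x)
    (ta : A.trans a x = b) (ta' : A.trans a (!x) = b)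
    (tb : A.trans b x = a) (tb' : A.trans b (!x) = c)
    (tc : A.trans c x = a) (tc' : A.trans c (!x) = a) : ¬ Finite A.autGroup := by
  have sa : TSec (A.perm a) x (!x) (A.perm b) := by simpa [oa, ta] using perm_tsec A a x
  have sa' : TSec (A.perm a) (!x) x (A.perm b) := by simpa [oa', ta'] using perm_tsec A a (!x)
  have sb : TSec (A.perm b) x x (A.perm a) := by simpa [ob, tb] using perm_tsec A b x
  have sb' : TSec (A.perm b) (!x) (!x) (A.perm c) := by
    simpa [ob', tb'] using perm_tsec A b (!x)
  have sc : TSec (A.perm c) x x (A.perm a) := by simpa [oc, tc] using perm_tsec A c x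
  have sc' : TSec (A.perm c) (!x) (!x) (A.perm a) := by
    simpa [oc', tc'] using perm_tsec A c (!x)
  have ma := perm_mem A a
  have mb := perm_mem A b
  have mc := perm_mem A c
  generalize A.perm a = a at *
  generalize A.perm b = b at *
  generalize A.perm c = c at *
  let K := Subgroup.closure ({b * b, a, b⁻¹ * c * b, b⁻¹ * a * b} :
    Set (Equiv.Perm (List Bool)))
  have k1 : b * b ∈ K := Subgroup.subset_closure (by simp)
  have k2 : a ∈ K := Subgroup.subset_closure (by simp)
  have k3 : b⁻¹ * c * b ∈ K := Subgroup.subset_closure (by simp)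
  have k4 : b⁻¹ * a * b ∈ K := Subgroup.subset_closure (by simp)
  have hle : K ≤ A.autGroup := by
    rw [Subgroup.closure_le]
    rintro g (rfl | rfl | rfl | rfl)
    · exact mul_mem mb mb
    · exact ma
    · exact mul_mem (mul_mem (inv_mem mb) mc) mb
    · exact mul_mem (mul_mem (inv_mem mb) ma) mb
  refine not_finite_autGroup A hle (not_finite_of_le_secGroup (x := x) ?_ k2 sa)
  have m1 : b * b ∈ secGroup K x := mem_secGroup (mul_mem k2 k2) (sa'.mul sa)
  have m2 : a⁻¹ * a * a ∈ secGroup K x := mem_secGroup k3 ((sb.inv.mul sc).mul sb)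
  have m2' : a ∈ secGroup K x := by simpa using m2
  have m3 : b⁻¹ * (c⁻¹ * b * a) ∈ secGroup K x :=
    mem_secGroup (mul_mem (inv_mem k2) k4) (sa.inv.mul ((sb'.inv.mul sa).mul sb))
  have m3' : b⁻¹ * c * b ∈ secGroup K x := by
    have := mul_mem m2' (inv_mem m3)
    simpa [mul_assoc] using this
  have m4 : b⁻¹ * (c⁻¹ * a * c) * b ∈ secGroup K x :=
    mem_secGroup (mul_mem (mul_mem (inv_mem k2) k3) k2)
      ((sa.inv.mul ((sb'.inv.mul sc').mul sb')).mul sa)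
  have m4' : b⁻¹ * a * b ∈ secGroup K x := by
    have := mul_mem (mul_mem m3' m4) (inv_mem m3')
    simpa [mul_assoc] using this
  rw [Subgroup.closure_le]
  rintro g (rfl | rfl | rfl | rfl)
  · exact m1
  · exact m2'
  · exact m3'
  · exact m4'

/-! ### Three-state automata and the decision procedure -/

/-- Three states. -/
inductive St
  | a
  | b
  | c

namespace St

/-- Boolean equality of states. -/
def eqb : St → St → Bool
  | a, a => true
  | b, b => true
  | c, c => true
  | _, _ => false

theorem eqb_eq : ∀ {p q : St}, eqb p q = true → p = q
  | a, a, _ => rfl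
  | b, b, _ => rfl
  | c, c, _ => rfl

theorem eqb_refl (p : St) : eqb p p = true := by cases p <;> rfl

/-- Tabulated function. -/
def tab {β : Type} (x y z : β) : St → β
  | a => x
  | b => y
  | c => z

theorem tab_eta {β : Type} (f : St → β) : tab (f a) (f b) (f c) = f := by
  funext q; cases q <;> rfl

/-- The states in a list. -/
def every : List St := [a, b, c]

theorem mem_every (q : St) : q ∈ every := by cases q <;> simp [every]

end St

/-- The automaton with sections `f` at `0`, `g` at `1` and activity `u`. -/
def stAut (f g : St → St) (u : St → Bool) : BinAutomaton St where
  trans q x := cond x (g q) (f q)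
  out q x := xor (u q) x
  out_bij q := by
    have h : ∀ b : Bool, Function.Bijective fun x => xor b x := by decide
    exact h (u q)

/-- Triples of booleans. -/
inductive B3
  | mk (x y z : Bool)

namespace B3

def mem : B3 → St → Bool
  | mk x _ _, .a => x
  | mk _ y _, .b => y
  | mk _ _ z, .c => z

def ins : B3 → St → B3
  | mk _ y z, .a => mk true y z
  | mk x _ z, .b => mk x true z
  | mk x y _, .c => mk x y true

def flip : B3 → St → B3
  | mk x y z, .a => mk (!x) y z
  | mk x y z, .b => mk x (!y) z
  | mk x y z, .c => mk x y (!z)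

theorem mem_ins {k : B3} {p q : St} (h : mem (ins k p) q = true) : q = p ∨ mem k q = true := by
  cases k; cases p <;> cases q <;> simp_all [mem, ins]

theorem flip_comm (k : B3) (p q : St) : flip (flip k p) q = flip (flip k q) p := by
  cases k; cases p <;> cases q <;> rfl

theorem flip_flip (k : B3) (p : St) : flip (flip k p) p = k := by
  cases k; cases p <;> simp [flip]

end B3

/-! #### Self-replication check -/

/-- If one of two states is known so is the other. -/
def repLink (p r : St) (k : B3) : B3 :=
  cond (k.mem p) (k.ins r) (cond (k.mem r) (k.ins p) k)

/-- One deduction step; here `tx`, `ty` are the sections at `x` and at the other letter. -/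
def repStep (tx ty : St → St) (u : St → Bool) (s q : St) (k : B3) : B3 :=
  cond (u s)
    (cond (u q) (repLink (ty q) (tx s) (repLink (tx q) (tx s) k))
      (cond (((k.ins (tx q)).mem (tx s)) || St.eqb (ty q) (tx s))
        ((k.ins (tx q)).ins (ty q)) (k.ins (tx q))))
    k

/-- One round of deduction steps. -/
def repRound (tx ty : St → St) (u : St → Bool) (S : List St) (k : B3) : B3 :=
  S.foldl (fun k s => S.foldl (fun k q => repStep tx ty u s q k) k) k

def repCheck (tx ty : St → St) (u : St → Bool) (S : List St) : Bool :=
  S.any u && (fun k : B3 => S.all k.mem)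
    (repRound tx ty u S (repRound tx ty u S (B3.mk false false false)))

section rep

variable {A : BinAutomaton St} {x : Bool} {tx ty : St → St} {u : St → Bool}
  {K : Subgroup (Equiv.Perm (List Bool))}

/-- All states marked in `k` lie in the section group. -/
def RepGood (A : BinAutomaton St) (x : Bool) (K : Subgroup (Equiv.Perm (List Bool)))
    (k : B3) : Prop := ∀ q, k.mem q = true → A.perm q ∈ secGroup K x

theorem RepGood.ins {k : B3} (h : RepGood A x K k) {p : St} (hp : A.perm p ∈ secGroup K x) :
    RepGood A x K (k.ins p) := by
  intro q hq
  rcases B3.mem_ins hq with rfl | hq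
  · exact hp
  · exact h q hq

theorem RepGood.link {k : B3} (h : RepGood A x K k) {p r : St}
    (hpr : A.perm p ∈ secGroup K x ↔ A.perm r ∈ secGroup K x) :
    RepGood A x K (repLink p r k) := by
  unfold repLink
  rcases hp : k.mem p with _ | _
  · rcases hr : k.mem r with _ | _
    · exact h
    · exact h.ins (hpr.2 (h _ hr))
  · exact h.ins (hpr.1 (h _ hp))

theorem RepGood.step {k : B3} (h : RepGood A x K k)
    (hx : ∀ q, TSec (A.perm q) x (xor (u q) x) (A.perm (tx q)))
    (hy : ∀ q, TSec (A.perm q) (!x) (xor (u q) (!x)) (A.perm (ty q)))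
    {s q : St} (hs : A.perm s ∈ K) (hq : A.perm q ∈ K) :
    RepGood A x K (repStep tx ty u s q k) := by
  unfold repStep
  rcases us : u s with _ | _
  · exact h
  have Hs := hx s
  simp only [us, Bool.true_xor] at Hs
  have Hq := hx q
  have Hq' := hy q
  rcases uq : u q with _ | _
  · simp only [uq, Bool.false_xor] at Hq Hq'
    have m1 := mem_secGroup hq Hq
    have m2 := mem_secGroup (mul_mem (mul_mem (inv_mem hs) hq) hs) ((Hs.inv.mul Hq').mul Hs)
    simp only [cond_true, cond_false]
    have h1 := h.ins m1
    rcases hm : (k.ins (tx q)).mem (tx s) with _ | _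
    · rcases he : St.eqb (ty q) (tx s) with _ | _
      · exact h1
      · refine h1.ins ?_
        have he := St.eqb_eq he
        rw [he] at m2 ⊢
        simpa using m2
    · refine h1.ins ?_
      have ms := h1 _ hm
      have := mul_mem (mul_mem ms m2) (inv_mem ms)
      simpa [mul_assoc] using this
  · simp only [uq, Bool.true_xor, Bool.not_not] at Hq Hq'
    have m1 := mem_secGroup (mul_mem hq hs) (Hq'.mul Hs)
    have m2 := mem_secGroup (mul_mem (inv_mem hq) hs) (Hq.inv.mul Hs)
    simp only [cond_true]
    refine (h.link ?_).link ?_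
    · constructor
      · intro hp
        simpa using mul_mem hp m2
      · intro hp
        simpa using mul_mem hp (inv_mem m2)
    · constructor
      · intro hp
        simpa using mul_mem (inv_mem hp) m1
      · intro hp
        simpa using mul_mem m1 (inv_mem hp)

theorem foldl_invariant {α β : Type} (P : α → Prop) (f : α → β → α) (S : List β)
    (hf : ∀ k s, s ∈ S → P k → P (f k s)) (k : α) (hk : P k) : P (S.foldl f k) := by
  induction S generalizing k with
  | nil => exact hk
  | cons s S ih =>
    exact ih (fun k t ht => hf k t (List.mem_cons_of_mem _ ht)) _
      (hf k s List.mem_cons_self hk)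

theorem RepGood.round {S : List St} {k : B3} (h : RepGood A x K k)
    (hx : ∀ q, TSec (A.perm q) x (xor (u q) x) (A.perm (tx q)))
    (hy : ∀ q, TSec (A.perm q) (!x) (xor (u q) (!x)) (A.perm (ty q)))
    (hS : ∀ q ∈ S, A.perm q ∈ K) :
    RepGood A x K (repRound tx ty u S k) := by
  refine foldl_invariant _ _ _ (fun k s hs hk => ?_) _ h
  exact foldl_invariant _ _ _ (fun k q hq hk => hk.step hx hy (hS s hs) (hS q hq)) _ hk

theorem repCheck_sound {S : List St}
    (hx : ∀ q, TSec (A.perm q) x (xor (u q) x) (A.perm (tx q)))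
    (hy : ∀ q, TSec (A.perm q) (!x) (xor (u q) (!x)) (A.perm (ty q)))
    (h : repCheck tx ty u S = true) : ¬ Finite A.autGroup := by
  simp only [repCheck, Bool.and_eq_true, List.any_eq_true, List.all_eq_true] at h
  obtain ⟨⟨s, hs, us⟩, hall⟩ := h
  let K := Subgroup.closure (A.perm '' {q | q ∈ S})
  have hS : ∀ q ∈ S, A.perm q ∈ K := fun q hq => Subgroup.subset_closure ⟨q, hq, rfl⟩
  have hle : K ≤ A.autGroup := by
    rw [Subgroup.closure_le]
    rintro _ ⟨q, _, rfl⟩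
    exact perm_mem A q
  have H0 : RepGood A x K (B3.mk false false false) := by
    intro q hq
    cases q <;> simp [B3.mem] at hq
  have H2 := (H0.round hx hy hS).round hx hy hS
  refine not_finite_autGroup A hle (not_finite_of_le_secGroup (x := x) ?_ (hS s hs)
    (h := A.perm (tx s)) ?_)
  · rw [Subgroup.closure_le]
    rintro _ ⟨q, hq, rfl⟩
    exact H2 q (hall q hq)
  · have := hx s
    rwa [us, Bool.true_xor] at this

end rep

/-! #### Words -/

/-- The permutation given by a word; the first letter acts first. -/
noncomputable def wp {Q : Type*} (A : BinAutomaton Q) : List Q → Equiv.Perm (List Bool)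
  | [] => 1
  | q :: w => wp A w * A.perm q

theorem wp_append {Q : Type*} (A : BinAutomaton Q) (v w : List Q) :
    wp A (v ++ w) = wp A w * wp A v := by
  induction v with
  | nil => simp [wp]
  | cons q v ih => simp [wp, ih, mul_assoc]

theorem wp_mem {Q : Type*} (A : BinAutomaton Q) (w : List Q) : wp A w ∈ A.autGroup := by
  induction w with
  | nil => exact one_mem _
  | cons q w ih => exact mul_mem ih (perm_mem A q)

/-- Section of a word. -/
def wsec {Q : Type*} (A : BinAutomaton Q) : List Q → Bool → List Q
  | [], _ => []
  | q :: w, x => A.trans q x :: wsec A w (A.out q x)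

/-- Image of a letter. -/
def wout {Q : Type*} (A : BinAutomaton Q) : List Q → Bool → Bool
  | [], x => x
  | q :: w, x => wout A w (A.out q x)

theorem wp_tsec {Q : Type*} (A : BinAutomaton Q) (w : List Q) (x : Bool) :
    TSec (wp A w) x (wout A w x) (wp A (wsec A w x)) := by
  induction w generalizing x with
  | nil => exact TSec.one x
  | cons q w ih => exact (ih _).mul (perm_tsec A q x)

/-! #### Parity check -/

section parity

variable (f g : St → St) (u : St → Bool)

/-- Parities of the numbers of occurrences. -/
def cnt : List St → B3
  | [] => B3.mk false false false
  | q :: w => (cnt w).flip q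

/-- Parity of the activity. -/
def pact : List St → Bool
  | [] => false
  | q :: w => xor (u q) (pact w)

/-- Linear action on parity vectors. -/
def pnext : B3 → B3
  | .mk x y z =>
    let k0 := B3.mk false false false
    let k1 := cond x ((k0.flip (f .a)).flip (g .a)) k0
    let k2 := cond y ((k1.flip (f .b)).flip (g .b)) k1
    cond z ((k2.flip (f .c)).flip (g .c)) k2

/-- Activity of a parity vector. -/
def vact : B3 → Bool
  | .mk x y z => xor (x && u .a) (xor (y && u .b) (z && u .c))

theorem pact_eq (w : List St) : pact u w = vact u (cnt w) := by
  induction w with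
  | nil => simp [pact, vact, cnt]
  | cons q w ih =>
    simp only [pact, cnt, ih]
    rcases cnt w with ⟨x, y, z⟩
    cases q <;> cases x <;> cases y <;> cases z <;> cases ha : u .a <;> cases hb : u .b <;>
      cases hc : u .c <;> simp [vact, B3.flip, ha, hb, hc]

theorem wout_eq (w : List St) (x : Bool) : wout (stAut f g u) w x = xor (pact u w) x := by
  induction w generalizing x with
  | nil => simp [wout, pact]
  | cons q w ih =>
    simp only [wout, pact, ih]
    simp only [stAut]
    cases u q <;> cases pact u w <;> cases x <;> rfl

theorem cond_flip (x : Bool) (p r s : St) (k : B3) :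
    cond x (((k.flip s).flip p).flip r) (k.flip s) = (cond x ((k.flip p).flip r) k).flip s := by
  cases x
  · rfl
  · simp only [cond_true]
    rw [B3.flip_comm k s p, B3.flip_comm _ s r]

theorem cond_not (x : Bool) (p r : St) (k : B3) :
    cond (!x) ((k.flip p).flip r) k = ((cond x ((k.flip p).flip r) k).flip p).flip r := by
  cases x
  · rfl
  · simp only [cond_true, cond_false, Bool.not_true]
    rw [B3.flip_comm (k.flip p) r p, B3.flip_flip, B3.flip_flip]

theorem pnext_flip (k : B3) (q : St) :
    pnext f g (k.flip q) = ((pnext f g k).flip (f q)).flip (g q) := by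
  rcases k with ⟨x, y, z⟩
  have ea : (B3.mk x y z).flip .a = B3.mk (!x) y z := rfl
  have eb : (B3.mk x y z).flip .b = B3.mk x (!y) z := rfl
  have ec : (B3.mk x y z).flip .c = B3.mk x y (!z) := rfl
  cases q
  · rw [ea]; simp only [pnext, cond_not, cond_flip]
  · rw [eb]; simp only [pnext, cond_not, cond_flip]
  · rw [ec]; simp only [pnext, cond_not, cond_flip]

/-- Parities for a concatenation of the two sections. -/
def cntFrom : List St → B3 → B3
  | [], k => k
  | q :: w, k => (cntFrom w k).flip q

theorem cnt_append (v w : List St) : cnt (v ++ w) = cntFrom v (cnt w) := by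
  induction v with
  | nil => rfl
  | cons q v ih => simp [cnt, cntFrom, ih]

theorem cntFrom_flip (v : List St) (k : B3) (q : St) :
    cntFrom v (k.flip q) = (cntFrom v k).flip q := by
  induction v with
  | nil => rfl
  | cons p v ih => simp only [cntFrom, ih]; exact B3.flip_comm _ _ _

theorem cnt_sec (w : List St) (x : Bool) :
    cnt (wsec (stAut f g u) w x ++ wsec (stAut f g u) w (!x)) = pnext f g (cnt w) := by
  rw [cnt_append]
  induction w generalizing x with
  | nil => rfl
  | cons q w ih =>
    have e1 : (stAut f g u).out q (!x) = !((stAut f g u).out q x) := by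
      simp only [stAut]; cases u q <;> cases x <;> rfl
    simp only [wsec, cntFrom, cnt, e1, cntFrom_flip, ih, pnext_flip]
    cases x
    · simp only [stAut, cond_false, Bool.not_false, cond_true]
    · simp only [stAut, cond_false, Bool.not_true, cond_true]
      exact B3.flip_comm _ _ _

theorem parity_order {k : B3} (hk : pnext f g k = k) (ha : vact u k = true) (n : ℕ) :
    ∀ w : List St, cnt w = k → 0 < n → wp (stAut f g u) w ^ n ≠ 1 := by
  induction n using Nat.strong_induction_on with
  | _ n ih =>
    intro w hw hn h1
    have hact : pact u w = true := by rw [pact_eq, hw, ha]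
    have s0 := wp_tsec (stAut f g u) w false
    have s1 := wp_tsec (stAut f g u) w true
    simp only [wout_eq, hact, Bool.true_xor, Bool.not_false, Bool.not_true] at s0 s1
    have s2 := s1.mul s0
    rcases Nat.even_or_odd' n with ⟨m, rfl | rfl⟩
    · rw [pow_mul, pow_two] at h1
      have s3 := s2.pow m
      rw [h1] at s3
      have := (TSec.one false).unique s3
      rw [← wp_append] at this
      refine ih m (by omega) _ ?_ (by omega) this.symm
      have := cnt_sec f g u w false
      rw [Bool.not_false] at this
      rw [this, hw, hk]
    · rw [pow_succ, pow_mul, pow_two] at h1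
      have s3 := (s2.pow m)
      have s4 := (s3.inv.mul (TSec.one false))
      have e : wp (stAut f g u) w = ((wp (stAut f g u) w * wp (stAut f g u) w) ^ m)⁻¹ * 1 := by
        rw [mul_one]; exact eq_inv_of_mul_eq_one_right h1
      rw [← e] at s4
      have := s4.out_unique s0
      simp at this

/-- The word whose parity vector is `k`. -/
def vword : B3 → List St
  | .mk x y z => cond x [.a] [] ++ (cond y [.b] [] ++ cond z [.c] [])

theorem cnt_vword (k : B3) : cnt (vword k) = k := by
  rcases k with ⟨x, y, z⟩
  cases x <;> cases y <;> cases z <;> rfl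

def B3.eqb : B3 → B3 → Bool
  | mk x y z, mk x' y' z' => (x == x') && ((y == y') && (z == z'))

theorem B3.eqb_eq {k l : B3} (h : B3.eqb k l = true) : k = l := by
  rcases k with ⟨x, y, z⟩
  rcases l with ⟨x', y', z'⟩
  simp [B3.eqb] at h
  simp [h]

/-- The nonzero parity vectors. -/
def B3.every : List B3 :=
  [mk true false false, mk false true false, mk false false true, mk true true false,
    mk true false true, mk false true true, mk true true true]

def parCheck : Bool := B3.every.any fun k => vact u k && B3.eqb (pnext f g k) k

theorem parCheck_sound (h : parCheck f g u = true) : ¬ Finite (stAut f g u).autGroup := by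
  simp only [parCheck, List.any_eq_true, Bool.and_eq_true] at h
  obtain ⟨k, -, h1, h2⟩ := h
  intro hfin
  let y : (stAut f g u).autGroup := ⟨wp (stAut f g u) (vword k), wp_mem _ _⟩
  have hy := isOfFinOrder_of_finite y
  obtain ⟨n, hn, h⟩ := isOfFinOrder_iff_pow_eq_one.1 hy
  refine parity_order f g u (B3.eqb_eq h2) h1 n _ (cnt_vword k) hn ?_
  exact congrArg Subtype.val h

end parity

/-! #### The check for infinite groups -/

/-- The orderings of the three states. -/
def stPerms : List (St × St × St) :=
  [(.a, .b, .c), (.a, .c, .b), (.b, .a, .c), (.b, .c, .a), (.c, .a, .b), (.c, .b, .a)]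

def excCheck (tx ty : St → St) (u : St → Bool) (a b c : St) : Bool :=
  (u a && u b && !u c && St.eqb (tx a) a && St.eqb (ty a) a && St.eqb (tx b) a &&
    St.eqb (ty b) c && St.eqb (tx c) b && St.eqb (ty c) b) ||
  (!u a && u b && u c && St.eqb (tx a) b && St.eqb (tx b) a && St.eqb (ty b) c &&
    St.eqb (tx c) a) ||
  (u a && !u b && !u c && St.eqb (tx a) b && St.eqb (ty a) b && St.eqb (tx b) a &&
    St.eqb (ty b) c && St.eqb (tx c) a && St.eqb (ty c) a)

def infAt (tx ty : St → St) (u : St → Bool) : Bool :=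
  repCheck tx ty u [.a, .b, .c] || repCheck tx ty u [.a, .b] || repCheck tx ty u [.a, .c] ||
  repCheck tx ty u [.b, .c] || stPerms.any fun p => excCheck tx ty u p.1 p.2.1 p.2.2

theorem excCheck_sound {A : BinAutomaton St} {x : Bool} {tx ty : St → St} {u : St → Bool}
    (hx : ∀ q, A.trans q x = tx q) (hy : ∀ q, A.trans q (!x) = ty q)
    (ho : ∀ q y, A.out q y = xor (u q) y) {a b c : St}
    (h : excCheck tx ty u a b c = true) : ¬ Finite A.autGroup := by
  simp only [excCheck, Bool.or_eq_true, Bool.and_eq_true, Bool.not_eq_true'] at h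
  rcases h with (h | h) | h
  · obtain ⟨⟨⟨⟨⟨⟨⟨⟨ua, ub⟩, uc⟩, h1⟩, h2⟩, h3⟩, h4⟩, h5⟩, h6⟩ := h
    apply exceptional_one A a b c x <;>
      simp [ho, hx, hy, ua, ub, uc, St.eqb_eq h1, St.eqb_eq h2, St.eqb_eq h3, St.eqb_eq h4,
        St.eqb_eq h5, St.eqb_eq h6]
  · obtain ⟨⟨⟨⟨⟨⟨ua, ub⟩, uc⟩, h1⟩, h2⟩, h3⟩, h4⟩ := h
    apply exceptional_two A a b c x <;>
      simp [ho, hx, hy, ua, ub, uc, St.eqb_eq h1, St.eqb_eq h2, St.eqb_eq h3, St.eqb_eq h4]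
  · obtain ⟨⟨⟨⟨⟨⟨⟨⟨ua, ub⟩, uc⟩, h1⟩, h2⟩, h3⟩, h4⟩, h5⟩, h6⟩ := h
    apply exceptional_three A a b c x <;>
      simp [ho, hx, hy, ua, ub, uc, St.eqb_eq h1, St.eqb_eq h2, St.eqb_eq h3, St.eqb_eq h4,
        St.eqb_eq h5, St.eqb_eq h6]

theorem infAt_sound {A : BinAutomaton St} {x : Bool} {tx ty : St → St} {u : St → Bool}
    (hx : ∀ q, A.trans q x = tx q) (hy : ∀ q, A.trans q (!x) = ty q)
    (ho : ∀ q y, A.out q y = xor (u q) y)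
    (h : infAt tx ty u = true) : ¬ Finite A.autGroup := by
  have sx : ∀ q, TSec (A.perm q) x (xor (u q) x) (A.perm (tx q)) := by
    intro q
    have := perm_tsec A q x
    rwa [hx, ho] at this
  have sy : ∀ q, TSec (A.perm q) (!x) (xor (u q) (!x)) (A.perm (ty q)) := by
    intro q
    have := perm_tsec A q (!x)
    rwa [hy, ho] at this
  simp only [infAt, Bool.or_eq_true, List.any_eq_true] at h
  rcases h with (((h | h) | h) | h) | ⟨p, -, h⟩
  · exact repCheck_sound sx sy h
  · exact repCheck_sound sx sy h
  · exact repCheck_sound sx sy h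
  · exact repCheck_sound sx sy h
  · exact excCheck_sound hx hy ho h

def infCheck (f g : St → St) (u : St → Bool) : Bool :=
  infAt f g u || parCheck f g u || infAt g f u

theorem infCheck_sound {f g : St → St} {u : St → Bool} (h : infCheck f g u = true) :
    ¬ Finite (stAut f g u).autGroup := by
  simp only [infCheck, Bool.or_eq_true] at h
  rcases h with (h | h) | h
  · exact infAt_sound (x := false) (fun _ => rfl) (fun _ => rfl) (fun _ _ => rfl) h
  · exact parCheck_sound f g u h
  · exact infAt_sound (x := true) (fun _ => rfl) (fun _ => rfl) (fun _ _ => rfl) h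

/-! #### The check for relations -/

/-- Evaluate a state before passing it on. -/
def forceSt {β : Type} (q : St) (k : St → β) : β :=
  match q with
  | .a => k .a
  | .b => k .b
  | .c => k .c

theorem forceSt_eq {β : Type} (q : St) (k : St → β) : forceSt q k = k q := by cases q <;> rfl

/-- Evaluate a boolean before passing it on. -/
def forceB {β : Type} (q : Bool) (k : Bool → β) : β :=
  match q with
  | true => k true
  | false => k false

theorem forceB_eq {β : Type} (q : Bool) (k : Bool → β) : forceB q k = k q := by cases q <;> rfl

/-- Equality of words. -/
def wordEq : List St → List St → Bool
  | [], [] => true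
  | p :: v, q :: w => cond (St.eqb p q) (wordEq v w) false
  | _, _ => false

theorem wordEq_eq : ∀ {v w : List St}, wordEq v w = true → v = w
  | [], [], _ => rfl
  | p :: v, q :: w, h => by
    simp only [wordEq] at h
    rcases hp : St.eqb p q with _ | _
    · simp [hp] at h
    · rw [hp] at h
      rw [St.eqb_eq hp, wordEq_eq h]
  | [], _ :: _, h => by simp [wordEq] at h
  | _ :: _, [], h => by simp [wordEq] at h

def wordMem (v : List St) : List (List St) → Bool
  | [] => false
  | w :: l => cond (wordEq v w) true (wordMem v l)

theorem wordMem_mem {v : List St} {l : List (List St)} (h : wordMem v l = true) : v ∈ l := by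
  induction l with
  | nil => simp [wordMem] at h
  | cons w l ih =>
    simp only [wordMem] at h
    rcases hw : wordEq v w with _ | _
    · rw [hw] at h
      exact List.mem_cons_of_mem _ (ih h)
    · rw [wordEq_eq hw]
      exact List.mem_cons_self

section rel

variable (f g : St → St) (u : St → Bool)

/-- Section of a word in continuation passing style. -/
def secK : List St → Bool → (List St → Bool → Bool) → Bool
  | [], x, k => k [] x
  | q :: w, x, k => forceSt (cond x (g q) (f q)) fun p => forceB (xor (u q) x) fun y =>
      secK w y fun v z => k (p :: v) z

theorem secK_eq (w : List St) (x : Bool) (k : List St → Bool → Bool) :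
    secK f g u w x k = k (wsec (stAut f g u) w x) (wout (stAut f g u) w x) := by
  induction w generalizing x k with
  | nil => rfl
  | cons q w ih =>
    simp only [secK, forceSt_eq, forceB_eq, ih]
    rfl

/-- Add a word to the work list. -/
def addK (v : List St) (todo vis : List (List St))
    (k : List (List St) → List (List St) → Bool) : Bool :=
  cond (wordMem v vis) (k todo vis) (k (v :: todo) (v :: vis))

/-- Close a set of words under sections, checking that all of them fix the letters. -/
def closeK : ℕ → List (List St) → List (List St) → Bool
  | 0, _, _ => false
  | _ + 1, [], _ => true
  | n + 1, w :: todo, vis =>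
    secK f g u w false fun v0 y0 => cond y0 false <|
      secK f g u w true fun v1 y1 => cond y1
        (addK v0 todo vis fun todo vis => addK v1 todo vis fun todo vis => closeK n todo vis) false

def trivCheck (w : List St) : Bool := closeK f g u 30 [w] [w]

/-- `w` fixes the letters and has sections in `V`. -/
def WOk (V : Set (List St)) (w : List St) : Prop :=
  (∀ x, wout (stAut f g u) w x = x) ∧ ∀ x, wsec (stAut f g u) w x ∈ V

variable {f g u}

theorem addK_sound {v : List St} {todo vis : List (List St)}
    {k : List (List St) → List (List St) → Bool} (h : addK v todo vis k = true) :
    ∃ todo' vis', k todo' vis' = true ∧ (∀ w ∈ vis, w ∈ vis') ∧ v ∈ vis' ∧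
      (∀ w ∈ todo, w ∈ todo') ∧ (∀ w ∈ vis', w ∈ vis ∨ w ∈ todo') := by
  unfold addK at h
  rcases hm : wordMem v vis with _ | _
  · rw [hm] at h
    refine ⟨_, _, h, ?_, ?_, ?_, ?_⟩
    · intro w hw; exact List.mem_cons_of_mem _ hw
    · exact List.mem_cons_self
    · intro w hw; exact List.mem_cons_of_mem _ hw
    · intro w hw
      rcases List.mem_cons.1 hw with rfl | hw
      · exact Or.inr List.mem_cons_self
      · exact Or.inl hw
  · rw [hm] at h
    exact ⟨_, _, h, fun _ hw => hw, wordMem_mem hm, fun _ hw => hw, fun _ hw => Or.inl hw⟩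

theorem closeK_sound (n : ℕ) : ∀ todo vis : List (List St), closeK f g u n todo vis = true →
    (∀ w ∈ vis, w ∈ todo ∨ WOk f g u {v | v ∈ vis} w) →
    ∃ V : Set (List St), (∀ w ∈ vis, w ∈ V) ∧ ∀ w ∈ V, WOk f g u V w := by
  induction n with
  | zero => intro todo vis h; simp [closeK] at h
  | succ n ih =>
    intro todo vis h hinv
    cases todo with
    | nil =>
      exact ⟨{v | v ∈ vis}, fun w hw => hw, fun w hw => (hinv w hw).resolve_left (by simp)⟩
    | cons w todo =>
      simp only [closeK, secK_eq] at h
      rcases h0 : wout (stAut f g u) w false with _ | _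
      swap
      · simp [h0] at h
      rcases h1 : wout (stAut f g u) w true with _ | _
      · simp [h1] at h
      simp only [h0, h1, cond_false, cond_true] at h
      obtain ⟨t1, v1, h, a1, a2, a3, a4⟩ := addK_sound h
      obtain ⟨t2, v2, h, b1, b2, b3, b4⟩ := addK_sound h
      obtain ⟨V, c1, c2⟩ := ih t2 v2 h (by
        intro y hy
        rcases b4 y hy with hy | hy
        swap
        · exact Or.inl hy
        rcases a4 y hy with hy | hy
        swap
        · exact Or.inl (b3 _ hy)
        have step : ∀ z, WOk f g u {v | v ∈ vis} z → WOk f g u {v | v ∈ v2} z :=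
          fun z hz => ⟨hz.1, fun x => b1 _ (a1 _ (hz.2 x))⟩
        rcases hinv y hy with hy | hy
        · rcases List.mem_cons.1 hy with rfl | hy
          · right
            refine ⟨fun x => ?_, fun x => ?_⟩
            · cases x <;> assumption
            · cases x
              · exact b1 _ a2
              · exact b2
          · exact Or.inl (b3 _ (a3 _ hy))
        · exact Or.inr (step _ hy))
      exact ⟨V, fun y hy => c1 _ (b1 _ (a1 _ hy)), c2⟩

theorem wp_nil (A : BinAutomaton St) (w : List St) : wp A w [] = [] := by
  induction w with
  | nil => rfl
  | cons q w ih => exact ih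

theorem wok_trivial {V : Set (List St)} (hV : ∀ w ∈ V, WOk f g u V w) (l : List Bool) :
    ∀ w ∈ V, wp (stAut f g u) w l = l := by
  induction l with
  | nil =>
    intro w _
    exact wp_nil _ w
  | cons x l ih =>
    intro w hw
    rw [wp_tsec (stAut f g u) w x l, (hV w hw).1, ih _ ((hV w hw).2 x)]

theorem trivCheck_sound {w : List St} (h : trivCheck f g u w = true) :
    wp (stAut f g u) w = 1 := by
  obtain ⟨V, h1, h2⟩ := closeK_sound 30 [w] [w] h (fun v hv => Or.inl hv)
  ext1 l
  exact wok_trivial h2 l w (h1 w (by simp))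

end rel

/-- Check the relations of `D₄ × C₂`. -/
def finAt (f g : St → St) (u : St → Bool) (p q r : St) : Bool :=
  (trivCheck f g u [p, p] && trivCheck f g u [q, q] && trivCheck f g u [r, r] &&
    trivCheck f g u [p, r, p, r] && trivCheck f g u [q, r, q, r] &&
    trivCheck f g u [p, q, p, q, p, q, p, q]) ||
  (trivCheck f g u [p, p] && trivCheck f g u [p, q, p, q] && trivCheck f g u [r, r] &&
    trivCheck f g u [p, r, p, r] && trivCheck f g u [p, q, r, p, q, r] &&
    trivCheck f g u [q, q, q, q])

def finCheck (f g : St → St) (u : St → Bool) : Bool :=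
  stPerms.any fun p => finAt f g u p.1 p.2.1 p.2.2

def forallSt (k : St → Bool) : Bool := k .a && k .b && k .c
def forallB (k : Bool → Bool) : Bool := k true && k false

theorem forallSt_spec {k : St → Bool} (h : forallSt k = true) (q : St) : k q = true := by
  simp only [forallSt, Bool.and_eq_true] at h
  cases q
  · exact h.1.1
  · exact h.1.2
  · exact h.2

theorem forallB_spec {k : Bool → Bool} (h : forallB k = true) (q : Bool) : k q = true := by
  simp only [forallB, Bool.and_eq_true] at h
  cases q
  · exact h.2
  · exact h.1

def checkOne (f g : St → St) (u : St → Bool) : Bool := infCheck f g u || finCheck f g u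

def checkAct (u : St → Bool) : Bool :=
  forallSt fun x => forallSt fun y => forallSt fun z =>
  forallSt fun x' => forallSt fun y' => forallSt fun z' =>
    checkOne (St.tab x y z) (St.tab x' y' z') u

set_option maxRecDepth 100000 in
theorem checkAct_tff : checkAct (St.tab true false false) = true := by decide +kernel

set_option maxRecDepth 100000 in
theorem checkAct_ttf : checkAct (St.tab true true false) = true := by decide +kernel


/-! ### Quotients of `D₄ × C₂` -/

section quotients

/-- The cyclic group of order two. -/
abbrev C2 := Multiplicative (ZMod 2)

/-- The group `D₄ × C₂`. -/
abbrev DC := DihedralGroup 4 × C2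

variable {M : Type} [Group M]

theorem pow_val_add {n : ℕ} [NeZero n] {t : M} (ht : t ^ n = 1) (i j : ZMod n) :
    t ^ (i + j).val = t ^ i.val * t ^ j.val := by
  rw [ZMod.val_add, ← pow_add, ← pow_eq_pow_mod _ ht]

theorem pow_val_sub {n : ℕ} [NeZero n] {t : M} (ht : t ^ n = 1) (i j : ZMod n) :
    t ^ (j - i).val = (t ^ i.val)⁻¹ * t ^ j.val := by
  rw [eq_inv_mul_iff_mul_eq, ← pow_val_add ht]
  congr 2
  ring

theorem conj_pow_inv {x y : M} (hx : x * x = 1) (hy : y * y = 1) (n : ℕ) :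
    x * (x * y) ^ n * x = ((x * y) ^ n)⁻¹ := by
  have hxi : x⁻¹ = x := inv_eq_of_mul_eq_one_right hx
  have hyi : y⁻¹ = y := inv_eq_of_mul_eq_one_right hy
  have e : x * (x * y) * x⁻¹ = (x * y)⁻¹ := by
    rw [mul_inv_rev, hyi, hxi, ← mul_assoc, hx, one_mul]
  have := conj_pow (i := n) (a := x) (b := x * y)
  rw [e, hxi, inv_pow] at this
  exact this.symm

/-- The map from the dihedral group given by two elements. -/
def dihFun (x y : M) : DihedralGroup 4 → M
  | .r i => (x * y) ^ i.val
  | .sr i => x * (x * y) ^ i.val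

/-- The map from `C₂` given by an element. -/
def cycFun (z : M) (i : C2) : M := z ^ (Multiplicative.toAdd i).val

/-- The homomorphism from the dihedral group given by two involutions. -/
def dihHom {x y : M} (hx : x * x = 1) (hy : y * y = 1) (hxy : (x * y) ^ 4 = 1) :
    DihedralGroup 4 →* M :=
  MonoidHom.mk' (dihFun x y) (by
    have key : ∀ n, (x * y) ^ n * x = x * ((x * y) ^ n)⁻¹ := by
      intro n
      rw [← conj_pow_inv hx hy n, ← mul_assoc, ← mul_assoc, hx, one_mul]
    rintro (i | i) (j | j)
    · simp only [DihedralGroup.r_mul_r, dihFun]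
      exact pow_val_add hxy i j
    · simp only [DihedralGroup.r_mul_sr, dihFun]
      rw [pow_val_sub hxy, ← mul_assoc, ← mul_assoc, key]
    · simp only [DihedralGroup.sr_mul_r, dihFun]
      rw [pow_val_add hxy, mul_assoc]
    · simp only [DihedralGroup.sr_mul_sr, dihFun]
      rw [pow_val_sub hxy, mul_assoc, ← mul_assoc _ x, key, mul_assoc, ← mul_assoc x, hx,
        one_mul])

/-- The homomorphism from `C₂` given by an involution. -/
def cycHom {z : M} (hz : z * z = 1) : C2 →* M :=
  MonoidHom.mk' (cycFun z) (by
    intro i j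
    have hz : z ^ 2 = 1 := by rw [pow_two, hz]
    exact pow_val_add hz (Multiplicative.toAdd i) (Multiplicative.toAdd j))

/-- The homomorphism from `D₄ × C₂` given by the relations. -/
def dcHom {x y z : M} (hx : x * x = 1) (hy : y * y = 1) (hz : z * z = 1)
    (hxz : x * z = z * x) (hyz : y * z = z * y) (hxy : (x * y) ^ 4 = 1) : DC →* M :=
  MonoidHom.noncommCoprod (dihHom hx hy hxy) (cycHom hz) (by
    have hc : Commute (x * y) z := Commute.mul_left hxz hyz
    rintro (i | i) j
    · exact (hc.pow_left _).pow_right _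
    · exact (Commute.mul_left hxz (hc.pow_left _)).pow_right _)

theorem dcHom_x {x y z : M} (hx : x * x = 1) (hy : y * y = 1) (hz : z * z = 1)
    (hxz : x * z = z * x) (hyz : y * z = z * y) (hxy : (x * y) ^ 4 = 1) :
    dcHom hx hy hz hxz hyz hxy (.sr 0, 1) = x := by
  show x * (x * y) ^ 0 * z ^ 0 = x
  simp

theorem dcHom_y {x y z : M} (hx : x * x = 1) (hy : y * y = 1) (hz : z * z = 1)
    (hxz : x * z = z * x) (hyz : y * z = z * y) (hxy : (x * y) ^ 4 = 1) :
    dcHom hx hy hz hxz hyz hxy (.sr 1, 1) = y := by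
  show x * (x * y) ^ 1 * z ^ 0 = y
  rw [pow_zero, pow_one, mul_one, ← mul_assoc, hx, one_mul]

theorem dcHom_z {x y z : M} (hx : x * x = 1) (hy : y * y = 1) (hz : z * z = 1)
    (hxz : x * z = z * x) (hyz : y * z = z * y) (hxy : (x * y) ^ 4 = 1) :
    dcHom hx hy hz hxz hyz hxy (1, .ofAdd 1) = z := by
  show (x * y) ^ 0 * z ^ 1 = z
  simp

theorem dcHom_range {x y z : M} (hx : x * x = 1) (hy : y * y = 1) (hz : z * z = 1)
    (hxz : x * z = z * x) (hyz : y * z = z * y) (hxy : (x * y) ^ 4 = 1) {H : Subgroup M}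
    (mx : x ∈ H) (my : y ∈ H) (mz : z ∈ H) : (dcHom hx hy hz hxz hyz hxy).range ≤ H := by
  rintro _ ⟨⟨i | i, j⟩, rfl⟩
  · show (x * y) ^ _ * z ^ _ ∈ H
    exact mul_mem (pow_mem (mul_mem mx my) _) (pow_mem mz _)
  · show x * (x * y) ^ _ * z ^ _ ∈ H
    exact mul_mem (mul_mem mx (pow_mem (mul_mem mx my) _)) (pow_mem mz _)

theorem mul_comm_of_sq {G : Type} [Group G] (hG : ∀ g : G, g * g = 1) (a b : G) :
    a * b = b * a := by
  have hi : ∀ g : G, g⁻¹ = g := fun g => inv_eq_of_mul_eq_one_right (hG g)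
  have := mul_inv_rev a b
  rwa [hi, hi, hi] at this

/-- Elementary abelian two-groups of the same order are isomorphic. -/
theorem elementary_iso {G H : Type} [Group G] [Group H] [Finite G] [Finite H]
    (hG : ∀ g : G, g * g = 1) (hH : ∀ g : H, g * g = 1) (hc : Nat.card G = Nat.card H) :
    Nonempty (G ≃* H) := by
  have cG : ∀ a b : G, a * b = b * a := mul_comm_of_sq hG
  have cH : ∀ a b : H, a * b = b * a := mul_comm_of_sq hH
  let iG : CommGroup G := { (inferInstance : Group G) with mul_comm := cG }
  let iH : CommGroup H := { (inferInstance : Group H) with mul_comm := cH }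
  let mG : Module (ZMod 2) (Additive G) := AddCommGroup.zmodModule (by
    intro x; rw [two_nsmul]; exact hG x)
  let mH : Module (ZMod 2) (Additive H) := AddCommGroup.zmodModule (by
    intro x; rw [two_nsmul]; exact hH x)
  have hcard : Nat.card (Additive G) = Nat.card (Additive H) := hc
  have : Module.Finite (ZMod 2) (Additive G) := Module.Finite.of_finite
  have : Module.Finite (ZMod 2) (Additive H) := Module.Finite.of_finite
  rw [Module.natCard_eq_pow_finrank (K := ZMod 2) (V := Additive G),
    Module.natCard_eq_pow_finrank (K := ZMod 2) (V := Additive H), Nat.card_zmod] at hcard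
  have hr := Nat.pow_right_injective (le_refl 2) hcard
  let e := LinearEquiv.ofFinrankEq (Additive G) (Additive H) hr
  exact ⟨MulEquiv.mk' e.toEquiv (fun a b => e.map_add a b)⟩

/-- The six groups. -/
def SixGroups.{u} (G : Type) [Group G] : Prop :=
  Nonempty (G ≃* PUnit.{u + 1}) ∨
  Nonempty (G ≃* Multiplicative (ZMod 2)) ∨
  Nonempty (G ≃* (Multiplicative (ZMod 2) × Multiplicative (ZMod 2))) ∨
  Nonempty (G ≃* DihedralGroup 4) ∨
  Nonempty (G ≃*
    (Multiplicative (ZMod 2) × Multiplicative (ZMod 2) × Multiplicative (ZMod 2))) ∨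
  Nonempty (G ≃* (DihedralGroup 4 × Multiplicative (ZMod 2)))

theorem six_of_elementary.{u} (F : DC →* M) (h : F (.r 2, 1) = 1) : SixGroups.{u} F.range := by
  have hsq : ∀ g : F.range, g * g = 1 := by
    rintro ⟨_, k, rfl⟩
    apply Subtype.ext
    show F k * F k = 1
    rw [← map_mul]
    have : ∀ k : DC, k * k = 1 ∨ k * k = (.r 2, 1) := by decide
    rcases this k with e | e
    · rw [e, map_one]
    · rw [e, h]
  have hfin : Finite F.range := Set.finite_range F
  have h16 : Nat.card DC = 16 := by
    rw [Nat.card_prod, DihedralGroup.nat_card]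
    have : Nat.card C2 = 2 := Nat.card_zmod 2
    rw [this]
  have hc2 : Nat.card C2 = 2 := Nat.card_zmod 2
  have hdvd : Nat.card F.range ∣ 16 := by
    rw [← h16]; exact Subgroup.card_range_dvd F
  have hne : Nat.card F.range ≠ 16 := by
    intro he
    have hb : Function.Bijective F.rangeRestrict :=
      (Nat.bijective_iff_surjective_and_card _).2 ⟨F.rangeRestrict_surjective, by rw [h16, he]⟩
    have e1 : F.rangeRestrict (.r 2, 1) = F.rangeRestrict 1 := by
      apply Subtype.ext
      show F _ = F _
      rw [h, map_one]
    exact absurd (hb.1 e1) (by decide)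
  have hmem : Nat.card F.range ∈ Nat.divisors 16 := Nat.mem_divisors.2 ⟨hdvd, by norm_num⟩
  have hdiv : Nat.divisors 16 = {1, 2, 4, 8, 16} := by decide
  rw [hdiv] at hmem
  simp only [Finset.mem_insert, Finset.mem_singleton] at hmem
  rcases hmem with e | e | e | e | e
  · refine Or.inl ?_
    have : Subsingleton F.range := (Nat.card_eq_one_iff_unique.1 e).1
    exact ⟨MulEquiv.mk' ⟨fun _ => PUnit.unit, fun _ => 1, fun _ => Subsingleton.elim _ _,
      fun _ => rfl⟩ (fun _ _ => rfl)⟩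
  · exact Or.inr (Or.inl (elementary_iso hsq (by decide) (by rw [e, hc2])))
  · exact Or.inr (Or.inr (Or.inl (elementary_iso hsq (by decide)
      (by rw [e, Nat.card_prod, hc2]))))
  · exact Or.inr (Or.inr (Or.inr (Or.inr (Or.inl (elementary_iso hsq (by decide)
      (by rw [e, Nat.card_prod, Nat.card_prod, hc2]))))))
  · exact absurd e hne

theorem six_of_dc.{u} (F : DC →* M) : SixGroups.{u} F.range := by
  by_cases h : F (.r 2, 1) = 1
  · exact six_of_elementary F h
  have hinj : ∀ d : DihedralGroup 4, F (d, 1) = 1 → d = 1 := by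
    intro d hd
    by_contra hne
    apply h
    have hk : ∀ g k : DC, F k = 1 → F (g * k * g⁻¹) = 1 := by
      intro g k hk; simp [hk]
    have : ∀ d : DihedralGroup 4, d ≠ 1 → d = .r 2 ∨ d * d = .r 2 ∨
        d * (.r 1 * d * (.r 1)⁻¹) = .r 2 := by decide
    rcases this d hne with e | e | e
    · rw [← e]; exact hd
    · have e2 : ((.r 2, 1) : DC) = (d, 1) * (d, 1) := by rw [← e]; simp
      rw [e2, map_mul, hd, one_mul]
    · have e2 : ((.r 2, 1) : DC) = (d, 1) * ((.r 1, 1) * (d, 1) * (.r 1, 1)⁻¹) := by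
        rw [← e]; simp
      rw [e2, map_mul, hd, one_mul, hk _ _ hd]
  let F1 : DihedralGroup 4 →* M := F.comp (MonoidHom.inl _ _)
  have hF1 : Function.Injective F1 := (injective_iff_map_eq_one F1).2 hinj
  have hc2 : ∀ c : C2, c = 1 ∨ c = .ofAdd 1 := by decide
  by_cases hc : F (1, .ofAdd 1) ∈ F1.range
  · have : F.range = F1.range := by
      apply le_antisymm
      · rintro _ ⟨⟨d, c⟩, rfl⟩
        have e : ((d, c) : DC) = (d, 1) * (1, c) := by simp
        rw [e, map_mul]
        refine mul_mem ⟨d, rfl⟩ ?_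
        rcases hc2 c with rfl | rfl
        · exact ⟨1, rfl⟩
        · exact hc
      · rintro _ ⟨d, rfl⟩
        exact ⟨_, rfl⟩
    rw [this]
    exact Or.inr (Or.inr (Or.inr (Or.inl ⟨(MonoidHom.ofInjective hF1).symm⟩)))
  · have hF : Function.Injective F := by
      refine (injective_iff_map_eq_one F).2 ?_
      rintro ⟨d, c⟩ hdc
      rcases hc2 c with rfl | rfl
      · rw [hinj d hdc]; rfl
      · exfalso
        apply hc
        have e : ((d, .ofAdd 1) : DC) = (d, 1) * (1, .ofAdd 1) := by simp
        rw [e, map_mul] at hdc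
        refine ⟨d⁻¹, ?_⟩
        rw [map_inv]
        exact inv_eq_of_mul_eq_one_right hdc
    exact Or.inr (Or.inr (Or.inr (Or.inr (Or.inr ⟨(MonoidHom.ofInjective hF).symm⟩))))

end quotients

/-! ### Conclusion -/

theorem commute_of_word {M : Type} [Group M] {x z : M} (hx : x * x = 1) (hz : z * z = 1)
    (h : z * x * z * x = 1) : x * z = z * x := by
  have hxi : x⁻¹ = x := inv_eq_of_mul_eq_one_right hx
  have hzi : z⁻¹ = z := inv_eq_of_mul_eq_one_right hz
  rw [mul_assoc] at h
  have := eq_inv_of_mul_eq_one_left h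
  rw [mul_inv_rev, hxi, hzi] at this
  exact this.symm

theorem six_of_relations.{u} {A : BinAutomaton St} {x y z : Equiv.Perm (List Bool)}
    (hx : x * x = 1) (hy : y * y = 1) (hz : z * z = 1)
    (hxz : x * z = z * x) (hyz : y * z = z * y) (hxy : (x * y) ^ 4 = 1)
    (mx : x ∈ A.autGroup) (my : y ∈ A.autGroup) (mz : z ∈ A.autGroup)
    (hgen : ∀ H : Subgroup (Equiv.Perm (List Bool)), x ∈ H → y ∈ H → z ∈ H →
      ∀ q, A.perm q ∈ H) : SixGroups.{u} A.autGroup := by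
  have : A.autGroup = (dcHom hx hy hz hxz hyz hxy).range := by
    apply le_antisymm
    · rw [BinAutomaton.autGroup, Subgroup.closure_le]
      rintro _ ⟨q, rfl⟩
      exact hgen (dcHom hx hy hz hxz hyz hxy).range ⟨_, dcHom_x hx hy hz hxz hyz hxy⟩
        ⟨_, dcHom_y hx hy hz hxz hyz hxy⟩ ⟨_, dcHom_z hx hy hz hxz hyz hxy⟩ q
    · exact dcHom_range hx hy hz hxz hyz hxy mx my mz
  rw [this]
  exact six_of_dc.{u} _

theorem finAt_sound.{u} {f g : St → St} {u : St → Bool} {p q r : St}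
    (hpqr : ∀ s, s = p ∨ s = q ∨ s = r) (h : finAt f g u p q r = true) :
    SixGroups.{u} (stAut f g u).autGroup := by
  simp only [finAt, Bool.or_eq_true, Bool.and_eq_true] at h
  have mp := perm_mem (stAut f g u) p
  have mq := perm_mem (stAut f g u) q
  have mr := perm_mem (stAut f g u) r
  rcases h with ⟨⟨⟨⟨⟨h1, h2⟩, h3⟩, h4⟩, h5⟩, h6⟩ | ⟨⟨⟨⟨⟨h1, h2⟩, h3⟩, h4⟩, h5⟩, h6⟩
  · replace h1 := trivCheck_sound h1
    replace h2 := trivCheck_sound h2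
    replace h3 := trivCheck_sound h3
    replace h4 := trivCheck_sound h4
    replace h5 := trivCheck_sound h5
    replace h6 := trivCheck_sound h6
    simp only [wp, one_mul] at h1 h2 h3 h4 h5 h6
    refine six_of_relations.{u} (x := (stAut f g u).perm q) (y := (stAut f g u).perm p)
      h2 h1 h3 (commute_of_word h2 h3 h5) (commute_of_word h1 h3 h4) ?_ mq mp mr ?_
    · rw [← h6]; simp only [pow_succ, pow_zero, one_mul, mul_assoc]
    · intro H a1 a2 a3 s
      rcases hpqr s with rfl | rfl | rfl <;> assumption
  · replace h1 := trivCheck_sound h1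
    replace h2 := trivCheck_sound h2
    replace h3 := trivCheck_sound h3
    replace h4 := trivCheck_sound h4
    replace h5 := trivCheck_sound h5
    replace h6 := trivCheck_sound h6
    simp only [wp, one_mul] at h1 h2 h3 h4 h5 h6
    have hy : (stAut f g u).perm q * (stAut f g u).perm p *
        ((stAut f g u).perm q * (stAut f g u).perm p) = 1 := by
      rw [← h2]; simp only [mul_assoc]
    refine six_of_relations.{u} (y := (stAut f g u).perm p)
      (x := (stAut f g u).perm q * (stAut f g u).perm p)
      hy h1 h3 (commute_of_word hy h3 ?_) (commute_of_word h1 h3 h4) ?_ (mul_mem mq mp) mp mr ?_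
    · rw [← h5]; simp only [mul_assoc]
    · rw [mul_assoc, h1, mul_one, ← h6]; simp only [pow_succ, pow_zero, one_mul]
    · intro H a1 a2 a3 s
      rcases hpqr s with rfl | rfl | rfl
      · exact a2
      · have := mul_mem a1 a2
        rwa [mul_assoc, h1, mul_one] at this
      · exact a3

theorem stPerms_cover : ∀ t ∈ stPerms, ∀ s, s = t.1 ∨ s = t.2.1 ∨ s = t.2.2 := by
  intro t ht s
  simp only [stPerms, List.mem_cons, List.not_mem_nil, or_false] at ht
  rcases ht with rfl | rfl | rfl | rfl | rfl | rfl <;> cases s <;> simp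

theorem checkOne_sound.{u} {f g : St → St} {u : St → Bool} (h : checkOne f g u = true)
    (hfin : Finite (stAut f g u).autGroup) : SixGroups.{u} (stAut f g u).autGroup := by
  simp only [checkOne, Bool.or_eq_true] at h
  rcases h with h | h
  · exact absurd hfin (infCheck_sound h)
  · simp only [finCheck, List.any_eq_true] at h
    obtain ⟨t, ht, h⟩ := h
    exact finAt_sound.{u} (stPerms_cover t ht) h

theorem checkAct_sound {u : St → Bool} (h : checkAct u = true) (f g : St → St) :
    checkOne f g u = true := by
  have := forallSt_spec (forallSt_spec (forallSt_spec (forallSt_spec (forallSt_spec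
    (forallSt_spec h (f .a)) (f .b)) (f .c)) (g .a)) (g .b)) (g .c)
  rwa [St.tab_eta, St.tab_eta] at this

/-- Renaming the states. -/
def relabel {Q R : Type} (A : BinAutomaton Q) (e : Q ≃ R) : BinAutomaton R where
  trans q x := e (A.trans (e.symm q) x)
  out q x := A.out (e.symm q) x
  out_bij q := A.out_bij (e.symm q)

theorem relabel_act {Q R : Type} (A : BinAutomaton Q) (e : Q ≃ R) (l : List Bool) :
    ∀ q, (relabel A e).act q l = A.act (e.symm q) l := by
  induction l with
  | nil => intro q; rfl
  | cons x l ih =>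
    intro q
    simp only [BinAutomaton.act, ih]
    simp [relabel]

theorem relabel_autGroup {Q R : Type} (A : BinAutomaton Q) (e : Q ≃ R) :
    (relabel A e).autGroup = A.autGroup := by
  have hp : ∀ q, (relabel A e).perm q = A.perm (e.symm q) := by
    intro q
    ext1 l
    exact relabel_act A e l q
  unfold BinAutomaton.autGroup
  congr 1
  ext s
  constructor
  · rintro ⟨q, rfl⟩
    exact ⟨_, (hp q).symm⟩
  · rintro ⟨q, rfl⟩
    refine ⟨e q, ?_⟩
    rw [hp, e.symm_apply_apply]

theorem exists_stAut (A : BinAutomaton St) : ∃ f g u, A = stAut f g u := by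
  refine ⟨fun q => A.trans q false, fun q => A.trans q true, fun q => A.out q false, ?_⟩
  rcases A with ⟨t, o, hb⟩
  simp only [stAut, BinAutomaton.mk.injEq]
  constructor
  · funext q x; cases x <;> rfl
  · funext q x
    cases x
    · simp
    · have := (hb q).1.ne (a₁ := true) (a₂ := false) (by decide)
      revert this
      cases o q true <;> cases o q false <;> simp

/-- The states as numbers. -/
def stFin : Fin 3 ≃ St where
  toFun i := match i with
    | 0 => .a
    | 1 => .b
    | 2 => .c
  invFun q := match q with
    | .a => 0
    | .b => 1
    | .c => 2
  left_inv i := by fin_cases i <;> rfl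
  right_inv q := by cases q <;> rfl

def swapAB : St ≃ St where
  toFun := St.tab .b .a .c
  invFun := St.tab .b .a .c
  left_inv q := by cases q <;> rfl
  right_inv q := by cases q <;> rfl

def swapAC : St ≃ St where
  toFun := St.tab .c .b .a
  invFun := St.tab .c .b .a
  left_inv q := by cases q <;> rfl
  right_inv q := by cases q <;> rfl

def swapBC : St ≃ St where
  toFun := St.tab .a .c .b
  invFun := St.tab .a .c .b
  left_inv q := by cases q <;> rfl
  right_inv q := by cases q <;> rfl

/-- The four sorted activity vectors. -/
def Sorted3 (v : St → Bool) : Prop :=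
  v = St.tab false false false ∨ v = St.tab true false false ∨ v = St.tab true true false ∨
    v = St.tab true true true

theorem exists_sort (u : St → Bool) : ∃ e : St ≃ St, Sorted3 (fun q => u (e.symm q)) := by
  rw [← St.tab_eta u]
  have key : ∀ (e : St ≃ St) (v w : St → Bool), (∀ q, v (e.symm q) = w q) →
      (fun q => v (e.symm q)) = w := fun e v w h => funext h
  unfold Sorted3
  rcases u .a with _ | _ <;> rcases u .b with _ | _ <;> rcases u .c with _ | _
  · exact ⟨.refl _, Or.inl rfl⟩
  · exact ⟨swapAC, Or.inr (Or.inl (key _ _ _ (by rintro (_ | _ | _) <;> rfl)))⟩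
  · exact ⟨swapAB, Or.inr (Or.inl (key _ _ _ (by rintro (_ | _ | _) <;> rfl)))⟩
  · exact ⟨swapAC, Or.inr (Or.inr (Or.inl (key _ _ _ (by rintro (_ | _ | _) <;> rfl))))⟩
  · exact ⟨.refl _, Or.inr (Or.inl rfl)⟩
  · exact ⟨swapBC, Or.inr (Or.inr (Or.inl (key _ _ _ (by rintro (_ | _ | _) <;> rfl))))⟩
  · exact ⟨.refl _, Or.inr (Or.inr (Or.inl rfl))⟩
  · exact ⟨.refl _, Or.inr (Or.inr (Or.inr rfl))⟩

theorem act_const {A : BinAutomaton St} {b : Bool} (h : ∀ q x, A.out q x = xor b x)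
    (l : List Bool) : ∀ q, A.act q l = l.map (xor b) := by
  induction l with
  | nil => intro q; rfl
  | cons x l ih =>
    intro q
    simp only [BinAutomaton.act, ih, h, List.map_cons]

/-- If all states have the same activity they coincide and have order at most two. -/
theorem six_of_const.{u} {A : BinAutomaton St} {b : Bool} (h : ∀ q x, A.out q x = xor b x) :
    SixGroups.{u} A.autGroup := by
  have he : ∀ q, A.perm q = A.perm .a := by
    intro q
    ext1 l
    exact (act_const h l q).trans (act_const h l .a).symm
  have hx : A.perm .a * A.perm .a = 1 := by
    ext1 l
    show A.act .a (A.act .a l) = l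
    rw [act_const h, act_const h, List.map_map]
    have : (xor b ∘ xor b) = id := by funext y; cases b <;> cases y <;> rfl
    rw [this, List.map_id]
  have m := perm_mem A .a
  refine six_of_relations.{u} hx hx hx rfl rfl (by rw [hx, one_pow]) m m m ?_
  intro H a1 _ _ q
  rw [he]
  exact a1

theorem six_of_finite.{u} (A : BinAutomaton St) (hfin : Finite A.autGroup) :
    SixGroups.{u} A.autGroup := by
  obtain ⟨e, he⟩ := exists_sort (fun q => A.out q false)
  rw [← relabel_autGroup A e] at hfin ⊢
  obtain ⟨f, g, u, hA⟩ := exists_stAut (relabel A e)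
  have hu : u = fun q => A.out (e.symm q) false := by
    funext q
    have : (relabel A e).out q false = (stAut f g u).out q false := by rw [hA]
    simpa [relabel, stAut] using this.symm
  rw [← hu] at he
  rw [hA] at hfin ⊢
  rcases he with rfl | rfl | rfl | rfl
  · exact six_of_const.{u} (b := false) (by rintro (_ | _ | _) x <;> rfl)
  · exact checkOne_sound.{u} (checkAct_sound checkAct_tff f g) hfin
  · exact checkOne_sound.{u} (checkAct_sound checkAct_ttf f g) hfin
  · exact six_of_const.{u} (b := true) (by rintro (_ | _ | _) x <;> rfl)

/-! ### Realizations -/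

theorem realize {A : BinAutomaton St} {K : Type} [Group K] (F : K →* Equiv.Perm (List Bool))
    (hF : ∀ k, F k = 1 → k = 1) (hgen : ∀ q, A.perm q ∈ F.range) (hle : F.range ≤ A.autGroup) :
    Nonempty (A.autGroup ≃* K) := by
  have : A.autGroup = F.range := by
    refine le_antisymm ?_ hle
    rw [BinAutomaton.autGroup, Subgroup.closure_le]
    rintro _ ⟨q, rfl⟩
    exact hgen q
  rw [this]
  exact ⟨(MonoidHom.ofInjective ((injective_iff_map_eq_one F).2 hF)).symm⟩

theorem cyc_mem {M : Type} [Group M] {z : M} (hz : z * z = 1) {H : Subgroup M} (h : z ∈ H)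
    (c : C2) : cycHom hz c ∈ H := pow_mem h _

theorem dih_mem {M : Type} [Group M] {x y : M} (hx : x * x = 1) (hy : y * y = 1)
    (hxy : (x * y) ^ 4 = 1) {H : Subgroup M} (mx : x ∈ H) (my : y ∈ H) (d : DihedralGroup 4) :
    dihHom hx hy hxy d ∈ H := by
  rcases d with i | i
  · exact pow_mem (mul_mem mx my) _
  · exact mul_mem mx (pow_mem (mul_mem mx my) _)

/-- The automaton generating the trivial group. -/
def autE : BinAutomaton St :=
  stAut (St.tab .a .a .a) (St.tab .a .a .a) (St.tab false false false)

def autC2 : BinAutomaton St :=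
  stAut (St.tab .b .b .b) (St.tab .b .b .b) (St.tab true false false)

def autV : BinAutomaton St :=
  stAut (St.tab .c .a .c) (St.tab .c .a .c) (St.tab true false false)

def autD : BinAutomaton St :=
  stAut (St.tab .c .a .c) (St.tab .c .c .c) (St.tab true false false)

def autC8 : BinAutomaton St :=
  stAut (St.tab .a .a .b) (St.tab .a .a .b) (St.tab true false false)

def autDC : BinAutomaton St :=
  stAut (St.tab .a .a .a) (St.tab .a .c .a) (St.tab true false false)

theorem autE_iso.{u} : Nonempty (autE.autGroup ≃* PUnit.{u + 1}) := by
  have h : ∀ q, autE.perm q = 1 := by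
    intro q
    have := trivCheck_sound (f := St.tab .a .a .a) (g := St.tab .a .a .a)
      (u := St.tab false false false) (w := [q]) (by cases q <;> decide)
    simp only [wp, one_mul] at this
    exact this
  have hs : ∀ s ∈ autE.autGroup, s = 1 := by
    intro s hs
    have : autE.autGroup ≤ ⊥ := by
      rw [BinAutomaton.autGroup, Subgroup.closure_le]
      rintro _ ⟨q, rfl⟩
      exact h q
    exact Subgroup.mem_bot.1 (this hs)
  exact ⟨MulEquiv.mk' ⟨fun _ => PUnit.unit, fun _ => 1,
    fun s => Subtype.ext (hs s.1 s.2).symm, fun _ => rfl⟩ (fun _ _ => rfl)⟩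

theorem autC2_iso : Nonempty (autC2.autGroup ≃* C2) := by
  have hx : autC2.perm .a * autC2.perm .a = 1 := trivCheck_sound (w := [.a, .a]) (by decide)
  have hb : autC2.perm .b = 1 := trivCheck_sound (w := [.b]) (by decide)
  have hc : autC2.perm .c = 1 := trivCheck_sound (w := [.c]) (by decide)
  refine realize (cycHom hx) ?_ ?_ ?_
  · have H : ∀ k : C2, (cycFun (autC2.perm .a) k) [false] = [false] → k = 1 := by decide +kernel
    exact fun k hk => H k (congrArg (fun s : Equiv.Perm (List Bool) => s _) hk)
  · rintro (_ | _ | _)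
    · exact ⟨.ofAdd 1, rfl⟩
    · rw [hb]; exact one_mem _
    · rw [hc]; exact one_mem _
  · rintro _ ⟨c, rfl⟩
    exact cyc_mem hx (perm_mem _ _) c

theorem autV_iso : Nonempty (autV.autGroup ≃* (C2 × C2)) := by
  have hx : autV.perm .a * autV.perm .a = 1 := trivCheck_sound (w := [.a, .a]) (by decide)
  have hy : autV.perm .b * autV.perm .b = 1 := trivCheck_sound (w := [.b, .b]) (by decide)
  have hxy : autV.perm .a * autV.perm .b = autV.perm .b * autV.perm .a :=
    commute_of_word hx hy (trivCheck_sound (w := [.a, .b, .a, .b]) (by decide))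
  have hc : autV.perm .c = 1 := trivCheck_sound (w := [.c]) (by decide)
  have hcomm : ∀ m n, Commute (cycHom hx m) (cycHom hy n) := fun m n =>
    (Commute.pow_pow hxy _ _)
  refine realize (MonoidHom.noncommCoprod (cycHom hx) (cycHom hy) hcomm) ?_ ?_ ?_
  · have H : ∀ k : C2 × C2, (cycFun (autV.perm .a) k.1 * cycFun (autV.perm .b) k.2)
        [false, false] = [false, false] →
      k = 1 := by decide +kernel
    exact fun k hk => H k (by
      rw [MonoidHom.noncommCoprod_apply] at hk
      exact congrArg (fun s : Equiv.Perm (List Bool) => s _) hk)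
  · rintro (_ | _ | _)
    · exact ⟨(.ofAdd 1, 1), by
        rw [MonoidHom.noncommCoprod_apply, map_one (cycHom hy), mul_one]; rfl⟩
    · exact ⟨(1, .ofAdd 1), by
        rw [MonoidHom.noncommCoprod_apply, map_one (cycHom hx), one_mul]; rfl⟩
    · rw [hc]; exact one_mem _
  · rintro _ ⟨c, rfl⟩
    rw [MonoidHom.noncommCoprod_apply]
    exact mul_mem (cyc_mem hx (perm_mem _ _) _) (cyc_mem hy (perm_mem _ _) _)

theorem autD_iso : Nonempty (autD.autGroup ≃* DihedralGroup 4) := by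
  have hx : autD.perm .a * autD.perm .a = 1 := trivCheck_sound (w := [.a, .a]) (by decide)
  have hy : autD.perm .b * autD.perm .b = 1 := trivCheck_sound (w := [.b, .b]) (by decide)
  have hxy : (autD.perm .a * autD.perm .b) ^ 4 = 1 :=
    trivCheck_sound (w := [.b, .a, .b, .a, .b, .a, .b, .a]) (by decide +kernel)
  have hc : autD.perm .c = 1 := trivCheck_sound (w := [.c]) (by decide)
  refine realize (dihHom hx hy hxy) ?_ ?_ ?_
  · have H : ∀ k : DihedralGroup 4, dihFun (autD.perm .a) (autD.perm .b) k [false, false] = [false, false] →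
      dihFun (autD.perm .a) (autD.perm .b) k [true, false] = [true, false] → k = 1 := by decide +kernel
    exact fun k hk => H k (congrArg (fun s : Equiv.Perm (List Bool) => s _) hk)
      (congrArg (fun s : Equiv.Perm (List Bool) => s _) hk)
  · rintro (_ | _ | _)
    · exact ⟨.sr 0, rfl⟩
    · refine ⟨.sr 1, ?_⟩
      show autD.perm .a * (autD.perm .a * autD.perm .b) ^ 1 = _
      rw [pow_one, ← mul_assoc, hx, one_mul]
    · rw [hc]; exact one_mem _
  · rintro _ ⟨c, rfl⟩
    exact dih_mem hx hy hxy (perm_mem _ _) (perm_mem _ _) c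

theorem autC8_iso : Nonempty (autC8.autGroup ≃* (C2 × C2 × C2)) := by
  have hx : autC8.perm .a * autC8.perm .a = 1 := trivCheck_sound (w := [.a, .a]) (by decide)
  have hy : autC8.perm .b * autC8.perm .b = 1 := trivCheck_sound (w := [.b, .b]) (by decide)
  have hz : autC8.perm .c * autC8.perm .c = 1 := trivCheck_sound (w := [.c, .c]) (by decide)
  have hxy : Commute (autC8.perm .a) (autC8.perm .b) :=
    commute_of_word hx hy (trivCheck_sound (w := [.a, .b, .a, .b]) (by decide))
  have hxz : Commute (autC8.perm .a) (autC8.perm .c) :=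
    commute_of_word hx hz (trivCheck_sound (w := [.a, .c, .a, .c]) (by decide))
  have hyz : Commute (autC8.perm .b) (autC8.perm .c) :=
    commute_of_word hy hz (trivCheck_sound (w := [.b, .c, .b, .c]) (by decide))
  have hcomm : ∀ m n, Commute (cycHom hy m) (cycHom hz n) := fun m n =>
    (Commute.pow_pow hyz _ _)
  have hcomm2 : ∀ m n, Commute (cycHom hx m)
      (MonoidHom.noncommCoprod (cycHom hy) (cycHom hz) hcomm n) := fun m n => by
    rw [MonoidHom.noncommCoprod_apply]
    exact (Commute.pow_pow hxy _ _).mul_right (Commute.pow_pow hxz _ _)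
  refine realize (MonoidHom.noncommCoprod (cycHom hx) _ hcomm2) ?_ ?_ ?_
  · have H : ∀ k : C2 × C2 × C2, (cycFun (autC8.perm .a) k.1 *
        (cycFun (autC8.perm .b) k.2.1 * cycFun (autC8.perm .c) k.2.2))
        [false, false, false] = [false, false, false] → k = 1 := by decide +kernel
    exact fun k hk => H k (by
      rw [MonoidHom.noncommCoprod_apply, MonoidHom.noncommCoprod_apply] at hk
      exact congrArg (fun s : Equiv.Perm (List Bool) => s _) hk)
  · rintro (_ | _ | _)
    · refine ⟨(.ofAdd 1, 1), ?_⟩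
      rw [MonoidHom.noncommCoprod_apply, map_one (MonoidHom.noncommCoprod _ _ _), mul_one]; rfl
    · refine ⟨(1, .ofAdd 1, 1), ?_⟩
      rw [MonoidHom.noncommCoprod_apply, map_one (cycHom hx), one_mul,
        MonoidHom.noncommCoprod_apply, map_one (cycHom hz), mul_one]; rfl
    · refine ⟨(1, 1, .ofAdd 1), ?_⟩
      rw [MonoidHom.noncommCoprod_apply, map_one (cycHom hx), one_mul,
        MonoidHom.noncommCoprod_apply, map_one (cycHom hy), one_mul]; rfl
  · rintro _ ⟨c, rfl⟩
    rw [MonoidHom.noncommCoprod_apply, MonoidHom.noncommCoprod_apply]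
    exact mul_mem (cyc_mem hx (perm_mem _ _) _)
      (mul_mem (cyc_mem hy (perm_mem _ _) _) (cyc_mem hz (perm_mem _ _) _))

theorem autDC_iso : Nonempty (autDC.autGroup ≃* (DihedralGroup 4 × C2)) := by
  have hx : autDC.perm .a * autDC.perm .a = 1 := trivCheck_sound (w := [.a, .a]) (by decide)
  have hy : autDC.perm .b * autDC.perm .b = 1 := trivCheck_sound (w := [.b, .b]) (by decide)
  have hz : autDC.perm .c * autDC.perm .c = 1 := trivCheck_sound (w := [.c, .c]) (by decide)
  have hxz : autDC.perm .a * autDC.perm .c = autDC.perm .c * autDC.perm .a :=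
    commute_of_word hx hz (trivCheck_sound (w := [.a, .c, .a, .c]) (by decide))
  have hyz : autDC.perm .b * autDC.perm .c = autDC.perm .c * autDC.perm .b :=
    commute_of_word hy hz (trivCheck_sound (w := [.b, .c, .b, .c]) (by decide))
  have hxy : (autDC.perm .a * autDC.perm .b) ^ 4 = 1 :=
    trivCheck_sound (w := [.b, .a, .b, .a, .b, .a, .b, .a]) (by decide +kernel)
  refine realize (dcHom hx hy hz hxz hyz hxy) ?_ ?_ ?_
  · have H : ∀ k : DC, (dihFun (autDC.perm .a) (autDC.perm .b) k.1 * cycFun (autDC.perm .c) k.2)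
        [false, false, false] =
        [false, false, false] →
      (dihFun (autDC.perm .a) (autDC.perm .b) k.1 * cycFun (autDC.perm .c) k.2)
        [true, false, false] = [true, false, false] →
        k = 1 := by decide +kernel
    intro k hk
    rw [dcHom, MonoidHom.noncommCoprod_apply] at hk
    exact H k (congrArg (fun s : Equiv.Perm (List Bool) => s _) hk)
      (congrArg (fun s : Equiv.Perm (List Bool) => s _) hk)
  · rintro (_ | _ | _)
    · exact ⟨_, dcHom_x hx hy hz hxz hyz hxy⟩
    · exact ⟨_, dcHom_y hx hy hz hxz hyz hxy⟩
    · exact ⟨_, dcHom_z hx hy hz hxz hyz hxy⟩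
  · exact dcHom_range hx hy hz hxz hyz hxy (perm_mem _ _) (perm_mem _ _) (perm_mem _ _)

/-- Classification of the finite groups generated by invertible automata with
3 states over a 2-letter alphabet: up to isomorphism they are exactly the
trivial group, `C₂`, `C₂ × C₂`, the dihedral group `D₄` of order 8,
`C₂ × C₂ × C₂`, and `D₄ × C₂`. -/
theorem classification_finite_three_state_automaton_groups
    (Q : Type) [Fintype Q] (hQ : Fintype.card Q = 3) :
    (∀ A : BinAutomaton Q, Finite ↥A.autGroup →
      (Nonempty (↥A.autGroup ≃* PUnit) ∨
       Nonempty (↥A.autGroup ≃* Multiplicative (ZMod 2)) ∨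
       Nonempty (↥A.autGroup ≃* (Multiplicative (ZMod 2) × Multiplicative (ZMod 2))) ∨
       Nonempty (↥A.autGroup ≃* DihedralGroup 4) ∨
       Nonempty (↥A.autGroup ≃*
         (Multiplicative (ZMod 2) × Multiplicative (ZMod 2) × Multiplicative (ZMod 2))) ∨
       Nonempty (↥A.autGroup ≃* (DihedralGroup 4 × Multiplicative (ZMod 2))))) ∧
    (∃ A : BinAutomaton Q, Nonempty (↥A.autGroup ≃* PUnit)) ∧
    (∃ A : BinAutomaton Q, Nonempty (↥A.autGroup ≃* Multiplicative (ZMod 2))) ∧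
    (∃ A : BinAutomaton Q,
      Nonempty (↥A.autGroup ≃* (Multiplicative (ZMod 2) × Multiplicative (ZMod 2)))) ∧
    (∃ A : BinAutomaton Q, Nonempty (↥A.autGroup ≃* DihedralGroup 4)) ∧
    (∃ A : BinAutomaton Q, Nonempty (↥A.autGroup ≃*
      (Multiplicative (ZMod 2) × Multiplicative (ZMod 2) × Multiplicative (ZMod 2)))) ∧
    (∃ A : BinAutomaton Q,
      Nonempty (↥A.autGroup ≃* (DihedralGroup 4 × Multiplicative (ZMod 2)))) := by
  have e : Q ≃ St := (Fintype.equivFinOfCardEq hQ).trans stFin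
  have tr : ∀ {P : Subgroup (Equiv.Perm (List Bool)) → Prop} (A : BinAutomaton St),
      P A.autGroup → ∃ B : BinAutomaton Q, P B.autGroup := by
    intro P A hA
    refine ⟨relabel A e.symm, ?_⟩
    rwa [relabel_autGroup]
  refine ⟨fun A hfin => ?_, ?_, ?_, ?_, ?_, ?_, ?_⟩
  · rw [← relabel_autGroup A e] at hfin ⊢
    exact six_of_finite _ hfin
  · exact tr (P := fun G => Nonempty (G ≃* PUnit)) autE autE_iso
  · exact tr (P := fun G => Nonempty (G ≃* C2)) autC2 autC2_iso
  · exact tr (P := fun G => Nonempty (G ≃* (C2 × C2))) autV autV_iso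
  · exact tr (P := fun G => Nonempty (G ≃* DihedralGroup 4)) autD autD_iso
  · exact tr (P := fun G => Nonempty (G ≃* (C2 × C2 × C2))) autC8 autC8_iso
  · exact tr (P := fun G => Nonempty (G ≃* (DihedralGroup 4 × C2))) autDC autDC_iso
end

section
/- The abelian groups generated by invertible automata with 3 states over a 2-letter alphabet are, up to isomorphism, exactly the following 6 groups: the trivial group, C₂, C₂ × C₂, C₂ × C₂ × C₂, ℤ, and ℤ². -/
section Models

variable {M : Type} [AddCommGroup M]

/-- Action of a model group on words, from parity and section data. -/
def modelAct (par : M → Bool) (sec : M → Bool → M) : M → List Bool → List Bool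
  | _, [] => []
  | v, x :: w => xor (par v) x :: modelAct par sec (sec v x) w

theorem modelAct_add (par : M → Bool) (sec : M → Bool → M)
    (hpar : ∀ u v, par (u + v) = xor (par u) (par v))
    (hsec : ∀ u v x, sec (u + v) x = sec u (xor (par v) x) + sec v x)
    (u v : M) (w : List Bool) :
    modelAct par sec (u + v) w = modelAct par sec u (modelAct par sec v w) := by
  induction w generalizing u v with
  | nil => rfl
  | cons x w ih => simp [modelAct, hpar, hsec, ih]

theorem modelAct_zero (par : M → Bool) (sec : M → Bool → M)
    (hpar : ∀ u v, par (u + v) = xor (par u) (par v))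
    (hsec : ∀ u v x, sec (u + v) x = sec u (xor (par v) x) + sec v x)
    (w : List Bool) : modelAct par sec 0 w = w := by
  have h0 : par 0 = false := by
    have := hpar 0 0
    simpa using this
  have h1 : ∀ x, sec 0 x = 0 := by
    intro x
    have := hsec 0 0 x
    simpa [h0] using this
  induction w with
  | nil => rfl
  | cons x w ih => simp [modelAct, h0, h1, ih]

/-- The model homomorphism into the permutations of words. -/
def modelHom (par : M → Bool) (sec : M → Bool → M)
    (hpar : ∀ u v, par (u + v) = xor (par u) (par v))
    (hsec : ∀ u v x, sec (u + v) x = sec u (xor (par v) x) + sec v x) :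
    Multiplicative M →* Equiv.Perm (List Bool) where
  toFun v :=
    { toFun := modelAct par sec v.toAdd
      invFun := modelAct par sec (-v.toAdd)
      left_inv := fun w => by
        rw [← modelAct_add par sec hpar hsec, neg_add_cancel, modelAct_zero par sec hpar hsec]
      right_inv := fun w => by
        rw [← modelAct_add par sec hpar hsec, add_neg_cancel, modelAct_zero par sec hpar hsec] }
  map_one' := by
    ext1 w
    exact modelAct_zero par sec hpar hsec w
  map_mul' u v := by
    ext1 w
    exact modelAct_add par sec hpar hsec _ _ w

theorem model_faithful (par : M → Bool) (sec : M → Bool → M) (μ : M → ℕ)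
    (hμ : ∀ v, v ≠ 0 → par v = false → sec v false ≠ 0 ∧ μ (sec v false) < μ v)
    (n : ℕ) : ∀ v, μ v ≤ n → (∀ w, modelAct par sec v w = w) → v = 0 := by
  induction n with
  | zero =>
    intro v hv hw
    by_contra hne
    have hp : par v = false := by
      have := hw [false]
      simpa [modelAct] using this
    have := hμ v hne hp
    omega
  | succ n ih =>
    intro v hv hw
    by_contra hne
    have hp : par v = false := by
      have := hw [false]
      simpa [modelAct] using this
    have h := hμ v hne hp
    refine h.1 (ih _ (by omega) fun w => ?_)
    have := hw (false :: w)
    simp only [modelAct, List.cons.injEq] at this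
    exact this.2

theorem exists_model {Q : Type} (e : Q ≃ Fin 3) (par : M → Bool) (sec : M → Bool → M)
    (hpar : ∀ u v, par (u + v) = xor (par u) (par v))
    (hsec : ∀ u v x, sec (u + v) x = sec u (xor (par v) x) + sec v x)
    (μ : M → ℕ)
    (hμ : ∀ v, v ≠ 0 → par v = false → sec v false ≠ 0 ∧ μ (sec v false) < μ v)
    (st : Fin 3 → M) (t : Fin 3 → Bool → Fin 3)
    (hst : ∀ i x, st (t i x) = sec (st i) x)
    (hgen : AddSubgroup.closure (Set.range st) = ⊤) :
    ∃ A : BinAutomaton Q, Nonempty (↥A.autGroup ≃* Multiplicative M) := by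
  let A : BinAutomaton Q :=
    { trans := fun q x => e.symm (t (e q) x)
      out := fun q x => xor (par (st (e q))) x
      out_bij := fun q => by
        have h : ∀ b : Bool, Function.Bijective fun x => xor b x := by decide
        exact h _ }
  refine ⟨A, ?_⟩
  let F := modelHom par sec hpar hsec
  have hact : ∀ (w : List Bool) (q : Q), A.act q w = modelAct par sec (st (e q)) w := by
    intro w
    induction w with
    | nil => intro q; rfl
    | cons x w ih =>
      intro q
      simp only [BinAutomaton.act, modelAct, ih]
      simp [A, hst]
  have hperm : ∀ q, A.perm q = F (Multiplicative.ofAdd (st (e q))) := by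
    intro q
    ext1 w
    exact hact w q
  have hrange : A.autGroup = F.range := by
    have h1 : Set.range A.perm = F '' (Multiplicative.toAdd ⁻¹' (Set.range st)) := by
      ext g
      constructor
      · rintro ⟨q, rfl⟩
        exact ⟨Multiplicative.ofAdd (st (e q)), ⟨e q, rfl⟩, (hperm q).symm⟩
      · rintro ⟨v, ⟨i, hi⟩, rfl⟩
        refine ⟨e.symm i, ?_⟩
        rw [hperm]
        simp [hi]
    have h2 : Subgroup.closure (Multiplicative.toAdd ⁻¹' (Set.range st)) = ⊤ := by
      rw [← AddSubgroup.toSubgroup_closure, hgen]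
      rfl
    rw [BinAutomaton.autGroup, h1, ← MonoidHom.map_closure, h2, MonoidHom.range_eq_map]
  have hinj : Function.Injective F := by
    rw [injective_iff_map_eq_one]
    intro v hv
    have : v.toAdd = 0 := model_faithful par sec μ hμ _ v.toAdd le_rfl fun w => by
      have := congrArg (fun g : Equiv.Perm (List Bool) => g w) hv
      exact this
    exact this
  rw [hrange]
  exact ⟨(MonoidHom.ofInjective hinj).symm⟩

end Models

section Examples

theorem ex_trivial {Q : Type} (e : Q ≃ Fin 3) : ∃ A : BinAutomaton Q, Nonempty (↥A.autGroup ≃* PUnit) := by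
  obtain ⟨A, ⟨f⟩⟩ := exists_model (M := PUnit) e (fun _ => false) (fun _ _ => 0)
    (by simp) (by simp) (fun _ => 0) (fun v hv => absurd rfl hv) (fun _ => 0) (fun i _ => i)
    (by simp) (Subsingleton.elim _ _)
  exact ⟨A, ⟨f.trans ⟨⟨fun _ => PUnit.unit, fun _ => 1, fun _ => rfl, fun _ => rfl⟩,
    fun _ _ => rfl⟩⟩⟩

theorem ex_C2 {Q : Type} (e : Q ≃ Fin 3) : ∃ A : BinAutomaton Q, Nonempty (↥A.autGroup ≃* Multiplicative (ZMod 2)) := by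
  refine exists_model (M := ZMod 2) e (fun v => decide (v = 1)) (fun _ _ => 0)
    (by decide) (by simp) (fun _ => 0) (by decide) ![0, 1, 0] (fun _ _ => 0)
    (by decide) ?_
  rw [eq_top_iff]
  intro v _
  have h : ∀ v : ZMod 2, v ∈ Set.range ![(0 : ZMod 2), 1, 0] := by decide
  exact AddSubgroup.subset_closure (h v)

theorem ex_C2C2 {Q : Type} (e : Q ≃ Fin 3) : ∃ A : BinAutomaton Q,
    Nonempty (↥A.autGroup ≃* (Multiplicative (ZMod 2) × Multiplicative (ZMod 2))) := by
  obtain ⟨A, ⟨f⟩⟩ := exists_model (M := ZMod 2 × ZMod 2) e (fun v => decide (v.1 = 1))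
    (fun v _ => (v.2, 0))
    (by decide) (by decide) (fun v => if v.2 = 0 then 0 else 1) (by decide)
    ![0, (1, 0), (0, 1)] (fun i _ => ![0, 0, 1] i)
    (by decide) (by
      rw [eq_top_iff]
      rintro v -
      have h : v = v.1.val • ((1, 0) : ZMod 2 × ZMod 2) + v.2.val • ((0, 1) : ZMod 2 × ZMod 2) := by
        revert v; decide
      rw [h]
      exact add_mem (nsmul_mem (AddSubgroup.subset_closure (Set.mem_range.2 ⟨1, rfl⟩)) _)
        (nsmul_mem (AddSubgroup.subset_closure (Set.mem_range.2 ⟨2, rfl⟩)) _))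
  exact ⟨A, ⟨f.trans (MulEquiv.prodMultiplicative _ _)⟩⟩

theorem ex_C2C2C2 {Q : Type} (e : Q ≃ Fin 3) : ∃ A : BinAutomaton Q,
    Nonempty (↥A.autGroup ≃*
      (Multiplicative (ZMod 2) × Multiplicative (ZMod 2) × Multiplicative (ZMod 2))) := by
  obtain ⟨A, ⟨f⟩⟩ := exists_model (M := ZMod 2 × ZMod 2 × ZMod 2) e
    (fun v => decide (v.1 = 1))
    (fun v _ => (v.2.1, v.2.2, v.1))
    (by decide) (by intro u v x; rfl)
    (fun v => if v.1 = 1 then 0 else if v.2.1 = 1 then 1 else 2) (by decide)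
    ![(1, 0, 0), (0, 1, 0), (0, 0, 1)] (fun i _ => ![2, 0, 1] i)
    (by decide) (by
      rw [eq_top_iff]
      rintro v -
      have h : v = v.1.val • ((1, 0, 0) : ZMod 2 × ZMod 2 × ZMod 2)
          + v.2.1.val • ((0, 1, 0) : ZMod 2 × ZMod 2 × ZMod 2)
          + v.2.2.val • ((0, 0, 1) : ZMod 2 × ZMod 2 × ZMod 2) := by
        revert v; decide
      rw [h]
      exact add_mem (add_mem (nsmul_mem (AddSubgroup.subset_closure (Set.mem_range.2 ⟨0, rfl⟩)) _)
        (nsmul_mem (AddSubgroup.subset_closure (Set.mem_range.2 ⟨1, rfl⟩)) _))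
        (nsmul_mem (AddSubgroup.subset_closure (Set.mem_range.2 ⟨2, rfl⟩)) _))
  exact ⟨A, ⟨(f.trans (MulEquiv.prodMultiplicative _ _)).trans
    ((MulEquiv.refl _).prodCongr (MulEquiv.prodMultiplicative _ _))⟩⟩

theorem ex_Z {Q : Type} (e : Q ≃ Fin 3) : ∃ A : BinAutomaton Q, Nonempty (↥A.autGroup ≃* Multiplicative ℤ) := by
  refine exists_model (M := ℤ) e (fun v => decide (v % 2 = 1))
    (fun v x => (v + cond x 1 0) / 2)
    ?_ ?_ Int.natAbs ?_ ![0, 1, 0] (fun i x => cond x i 0) (by decide) ?_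
  · intro u v
    rcases Int.emod_two_eq_zero_or_one u with h | h <;>
    rcases Int.emod_two_eq_zero_or_one v with h' | h' <;> simp [Int.add_emod, h, h']
  · intro u v x
    rcases Int.emod_two_eq_zero_or_one u with h | h <;>
    rcases Int.emod_two_eq_zero_or_one v with h' | h' <;> cases x <;> simp [h'] <;> omega
  · intro v hv hp
    simp at hp ⊢
    omega
  · rw [eq_top_iff]
    rintro v -
    rw [show v = v • (1 : ℤ) by simp]
    exact zsmul_mem (AddSubgroup.subset_closure (Set.mem_range.2 ⟨1, rfl⟩)) _

theorem ex_ZZ {Q : Type} (e : Q ≃ Fin 3) : ∃ A : BinAutomaton Q,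
    Nonempty (↥A.autGroup ≃* (Multiplicative ℤ × Multiplicative ℤ)) := by
  obtain ⟨A, ⟨f⟩⟩ := exists_model (M := ℤ × ℤ) e (fun v => decide (v.1 % 2 = 1))
    (fun v x => if v.1 % 2 = 1 then
        (v.2 - v.1 + 1 + cond x 0 (-2), -((v.1 - 1) / 2) + cond x 1 (-2))
      else (v.2 - v.1, -(v.1 / 2)))
    (by
      rintro ⟨u, u'⟩ ⟨v, v'⟩
      rcases Int.emod_two_eq_zero_or_one u with h | h <;>
      rcases Int.emod_two_eq_zero_or_one v with h' | h' <;> simp [Int.add_emod, h, h'])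
    (by
      rintro ⟨u, u'⟩ ⟨v, v'⟩ x
      rcases Int.emod_two_eq_zero_or_one u with h | h <;>
      rcases Int.emod_two_eq_zero_or_one v with h' | h' <;> cases x <;>
      simp [h', h, Int.add_emod] <;> omega)
    (fun v => ((v.1 - v.2) ^ 2 + v.2 ^ 2).toNat)
    (by
      rintro ⟨m, n⟩ hv hp
      simp only [decide_eq_false_iff_not] at hp
      obtain ⟨k, rfl⟩ : ∃ k, m = 2 * k := ⟨m / 2, by omega⟩
      have h2 : (2 * k) / 2 = k := by omega
      simp only [hp, if_false, h2]
      simp only [ne_eq, Prod.mk_eq_zero] at hv ⊢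
      refine ⟨by omega, ?_⟩
      have h3 : 0 < (n - k) ^ 2 + k ^ 2 := by
        by_cases hk : k = 0
        · have hn : n ≠ 0 := by omega
          subst hk
          simp
          positivity
        · positivity
      have h4 : (2 * k - n) ^ 2 + n ^ 2 = 2 * ((n - k) ^ 2 + k ^ 2) := by ring
      have h5 : (n - 2 * k - -k) ^ 2 + (-k) ^ 2 = (n - k) ^ 2 + k ^ 2 := by ring
      rw [h4, h5]
      omega)
    ![(1, 0), (-2, -2), (0, 1)] (fun i x => cond x (![2, 2, 0] i) (![1, 2, 0] i))
    (by decide) (by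
      rw [eq_top_iff]
      rintro v -
      have h : v = v.1 • ((1, 0) : ℤ × ℤ) + v.2 • ((0, 1) : ℤ × ℤ) := by
        ext <;> simp
      rw [h]
      exact add_mem (zsmul_mem (AddSubgroup.subset_closure (Set.mem_range.2 ⟨0, rfl⟩)) _)
        (zsmul_mem (AddSubgroup.subset_closure (Set.mem_range.2 ⟨2, rfl⟩)) _))
  exact ⟨A, ⟨f.trans (MulEquiv.prodMultiplicative _ _)⟩⟩

end Examples

section Abstract

variable {G : Type*} [CommGroup G] (par : G → Bool) (s : G → Bool → G)

theorem abs_sec_eq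
    (hs : ∀ g h x, s (g * h) x = s g (xor (par h) x) * s h x)
    {u : G} (hu : par u = true) {g : G} (hg : par g = false) (x y : Bool) : s g x = s g y := by
  have h1 := hs g u false
  have h2 := hs u g false
  rw [mul_comm u g, h1, mul_comm] at h2
  simp only [hu, hg, Bool.xor_false] at h2
  have h3 : s g true = s g false := mul_left_cancel h2
  cases x <;> cases y <;> simp [h3]

theorem abs_dichotomy (hpar : ∀ g h, par (g * h) = xor (par g) (par h))
    (hs : ∀ g h x, s (g * h) x = s g (xor (par h) x) * s h x)
    (hf : ∀ S : Set G, (∀ g ∈ S, par g = false ∧ ∀ x, s g x ∈ S) → ∀ g ∈ S, g = 1) :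
    (∀ g : G, g ^ 2 = 1) ∨
    ((∀ (n : ℕ) (g : G), 0 < n → g ^ n = 1 → g = 1) ∧ ∃ u, par u = true) := by
  have par1 : par 1 = false := by
    have := hpar 1 1
    simpa using this
  have s1 : ∀ x, s 1 x = 1 := by
    intro x
    have := hs 1 1 x
    simpa [par1] using this
  by_cases hact : ∃ u, par u = true
  swap
  · left
    intro g
    push Not at hact
    exact hf Set.univ (fun g _ => ⟨by simpa using hact g, fun _ => trivial⟩) _ trivial
  obtain ⟨u, hu⟩ := hact
  have parpow : ∀ g, par g = false → ∀ n : ℕ, par (g ^ n) = false ∧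
      ∀ x, s (g ^ n) x = s g x ^ n := by
    intro g hg n
    induction n with
    | zero => simp [par1, s1]
    | succ n ih =>
      refine ⟨by rw [pow_succ, hpar, ih.1, hg]; rfl, fun x => ?_⟩
      rw [pow_succ, hs, pow_succ, hg, Bool.false_xor, ih.2]
  by_cases ht : ∃ t, par t = true ∧ t ^ 2 = 1
  · left
    obtain ⟨t, ht, ht2⟩ := ht
    have key : ∀ h, ∃ k, par k = false ∧ k ^ 2 = h ^ 2 := by
      intro h
      by_cases hh : par h = true
      · exact ⟨h * t, by rw [hpar, hh, ht]; rfl, by rw [mul_pow, ht2, mul_one]⟩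
      · exact ⟨h, by simpa using hh, rfl⟩
    intro g
    refine hf {x | ∃ h : G, x = h ^ 2} ?_ _ ⟨g, rfl⟩
    rintro _ ⟨h, rfl⟩
    obtain ⟨k, hk, hk2⟩ := key h
    rw [← hk2]
    exact ⟨(parpow k hk 2).1, fun x => ⟨s k x, (parpow k hk 2).2 x⟩⟩
  · right
    refine ⟨?_, u, hu⟩
    push Not at ht
    have base : ∀ n : ℕ, (∀ g, g ^ n = 1 → par g = false) → ∀ g : G, g ^ n = 1 → g = 1 := by
      intro n hn g hg
      refine hf {g | g ^ n = 1} ?_ g hg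
      intro g hg
      refine ⟨hn g hg, fun x => ?_⟩
      change s g x ^ n = 1
      rw [← (parpow g (hn g hg) n).2, show g ^ n = 1 from hg, s1]
    have two : ∀ g : G, g ^ 2 = 1 → g = 1 := by
      apply base
      intro g hg
      by_contra h
      exact ht g (by simpa using h) hg
    have odd : ∀ m : ℕ, ∀ g : G, g ^ (2 * m + 1) = 1 → g = 1 := by
      intro m
      apply base
      intro g hg
      have h2 : par (g ^ 2) = false := by rw [pow_two, hpar]; simp
      have h3 := (parpow _ h2 m).1
      have h4 := congrArg par hg
      rwa [pow_succ, pow_mul, hpar, h3, par1, Bool.false_xor] at h4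
    intro n
    induction n using Nat.strong_induction_on with
    | _ n ih =>
      intro g hn hg
      obtain ⟨m, rfl | rfl⟩ := Nat.even_or_odd' n
      · rw [mul_comm, pow_mul] at hg
        exact ih m (by omega) g (by omega) (two _ hg)
      · exact odd m g hg

theorem abs_embed (hpar : ∀ g h, par (g * h) = xor (par g) (par h))
    (hs : ∀ g h x, s (g * h) x = s g (xor (par h) x) * s h x)
    (hf : ∀ S : Set G, (∀ g ∈ S, par g = false ∧ ∀ x, s g x ∈ S) → ∀ g ∈ S, g = 1)
    (htf : ∀ (n : ℕ) (g : G), 0 < n → g ^ n = 1 → g = 1) {u : G} (hu : par u = true)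
    (f : Fin 3 → G) (hgen : Subgroup.closure (Set.range f) = ⊤)
    (hfs : ∀ i x, s (f i) x ∈ Set.range f) :
    ∃ ψ : G →* G, Function.Injective ψ ∧
      ∀ g, ψ g ∈ Subgroup.closure {f 1 * (f 0)⁻¹, f 2 * (f 0)⁻¹} := by
  have hsq : ∀ g, par (g ^ 2) = false := fun g => by rw [pow_two, hpar]; simp
  let ψ : G →* G := MonoidHom.mk' (fun g => s (g ^ 2) false * (g ^ 2)⁻¹) (by
    intro a b
    rw [mul_pow, hs, hsq, Bool.false_xor, mul_inv, mul_mul_mul_comm])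
  refine ⟨ψ, ?_, ?_⟩
  · rw [injective_iff_map_eq_one]
    intro g hg
    have h1 : s (g ^ 2) false = g ^ 2 := mul_inv_eq_one.1 hg
    refine htf 2 g (by norm_num) (hf {g ^ 2} ?_ _ rfl)
    rintro _ rfl
    exact ⟨hsq g, fun x => by
      rw [abs_sec_eq par s hs hu (hsq g) x false, h1]; rfl⟩
  · set D := Subgroup.closure {f 1 * (f 0)⁻¹, f 2 * (f 0)⁻¹} with hD
    have h0 : ∀ i, f i * (f 0)⁻¹ ∈ D := by
      intro i
      fin_cases i
      · simp
      · exact Subgroup.subset_closure (by simp)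
      · exact Subgroup.subset_closure (by simp)
    have hij : ∀ i j, f i * (f j)⁻¹ ∈ D := by
      intro i j
      have := mul_mem (h0 i) (inv_mem (h0 j))
      simpa using this
    have htop : Subgroup.closure (Set.range f) ≤ D.comap ψ := by
      rw [Subgroup.closure_le]
      rintro _ ⟨i, rfl⟩
      change s (f i ^ 2) false * (f i ^ 2)⁻¹ ∈ D
      rw [pow_two, hs, mul_inv, mul_mul_mul_comm]
      obtain ⟨j, hj⟩ := hfs i (xor (par (f i)) false)
      obtain ⟨k, hk⟩ := hfs i false
      rw [← hj, ← hk]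
      exact mul_mem (hij _ _) (hij _ _)
    intro g
    exact htop (by rw [hgen]; trivial)

theorem abs_span (R : Type*) [Ring R] [Module R (Additive G)] (S : Set G) (g : G)
    (hg : g ∈ Subgroup.closure S) :
    Additive.ofMul g ∈ Submodule.span R (Additive.toMul ⁻¹' S) := by
  induction hg using Subgroup.closure_induction with
  | mem g h => exact Submodule.subset_span h
  | one => exact zero_mem _
  | mul x y _ _ hx hy => exact add_mem hx hy
  | inv x _ hx => exact neg_mem hx

/-- Passing from an additive coordinate isomorphism to a multiplicative one. -/
def coordEquiv {R : Type} [AddCommGroup R] (e : Additive G ≃+ R) : G ≃* Multiplicative R where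
  toFun g := Multiplicative.ofAdd (e (Additive.ofMul g))
  invFun r := (e.symm r.toAdd).toMul
  left_inv g := by simp
  right_inv r := by simp
  map_mul' g h := by simp

theorem equiv_zero {R : Type} [AddCommGroup R] (e : Additive G ≃+ (Fin 0 → R)) :
    Nonempty (G ≃* PUnit) := by
  have : Subsingleton (Multiplicative (Fin 0 → R)) :=
    inferInstanceAs (Subsingleton (Fin 0 → R))
  have : Subsingleton G := (coordEquiv e).toEquiv.subsingleton
  exact ⟨⟨⟨fun _ => PUnit.unit, fun _ => 1, fun _ => Subsingleton.elim _ _,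
    fun _ => rfl⟩, fun _ _ => rfl⟩⟩

theorem equiv_one {R : Type} [AddCommGroup R] (e : Additive G ≃+ (Fin 1 → R)) :
    Nonempty (G ≃* Multiplicative R) :=
  ⟨coordEquiv (e.trans ⟨⟨fun v => v 0, fun r => ![r],
    fun v => by ext i; fin_cases i; rfl, fun _ => rfl⟩, fun _ _ => rfl⟩)⟩

theorem equiv_two {R : Type} [AddCommGroup R] (e : Additive G ≃+ (Fin 2 → R)) :
    Nonempty (G ≃* (Multiplicative R × Multiplicative R)) :=
  ⟨(coordEquiv (R := R × R) (e.trans ⟨⟨fun v => (v 0, v 1), fun r => ![r.1, r.2],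
    fun v => by ext i; fin_cases i <;> rfl, fun _ => rfl⟩, fun _ _ => rfl⟩)).trans
    (MulEquiv.prodMultiplicative _ _)⟩

theorem equiv_three {R : Type} [AddCommGroup R] (e : Additive G ≃+ (Fin 3 → R)) :
    Nonempty (G ≃* (Multiplicative R × Multiplicative R × Multiplicative R)) :=
  ⟨((coordEquiv (R := R × R × R) (e.trans ⟨⟨fun v => (v 0, v 1, v 2),
    fun r => ![r.1, r.2.1, r.2.2],
    fun v => by ext i; fin_cases i <;> rfl, fun _ => rfl⟩, fun _ _ => rfl⟩)).trans
    (MulEquiv.prodMultiplicative _ _)).trans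
    ((MulEquiv.refl _).prodCongr (MulEquiv.prodMultiplicative _ _))⟩

theorem abs_span_top (R : Type*) [Ring R] [Module R (Additive G)]
    (f : Fin 3 → G) (hgen : Subgroup.closure (Set.range f) = ⊤) :
    Submodule.span R (Set.range fun i => Additive.ofMul (f i)) = ⊤ := by
  rw [eq_top_iff]
  rintro x -
  exact abs_span R (Set.range f) x.toMul (by rw [hgen]; trivial)

theorem abs_free (htf : ∀ (n : ℕ) (g : G), 0 < n → g ^ n = 1 → g = 1)
    (f : Fin 3 → G) (hgen : Subgroup.closure (Set.range f) = ⊤) (a b : G)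
    (ψ : G →* G) (hinj : Function.Injective ψ) (hψ : ∀ g, ψ g ∈ Subgroup.closure {a, b}) :
    Nonempty (G ≃* PUnit) ∨ Nonempty (G ≃* Multiplicative ℤ) ∨
      Nonempty (G ≃* (Multiplicative ℤ × Multiplicative ℤ)) := by
  have : Module.Finite ℤ (Additive G) := by
    refine ⟨Submodule.fg_def.2 ⟨_, Set.finite_range _, abs_span_top ℤ f hgen⟩⟩
  have : IsMulTorsionFree G := by
    refine ⟨fun n hn x y hxy => ?_⟩
    have h : (x / y) ^ n = 1 := by rw [div_pow, div_eq_one]; exact hxy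
    exact div_eq_one.1 (htf n _ (Nat.pos_of_ne_zero hn) h)
  have : Module.IsTorsionFree ℤ (Additive G) := inferInstance
  have : Module.Free ℤ (Additive G) := inferInstance
  have hle : Module.finrank ℤ (Additive G) ≤ 2 := by
    let v : Fin 2 → Additive G := ![Additive.ofMul a, Additive.ofMul b]
    have hmem : ∀ x, (MonoidHom.toAdditive ψ).toIntLinearMap x ∈
        Submodule.span ℤ (Set.range v) := by
      intro x
      refine Submodule.span_mono ?_ (abs_span ℤ {a, b} _ (hψ x.toMul))
      rintro y (hy | hy)
      · exact ⟨0, hy.symm⟩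
      · exact ⟨1, hy.symm⟩
    let L : Additive G →ₗ[ℤ] Submodule.span ℤ (Set.range v) :=
      (MonoidHom.toAdditive ψ).toIntLinearMap.codRestrict _ hmem
    have hL : Function.Injective L := fun x y h => hinj (congrArg Subtype.val h)
    have : Module.Finite ℤ (Submodule.span ℤ (Set.range v)) :=
      Module.Finite.span_of_finite ℤ (Set.finite_range v)
    refine (LinearMap.finrank_le_finrank_of_injective hL).trans ?_
    exact (finrank_range_le_card (R := ℤ) v).trans (by simp)
  obtain ⟨k, hk⟩ : ∃ k, k = Module.finrank ℤ (Additive G) := ⟨_, rfl⟩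
  have hk' : Module.finrank ℤ (Additive G) = Module.finrank ℤ (Fin k → ℤ) := by
    rw [Module.finrank_fin_fun, hk]
  have E : Additive G ≃+ (Fin k → ℤ) :=
    (LinearEquiv.ofFinrankEq (Additive G) (Fin k → ℤ) hk').toAddEquiv
  rw [← hk] at hle
  interval_cases k
  · exact Or.inl (equiv_zero E)
  · exact Or.inr (Or.inl (equiv_one E))
  · exact Or.inr (Or.inr (equiv_two E))

theorem abs_exp_two (h2 : ∀ g : G, g ^ 2 = 1)
    (f : Fin 3 → G) (hgen : Subgroup.closure (Set.range f) = ⊤) :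
    Nonempty (G ≃* PUnit) ∨ Nonempty (G ≃* Multiplicative (ZMod 2)) ∨
      Nonempty (G ≃* (Multiplicative (ZMod 2) × Multiplicative (ZMod 2))) ∨
      Nonempty (G ≃*
        (Multiplicative (ZMod 2) × Multiplicative (ZMod 2) × Multiplicative (ZMod 2))) := by
  have : Fact (Nat.Prime 2) := ⟨Nat.prime_two⟩
  letI : Module (ZMod 2) (Additive G) :=
    AddCommGroup.zmodModule (n := 2) (fun x => h2 x.toMul)
  have : Module.Finite (ZMod 2) (Additive G) := by
    refine ⟨Submodule.fg_def.2 ⟨_, Set.finite_range _, abs_span_top (ZMod 2) f hgen⟩⟩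
  have hle : Module.finrank (ZMod 2) (Additive G) ≤ 3 := by
    have h := finrank_range_le_card (R := ZMod 2) (fun i => Additive.ofMul (f i))
    rw [Set.finrank, abs_span_top (ZMod 2) f hgen, finrank_top] at h
    simpa using h
  obtain ⟨k, hk⟩ : ∃ k, k = Module.finrank (ZMod 2) (Additive G) := ⟨_, rfl⟩
  have hk' : Module.finrank (ZMod 2) (Additive G) = Module.finrank (ZMod 2) (Fin k → ZMod 2) := by
    rw [Module.finrank_fin_fun, hk]
  have E : Additive G ≃+ (Fin k → ZMod 2) :=
    (LinearEquiv.ofFinrankEq (Additive G) (Fin k → ZMod 2) hk').toAddEquiv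
  rw [← hk] at hle
  interval_cases k
  · exact Or.inl (equiv_zero E)
  · exact Or.inr (Or.inl (equiv_one E))
  · exact Or.inr (Or.inr (Or.inl (equiv_two E)))
  · exact Or.inr (Or.inr (Or.inr (equiv_three E)))

end Abstract

theorem autGroup_sections {Q : Type} (A : BinAutomaton Q) (g : Equiv.Perm (List Bool))
    (hg : g ∈ A.autGroup) : g [] = [] ∧ ∃ (b : Bool) (s : Bool → Equiv.Perm (List Bool)),
      (∀ x, s x ∈ A.autGroup) ∧ ∀ x w, g (x :: w) = xor b x :: s x w := by
  unfold BinAutomaton.autGroup at hg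
  induction hg using Subgroup.closure_induction with
  | mem g h =>
    obtain ⟨q, rfl⟩ := h
    refine ⟨rfl, A.out q false, fun x => A.perm (A.trans q x),
      fun x => Subgroup.subset_closure ⟨_, rfl⟩, fun x w => ?_⟩
    have h1 : A.out q x = xor (A.out q false) x := by
      have hne : A.out q false ≠ A.out q true := fun h => by
        simpa using (A.out_bij q).1 h
      cases x
      · simp
      · revert hne
        cases A.out q false <;> cases A.out q true <;> simp
    change A.out q x :: A.act (A.trans q x) w = _
    rw [h1]
    rfl
  | one => exact ⟨rfl, false, fun _ => 1, fun _ => one_mem _, fun x w => by simp⟩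
  | mul g h _ _ ihg ihh =>
    obtain ⟨g0, b, s, hs, hgs⟩ := ihg
    obtain ⟨h0, c, t, ht, hht⟩ := ihh
    refine ⟨by simp [g0, h0], xor b c, fun x => s (xor c x) * t x,
      fun x => mul_mem (hs _) (ht _), fun x w => ?_⟩
    simp [hgs, hht]
  | inv g _ ihg =>
    obtain ⟨g0, b, s, hs, hgs⟩ := ihg
    refine ⟨by rw [Equiv.Perm.inv_eq_iff_eq, g0], b, fun x => (s (xor b x))⁻¹,
      fun x => inv_mem (hs _), fun x w => ?_⟩
    rw [Equiv.Perm.inv_eq_iff_eq, hgs]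
    simp

theorem classify {Q : Type} (e : Q ≃ Fin 3) (A : BinAutomaton Q)
    (hcomm : ∀ g ∈ A.autGroup, ∀ h ∈ A.autGroup, g * h = h * g) :
    (Nonempty (↥A.autGroup ≃* PUnit) ∨
       Nonempty (↥A.autGroup ≃* Multiplicative (ZMod 2)) ∨
       Nonempty (↥A.autGroup ≃* (Multiplicative (ZMod 2) × Multiplicative (ZMod 2))) ∨
       Nonempty (↥A.autGroup ≃*
         (Multiplicative (ZMod 2) × Multiplicative (ZMod 2) × Multiplicative (ZMod 2))) ∨
       Nonempty (↥A.autGroup ≃* Multiplicative ℤ) ∨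
       Nonempty (↥A.autGroup ≃* (Multiplicative ℤ × Multiplicative ℤ))) := by
  letI : CommGroup A.autGroup :=
    { (inferInstance : Group A.autGroup) with
      mul_comm := fun g h => Subtype.ext (hcomm g g.2 h h.2) }
  have H : ∀ g : A.autGroup, ∃ (b : Bool) (s : Bool → A.autGroup),
      ∀ x w, g.1 (x :: w) = xor b x :: (s x).1 w := by
    intro g
    obtain ⟨-, b, s, hs, h⟩ := autGroup_sections A g.1 g.2
    exact ⟨b, fun x => ⟨s x, hs x⟩, h⟩
  choose par s hps using H
  have uniq : ∀ (g : A.autGroup) (b : Bool) (t : Bool → A.autGroup),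
      (∀ x w, g.1 (x :: w) = xor b x :: (t x).1 w) → par g = b ∧ ∀ x, s g x = t x := by
    intro g b t h
    have h1 : ∀ x w, xor (par g) x = xor b x ∧ (s g x).1 w = (t x).1 w := by
      intro x w
      have := (hps g x w).symm.trans (h x w)
      simpa only [List.cons.injEq] using this
    refine ⟨by simpa using (h1 false []).1, fun x => Subtype.ext (Equiv.ext fun w => (h1 x w).2)⟩
  have hmul : ∀ g h : A.autGroup, par (g * h) = xor (par g) (par h) ∧
      ∀ x, s (g * h) x = s g (xor (par h) x) * s h x := by
    intro g h
    refine uniq (g * h) _ (fun x => s g (xor (par h) x) * s h x) fun x w => ?_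
    change g.1 (h.1 (x :: w)) = _ :: (s g _).1 ((s h x).1 w)
    rw [hps, hps, Bool.xor_assoc]
  have hpar := fun g h => (hmul g h).1
  have hs := fun g h => (hmul g h).2
  have hf : ∀ S : Set A.autGroup, (∀ g ∈ S, par g = false ∧ ∀ x, s g x ∈ S) →
      ∀ g ∈ S, g = 1 := by
    intro S hS
    have : ∀ (w : List Bool), ∀ g ∈ S, g.1 w = w := by
      intro w
      induction w with
      | nil => exact fun g _ => (autGroup_sections A g.1 g.2).1
      | cons x w ih =>
        intro g hg
        rw [hps, (hS g hg).1, ih _ ((hS g hg).2 x), Bool.false_xor]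
    exact fun g hg => Subtype.ext (Equiv.ext fun w => this w g hg)
  let p : Q → A.autGroup := fun q => ⟨A.perm q, Subgroup.subset_closure ⟨q, rfl⟩⟩
  let f : Fin 3 → A.autGroup := fun i => p (e.symm i)
  have hfr : Set.range f = Set.range p := e.symm.surjective.range_comp p
  have hgen : Subgroup.closure (Set.range f) = ⊤ := by
    rw [hfr]
    have h1 : Set.range p = ((↑) : A.autGroup → Equiv.Perm (List Bool)) ⁻¹' Set.range A.perm := by
      ext g
      constructor
      · rintro ⟨q, rfl⟩
        exact ⟨q, rfl⟩
      · rintro ⟨q, hq⟩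
        exact ⟨q, Subtype.ext hq⟩
    rw [h1]
    exact Subgroup.closure_closure_coe_preimage
  have hfs : ∀ i x, s (f i) x ∈ Set.range f := by
    intro i x
    have h1 : A.out (e.symm i) false ≠ A.out (e.symm i) true := fun h => by
      simpa using (A.out_bij _).1 h
    have h2 := (uniq (f i) (A.out (e.symm i) false) (fun x => p (A.trans (e.symm i) x)) (by
      intro x w
      change A.out (e.symm i) x :: A.act (A.trans (e.symm i) x) w = _ :: A.act _ w
      congr 1
      cases x
      · simp
      · revert h1
        cases A.out (e.symm i) false <;> cases A.out (e.symm i) true <;> simp)).2 x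
    rw [h2, hfr]
    exact ⟨_, rfl⟩
  rcases abs_dichotomy par s hpar hs hf with h2 | ⟨htf, u, hu⟩
  · have := abs_exp_two h2 f hgen
    tauto
  · obtain ⟨ψ, hinj, hψ⟩ := abs_embed par s hpar hs hf htf hu f hgen hfs
    have := abs_free htf f hgen _ _ ψ hinj hψ
    tauto

/-- Classification of the abelian groups generated by invertible automata with
3 states over a 2-letter alphabet: up to isomorphism they are exactly the
trivial group, `C₂`, `C₂ × C₂`, `C₂ × C₂ × C₂`, `ℤ`, and `ℤ²`. -/
theorem classification_abelian_three_state_automaton_groups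
    (Q : Type) [Fintype Q] (hQ : Fintype.card Q = 3) :
    (∀ A : BinAutomaton Q,
      (∀ g ∈ A.autGroup, ∀ h ∈ A.autGroup, g * h = h * g) →
      (Nonempty (↥A.autGroup ≃* PUnit) ∨
       Nonempty (↥A.autGroup ≃* Multiplicative (ZMod 2)) ∨
       Nonempty (↥A.autGroup ≃* (Multiplicative (ZMod 2) × Multiplicative (ZMod 2))) ∨
       Nonempty (↥A.autGroup ≃*
         (Multiplicative (ZMod 2) × Multiplicative (ZMod 2) × Multiplicative (ZMod 2))) ∨
       Nonempty (↥A.autGroup ≃* Multiplicative ℤ) ∨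
       Nonempty (↥A.autGroup ≃* (Multiplicative ℤ × Multiplicative ℤ)))) ∧
    (∃ A : BinAutomaton Q, Nonempty (↥A.autGroup ≃* PUnit)) ∧
    (∃ A : BinAutomaton Q, Nonempty (↥A.autGroup ≃* Multiplicative (ZMod 2))) ∧
    (∃ A : BinAutomaton Q,
      Nonempty (↥A.autGroup ≃* (Multiplicative (ZMod 2) × Multiplicative (ZMod 2)))) ∧
    (∃ A : BinAutomaton Q, Nonempty (↥A.autGroup ≃*
      (Multiplicative (ZMod 2) × Multiplicative (ZMod 2) × Multiplicative (ZMod 2)))) ∧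
    (∃ A : BinAutomaton Q, Nonempty (↥A.autGroup ≃* Multiplicative ℤ)) ∧
    (∃ A : BinAutomaton Q,
      Nonempty (↥A.autGroup ≃* (Multiplicative ℤ × Multiplicative ℤ))) := by
  have e : Q ≃ Fin 3 := Fintype.equivFinOfCardEq hQ
  exact ⟨fun A hA => classify e A hA, ex_trivial e, ex_C2 e, ex_C2C2 e, ex_C2C2C2 e, ex_Z e,
    ex_ZZ e⟩
end
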